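/- Let n ≥ 1 and let K ⊂ ℂⁿ be a compact set. Then K is convex with respect to principal hypersurfaces if and only if for every open set U ⊇ K there exist an open set Ω, an open set W with closure(Ω) ⊆ W, and a smooth strictly plurisubharmonic function ρ : W → ℝ such that K ⊆ Ω ⊆ U, the closure of Ω is compact, Ω = {z ∈ W : ρ(z) < 0}, and there exists a smooth strictly plurisubharmonic function ψ : ℂⁿ → ℝ such that ψ − ρ is pluriharmonic on an open neighborhood of closure(Ω) contained in W. -/

import Mathlib

open Complex MeasureTheory

/-- The Levi quadratic form of a real-valued function on ℂⁿ:
`H_φ(x)(w) = D²φ(x)(w,w) + D²φ(x)(iw,iw)`. -/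
noncomputable def leviForm {n : ℕ} (φ : EuclideanSpace ℂ (Fin n) → ℝ)
    (x w : EuclideanSpace ℂ (Fin n)) : ℝ :=
  iteratedFDeriv ℝ 2 φ x ![w, w] +
    iteratedFDeriv ℝ 2 φ x ![Complex.I • w, Complex.I • w]

/-- A compact set `K ⊆ ℂⁿ` is convex with respect to principal hypersurfaces if every point
outside `K` is separated from `K` by the zero set of an entire function. -/
def PrincipalConvex {n : ℕ} (K : Set (EuclideanSpace ℂ (Fin n))) : Prop :=
  ∀ a ∉ K, ∃ f : EuclideanSpace ℂ (Fin n) → ℂ,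
    Differentiable ℂ f ∧ f a = 0 ∧ ∀ z ∈ K, f z ≠ 0

section

open Set Filter Topology ComplexConjugate
open scoped ContDiff InnerProductSpace

/-- Complex `n`-space with its Euclidean norm. -/
abbrev CSpace (n : ℕ) := EuclideanSpace ℂ (Fin n)

/-- The Wirtinger-type derivative `(D_w f + a D_{iw} f) / 2`. For `a = i` it is the `∂̄`-derivative
and for `a = -i` the `∂`-derivative in the direction `w`. -/
noncomputable def wirt {n : ℕ} (a : ℂ) (w : CSpace n) (f : CSpace n → ℂ) (x : CSpace n) : ℂ :=
  (fderiv ℝ f x w + a * fderiv ℝ f x (I • w)) / 2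

/-- Smooth compactly supported functions. -/
def IsTest {n : ℕ} (f : CSpace n → ℂ) : Prop :=
  ContDiff ℝ ∞ f ∧ HasCompactSupport f

section Wirtinger

variable {n : ℕ} {a : ℂ} {w : CSpace n} {f g : CSpace n → ℂ} {x : CSpace n}

theorem wirt_add (hf : DifferentiableAt ℝ f x) (hg : DifferentiableAt ℝ g x) :
    wirt a w (fun y => f y + g y) x = wirt a w f x + wirt a w g x := by
  simp only [wirt, fderiv_fun_add hf hg, add_apply]; ring

theorem wirt_sub (hf : DifferentiableAt ℝ f x) (hg : DifferentiableAt ℝ g x) :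
    wirt a w (fun y => f y - g y) x = wirt a w f x - wirt a w g x := by
  simp only [wirt, fderiv_fun_sub hf hg, sub_apply]; ring

theorem wirt_sum {ι : Type*} (s : Finset ι) {f : ι → CSpace n → ℂ}
    (hf : ∀ i ∈ s, DifferentiableAt ℝ (f i) x) :
    wirt a w (fun y => ∑ i ∈ s, f i y) x = ∑ i ∈ s, wirt a w (f i) x := by
  simp only [wirt, fderiv_fun_sum hf, sum_apply, Finset.mul_sum,
    ← Finset.sum_add_distrib, Finset.sum_div]

theorem wirt_mul (hf : DifferentiableAt ℝ f x) (hg : DifferentiableAt ℝ g x) :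
    wirt a w (fun y => f y * g y) x = wirt a w f x * g x + f x * wirt a w g x := by
  simp only [wirt, fderiv_fun_mul hf hg, add_apply, smul_apply, smul_eq_mul]
  ring

theorem wirt_const (c : ℂ) : wirt a w (fun _ => c) x = 0 := by
  simp [wirt]

theorem wirt_const_mul (c : ℂ) (hf : DifferentiableAt ℝ f x) :
    wirt a w (fun y => c * f y) x = c * wirt a w f x := by
  rw [wirt_mul (differentiableAt_const c) hf, wirt_const]; ring

theorem wirt_congr (h : f =ᶠ[𝓝 x] g) : wirt a w f x = wirt a w g x := by
  simp only [wirt, h.fderiv_eq]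

theorem wirt_exp (hf : DifferentiableAt ℝ f x) :
    wirt a w (fun y => cexp (f y)) x = cexp (f x) * wirt a w f x := by
  simp only [wirt, hf.hasFDerivAt.cexp.fderiv, smul_apply, smul_eq_mul]
  ring

theorem fderiv_conj (v : CSpace n) :
    fderiv ℝ (fun y => conj (f y)) x v = conj (fderiv ℝ f x v) := by
  have : (fun y => conj (f y)) = (Complex.conjCLE : ℂ → ℂ) ∘ f := rfl
  rw [this, Complex.conjCLE.comp_fderiv]
  simp

theorem conj_wirt : conj (wirt a w f x) = wirt (conj a) w (fun y => conj (f y)) x := by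
  simp only [wirt, fderiv_conj, map_div₀, map_add, map_mul, Complex.conj_ofNat]

theorem ContDiff.wirt (hf : ContDiff ℝ ∞ f) : ContDiff ℝ ∞ (wirt a w f) := by
  have h (v : CSpace n) : ContDiff ℝ ∞ fun x => fderiv ℝ f x v :=
    (hf.fderiv_right (m := ∞) (by simp)).clm_apply contDiff_const
  unfold _root_.wirt
  simp only [div_eq_mul_inv]
  exact ((h w).add (contDiff_const.mul (h _))).mul contDiff_const

theorem HasCompactSupport.wirt (hf : HasCompactSupport f) : HasCompactSupport (wirt a w f) := by
  refine (hf.fderiv (𝕜 := ℝ)).mono fun x hx => ?_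
  contrapose! hx
  simp only [Function.mem_support, not_not] at hx ⊢
  simp [_root_.wirt, hx]

/-- A pure second derivative, used to compare mixed Wirtinger derivatives. -/
theorem fderiv_wirt (hf : ContDiff ℝ ∞ f) (v : CSpace n) :
    fderiv ℝ (wirt a w f) x v =
      (fderiv ℝ (fderiv ℝ f) x v w + a * fderiv ℝ (fderiv ℝ f) x v (I • w)) / 2 := by
  have hd : DifferentiableAt ℝ (fderiv ℝ f) x :=
    ((hf.fderiv_right (m := 1) (by norm_cast)).differentiable (by norm_num)) x
  have h (u : CSpace n) : HasFDerivAt (fun x => fderiv ℝ f x u)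
      ((fderiv ℝ (fderiv ℝ f) x).flip u) x := by
    simpa using hd.hasFDerivAt.clm_apply (hasFDerivAt_const u x)
  have h2 : HasFDerivAt (wirt a w f) _ x :=
    ((h w).add ((h (I • w)).const_mul a)).mul_const (2⁻¹ : ℂ)
  rw [h2.fderiv]
  simp
  ring

theorem fderiv_fderiv_symm (hf : ContDiff ℝ ∞ f) (u v : CSpace n) :
    fderiv ℝ (fderiv ℝ f) x u v = fderiv ℝ (fderiv ℝ f) x v u :=
  (hf.contDiffAt.isSymmSndFDerivAt
    (by simpa using (WithTop.coe_le_coe.2 le_top : ((2 : ℕ∞) : WithTop ℕ∞) ≤ ∞))) u v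

theorem wirt_wirt_comm {b : ℂ} {v : CSpace n} (hf : ContDiff ℝ ∞ f) :
    wirt a w (wirt b v f) x = wirt b v (wirt a w f) x := by
  conv_lhs => unfold wirt
  conv_rhs => unfold wirt
  change (fderiv ℝ (wirt b v f) x w + a * fderiv ℝ (wirt b v f) x (I • w)) / 2 =
    (fderiv ℝ (wirt a w f) x v + b * fderiv ℝ (wirt a w f) x (I • v)) / 2
  simp only [fderiv_wirt hf]
  rw [fderiv_fderiv_symm hf w v, fderiv_fderiv_symm hf w (I • v),
    fderiv_fderiv_symm hf (I • w) v, fderiv_fderiv_symm hf (I • w) (I • v)]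
  ring

end Wirtinger

namespace IsTest

variable {n : ℕ} {a : ℂ} {w : CSpace n} {f g : CSpace n → ℂ}

theorem wirt (hf : IsTest f) : IsTest (wirt a w f) := ⟨hf.1.wirt, hf.2.wirt⟩

theorem mul_left (hg : ContDiff ℝ ∞ g) (hf : IsTest f) : IsTest (fun x => g x * f x) :=
  ⟨hg.mul hf.1, hf.2.mul_left⟩

theorem add (hf : IsTest f) (hg : IsTest g) : IsTest (fun x => f x + g x) :=
  ⟨hf.1.add hg.1, hf.2.add hg.2⟩

theorem neg (hf : IsTest f) : IsTest (fun x => - f x) :=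
  ⟨hf.1.neg, hf.2.neg⟩

theorem sub (hf : IsTest f) (hg : IsTest g) : IsTest (fun x => f x - g x) := by
  simpa only [sub_eq_add_neg] using hf.add hg.neg

theorem conjugate (hf : IsTest f) : IsTest (fun x => conj (f x)) :=
  ⟨Complex.conjCLE.contDiff.comp hf.1, hf.2.comp_left (map_zero _)⟩

theorem sum {ι : Type*} (s : Finset ι) {f : ι → CSpace n → ℂ} (hf : ∀ i ∈ s, IsTest (f i)) :
    IsTest (fun x => ∑ i ∈ s, f i x) := by
  classical
  induction s using Finset.induction_on with
  | empty => exact ⟨by simpa using contDiff_const, by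
      simp only [Finset.sum_empty]; exact HasCompactSupport.zero⟩
  | insert i s hi ih =>
    simp only [Finset.sum_insert hi]
    exact (hf i (by simp)).add (ih fun j hj => hf j (by simp [hj]))

theorem differentiable (hf : IsTest f) : Differentiable ℝ f := hf.1.differentiable (by simp)

theorem continuous (hf : IsTest f) : Continuous f := hf.1.continuous

theorem integrable (hf : IsTest f) : Integrable f :=
  hf.continuous.integrable_of_hasCompactSupport hf.2

theorem memLp (hf : IsTest f) : MemLp f 2 :=
  hf.continuous.memLp_of_hasCompactSupport hf.2

end IsTest

section Twisted

variable {n : ℕ} {a : ℂ} {w v : CSpace n} {f g : CSpace n → ℂ}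

theorem integral_wirt_mul (hf : ContDiff ℝ ∞ f) (hg : IsTest g) :
    ∫ x, wirt a w f x * g x = -∫ x, f x * wirt a w g x := by
  have hd (h : CSpace n → ℂ) (hh : ContDiff ℝ ∞ h) (u : CSpace n) :
      Continuous fun x => fderiv ℝ h x u :=
    ((hh.continuous_fderiv (by simp)).clm_apply continuous_const)
  have hgs (u : CSpace n) : HasCompactSupport fun x => fderiv ℝ g x u :=
    hg.2.fderiv_apply (𝕜 := ℝ) u
  have i1 (u : CSpace n) : Integrable fun x => fderiv ℝ f x u * g x :=
    ((hd f hf u).mul hg.continuous).integrable_of_hasCompactSupport hg.2.mul_left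
  have i2 (u : CSpace n) : Integrable fun x => f x * fderiv ℝ g x u :=
    (hf.continuous.mul (hd g hg.1 u)).integrable_of_hasCompactSupport (hgs u).mul_left
  have i3 : Integrable fun x => f x * g x :=
    (hf.continuous.mul hg.continuous).integrable_of_hasCompactSupport hg.2.mul_left
  have key (u : CSpace n) : ∫ x, fderiv ℝ f x u * g x = -∫ x, f x * fderiv ℝ g x u := by
    rw [integral_mul_fderiv_eq_neg_fderiv_mul_of_integrable (i1 u) (i2 u) i3
      (fun x _ => hf.differentiable (by simp) x) (fun x _ => hg.differentiable x), neg_neg]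
  have e1 : ∀ x, wirt a w f x * g x =
      (fderiv ℝ f x w * g x + a * (fderiv ℝ f x (I • w) * g x)) / 2 := by
    intro x; simp only [wirt]; ring
  have e2 : ∀ x, f x * wirt a w g x =
      (f x * fderiv ℝ g x w + a * (f x * fderiv ℝ g x (I • w))) / 2 := by
    intro x; simp only [wirt]; ring
  simp only [e1, e2, integral_div]
  rw [integral_add (i1 w) ((i1 _).const_mul a), integral_add (i2 w) ((i2 _).const_mul a),
    integral_const_mul, integral_const_mul, key, key]
  ring

/-- The derivative `∂̄_w + (∂̄_w φ) / 2`, which is `e^{-φ/2} ∘ ∂̄_w ∘ e^{φ/2}`. -/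
noncomputable def dbarW (φ : CSpace n → ℝ) (w : CSpace n) (f : CSpace n → ℂ) (x : CSpace n) : ℂ :=
  wirt I w f x + wirt I w (fun y => (φ y : ℂ)) x / 2 * f x

/-- The derivative `∂_w - (∂_w φ) / 2`, minus the formal adjoint of `dbarW`. -/
noncomputable def delW (φ : CSpace n → ℝ) (w : CSpace n) (f : CSpace n → ℂ) (x : CSpace n) : ℂ :=
  wirt (-I) w f x - wirt (-I) w (fun y => (φ y : ℂ)) x / 2 * f x

variable {φ : CSpace n → ℝ}

theorem ContDiff.ofReal_comp {m : WithTop ℕ∞} (hφ : ContDiff ℝ m φ) :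
    ContDiff ℝ m (fun y => (φ y : ℂ)) :=
  Complex.ofRealCLM.contDiff.comp hφ

theorem ContDiff.dbarW (hφ : ContDiff ℝ ∞ φ) (hf : ContDiff ℝ ∞ f) :
    ContDiff ℝ ∞ (dbarW φ w f) := by
  unfold _root_.dbarW
  simp only [div_eq_mul_inv]
  exact (ContDiff.wirt hf).add
    (((ContDiff.wirt hφ.ofReal_comp).mul contDiff_const).mul hf)

theorem IsTest.dbarW (hφ : ContDiff ℝ ∞ φ) (hf : IsTest f) : IsTest (dbarW φ w f) :=
  ⟨ContDiff.dbarW hφ hf.1, by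
    refine HasCompactSupport.add hf.wirt.2 (HasCompactSupport.mul_left hf.2)⟩

theorem IsTest.delW (hφ : ContDiff ℝ ∞ φ) (hf : IsTest f) : IsTest (delW φ w f) := by
  unfold _root_.delW
  refine hf.wirt.sub (IsTest.mul_left ?_ hf)
  simp only [div_eq_mul_inv]
  exact (ContDiff.wirt hφ.ofReal_comp).mul contDiff_const

theorem conj_delW (x : CSpace n) : conj (delW φ w f x) =
    wirt I w (fun y => conj (f y)) x - wirt I w (fun y => (φ y : ℂ)) x / 2 * conj (f x) := by
  simp only [delW, map_sub, map_mul, map_div₀, conj_wirt, map_neg, conj_I, neg_neg, conj_ofReal,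
    Complex.conj_ofNat]

/-- Integration by parts: `-delW` is the formal adjoint of `dbarW`. -/
theorem integral_dbarW_mul_conj (hφ : ContDiff ℝ ∞ φ) (hf : ContDiff ℝ ∞ f) (hg : IsTest g) :
    ∫ x, dbarW φ w f x * conj (g x) = -∫ x, f x * conj (delW φ w g x) := by
  have hφ' := hφ.ofReal_comp
  have h1 : Integrable fun x => wirt I w f x * conj (g x) :=
    (IsTest.mul_left (ContDiff.wirt hf) hg.conjugate).integrable
  have h2 : Integrable fun x => wirt I w (fun y => (φ y : ℂ)) x / 2 * f x * conj (g x) := by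
    refine (IsTest.mul_left ?_ hg.conjugate).integrable
    simp only [div_eq_mul_inv]
    exact ((ContDiff.wirt hφ').mul contDiff_const).mul hf
  have h3 : Integrable fun x => f x * wirt I w (fun y => conj (g y)) x :=
    (IsTest.mul_left hf hg.conjugate.wirt).integrable
  simp only [dbarW, conj_delW, add_mul, mul_sub]
  rw [integral_add h1 h2, integral_sub h3 (h2.congr (.of_forall fun x => by ring)),
    integral_wirt_mul hf hg.conjugate]
  have : (fun x => f x * (wirt I w (fun y => (φ y : ℂ)) x / 2 * conj (g x))) =
      fun x => wirt I w (fun y => (φ y : ℂ)) x / 2 * f x * conj (g x) := by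
    ext x; ring
  rw [this]; ring

theorem dbarW_comm (hφ : ContDiff ℝ ∞ φ) (hf : ContDiff ℝ ∞ f) (x : CSpace n) :
    dbarW φ v (dbarW φ w f) x = dbarW φ w (dbarW φ v f) x := by
  have hφ' := hφ.ofReal_comp
  have d1 (u : CSpace n) (h : CSpace n → ℂ) (hh : ContDiff ℝ ∞ h) :
      DifferentiableAt ℝ (wirt I u h) x :=
    (ContDiff.wirt hh).differentiable (by simp) x
  have d2 (u : CSpace n) : DifferentiableAt ℝ (fun y => wirt I u (fun z => (φ z : ℂ)) y / 2) x := by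
    simpa only [div_eq_mul_inv] using (d1 u _ hφ').mul_const (2⁻¹ : ℂ)
  have df : DifferentiableAt ℝ f x := hf.differentiable (by simp) x
  have e (u u' : CSpace n) : wirt I u (dbarW φ u' f) x = wirt I u (wirt I u' f) x +
      (wirt I u (wirt I u' fun z => (φ z : ℂ)) x / 2 * f x +
        wirt I u' (fun z => (φ z : ℂ)) x / 2 * wirt I u f x) := by
    unfold dbarW
    rw [wirt_add (d1 u' f hf) ((d2 u').fun_mul df), wirt_mul (d2 u') df]
    simp only [div_eq_mul_inv, mul_comm _ (2⁻¹ : ℂ)]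
    rw [wirt_const_mul _ (d1 u' _ hφ')]
  conv_lhs => rw [dbarW]
  conv_rhs => rw [dbarW]
  rw [e, e, wirt_wirt_comm hf, wirt_wirt_comm hφ']
  simp only [dbarW]
  ring

theorem dbarW_delW (hφ : ContDiff ℝ ∞ φ) (hf : ContDiff ℝ ∞ f) (x : CSpace n) :
    dbarW φ v (delW φ w f) x =
      delW φ w (dbarW φ v f) x - wirt I v (wirt (-I) w fun z => (φ z : ℂ)) x * f x := by
  have hφ' := hφ.ofReal_comp
  have d1 (b : ℂ) (u : CSpace n) (h : CSpace n → ℂ) (hh : ContDiff ℝ ∞ h) :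
      DifferentiableAt ℝ (wirt b u h) x :=
    (ContDiff.wirt hh).differentiable (by simp) x
  have d2 (b : ℂ) (u : CSpace n) :
      DifferentiableAt ℝ (fun y => wirt b u (fun z => (φ z : ℂ)) y / 2) x := by
    simpa only [div_eq_mul_inv] using (d1 b u _ hφ').mul_const (2⁻¹ : ℂ)
  have df : DifferentiableAt ℝ f x := hf.differentiable (by simp) x
  have e1 : wirt I v (delW φ w f) x = wirt I v (wirt (-I) w f) x -
      (wirt I v (wirt (-I) w fun z => (φ z : ℂ)) x / 2 * f x +
        wirt (-I) w (fun z => (φ z : ℂ)) x / 2 * wirt I v f x) := by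
    unfold delW
    rw [wirt_sub (d1 _ w f hf) ((d2 _ w).fun_mul df), wirt_mul (d2 _ w) df]
    simp only [div_eq_mul_inv, mul_comm _ (2⁻¹ : ℂ)]
    rw [wirt_const_mul _ (d1 _ w _ hφ')]
  have e2 : wirt (-I) w (dbarW φ v f) x = wirt (-I) w (wirt I v f) x +
      (wirt (-I) w (wirt I v fun z => (φ z : ℂ)) x / 2 * f x +
        wirt I v (fun z => (φ z : ℂ)) x / 2 * wirt (-I) w f x) := by
    unfold dbarW
    rw [wirt_add (d1 _ v f hf) ((d2 _ v).fun_mul df), wirt_mul (d2 _ v) df]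
    simp only [div_eq_mul_inv, mul_comm _ (2⁻¹ : ℂ)]
    rw [wirt_const_mul _ (d1 _ v _ hφ')]
  conv_lhs => rw [dbarW]
  conv_rhs => rw [delW]
  rw [e1, e2, wirt_wirt_comm hf (a := -I), wirt_wirt_comm hφ' (a := -I)]
  simp only [dbarW, delW]
  ring

end Twisted

section APriori

variable {n : ℕ} {φ : CSpace n → ℝ} {f g : CSpace n → ℂ}

/-- The standard basis vectors of `ℂⁿ`. -/
noncomputable abbrev cbasis (k : Fin n) : CSpace n := EuclideanSpace.single k 1

/-- The mixed second derivative `∂²φ/∂z_j∂z̄_k`. -/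
noncomputable def mixedDeriv (φ : CSpace n → ℝ) (j k : Fin n) (x : CSpace n) : ℂ :=
  wirt I (cbasis k) (wirt (-I) (cbasis j) fun y => (φ y : ℂ)) x

theorem ContDiff.mixedDeriv (hφ : ContDiff ℝ ∞ φ) (j k : Fin n) :
    ContDiff ℝ ∞ (mixedDeriv φ j k) :=
  hφ.ofReal_comp.wirt.wirt

theorem integral_delW_mul_conj_delW (hφ : ContDiff ℝ ∞ φ) (hf : IsTest f) (hg : IsTest g)
    (j k : Fin n) :
    ∫ x, delW φ (cbasis j) f x * conj (delW φ (cbasis k) g x) =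
      ∫ x, (dbarW φ (cbasis k) f x * conj (dbarW φ (cbasis j) g x) +
        mixedDeriv φ j k x * f x * conj (g x)) := by
  have h1 := integral_dbarW_mul_conj (w := cbasis k) hφ (hf.delW (w := cbasis j) hφ).1 hg
  have h2 := integral_dbarW_mul_conj (w := cbasis j) hφ hg.1 (hf.dbarW (w := cbasis k) hφ)
  have h3 : ∫ x, dbarW φ (cbasis k) f x * conj (dbarW φ (cbasis j) g x) =
      -∫ x, delW φ (cbasis j) (dbarW φ (cbasis k) f) x * conj (g x) := by
    have := congrArg conj h2
    rw [map_neg, ← integral_conj, ← integral_conj] at this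
    simp only [map_mul, Complex.conj_conj] at this
    simpa only [mul_comm] using this
  have i1 : Integrable fun x => dbarW φ (cbasis k) f x * conj (dbarW φ (cbasis j) g x) :=
    (IsTest.mul_left (hf.dbarW hφ).1 (hg.dbarW hφ).conjugate).integrable
  have i2 : Integrable fun x => mixedDeriv φ j k x * f x * conj (g x) :=
    (IsTest.mul_left ((hφ.mixedDeriv j k).mul hf.1) hg.conjugate).integrable
  have i3 : Integrable fun x => delW φ (cbasis j) (dbarW φ (cbasis k) f) x * conj (g x) :=
    (IsTest.mul_left ((hf.dbarW hφ).delW hφ).1 hg.conjugate).integrable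
  rw [integral_add i1 i2, h3, ← neg_eq_iff_eq_neg.2 h1]
  unfold mixedDeriv at i2 ⊢
  simp only [dbarW_delW hφ hf.1, sub_mul]
  rw [integral_sub i3 i2]
  ring

theorem half_sum_norm_sub_sq {ι : Type*} [Fintype ι] (m : ι → ι → ℂ) :
    (∑ j, ∑ k, m k j * conj (m j k)).re + (∑ j, ∑ k, ‖m j k - m k j‖ ^ 2) / 2 =
      ∑ j, ∑ k, ‖m j k‖ ^ 2 := by
  have h (j k : ι) : ‖m j k - m k j‖ ^ 2 =
      ‖m j k‖ ^ 2 + ‖m k j‖ ^ 2 - 2 * (m k j * conj (m j k)).re := by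
    simp only [← normSq_eq_norm_sq, normSq_apply]
    simp
    ring
  simp only [h, Finset.sum_sub_distrib, Finset.sum_add_distrib, re_sum, ← Finset.mul_sum]
  rw [Finset.sum_comm (f := fun x y => ‖m y x‖ ^ 2)]
  ring

/-- The basic `L²` estimate for smooth compactly supported `(0,1)`-forms. -/
theorem basic_estimate (hφ : ContDiff ℝ ∞ φ) {c : ℝ}
    (hc : ∀ x (w : Fin n → ℂ), c * ∑ k, ‖w k‖ ^ 2 ≤
      (∑ j, ∑ k, mixedDeriv φ j k x * w j * conj (w k)).re)
    {v : Fin n → CSpace n → ℂ} (hv : ∀ k, IsTest (v k)) :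
    c * ∫ x, ∑ k, ‖v k x‖ ^ 2 ≤ (∫ x, ‖∑ k, delW φ (cbasis k) (v k) x‖ ^ 2) +
      (∫ x, ∑ j, ∑ k, ‖dbarW φ (cbasis j) (v k) x - dbarW φ (cbasis k) (v j) x‖ ^ 2) / 2 := by
  have hA (j k : Fin n) : IsTest (dbarW φ (cbasis j) (v k)) := (hv k).dbarW hφ
  have hB (k : Fin n) : IsTest (delW φ (cbasis k) (v k)) := (hv k).delW hφ
  have isq {h : CSpace n → ℂ} (hh : IsTest h) : Integrable fun x => ‖h x‖ ^ 2 :=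
    (memLp_two_iff_integrable_sq_norm hh.continuous.aestronglyMeasurable).1 hh.memLp
  have i1 (j k : Fin n) : Integrable fun x =>
      (dbarW φ (cbasis k) (v j) x * conj (dbarW φ (cbasis j) (v k) x) +
        mixedDeriv φ j k x * v j x * conj (v k x)) :=
    ((IsTest.mul_left (hA k j).1 (hA j k).conjugate).add
      (IsTest.mul_left ((hφ.mixedDeriv j k).mul (hv j).1) (hv k).conjugate)).integrable
  have e1 : ((∫ x, ‖∑ k, delW φ (cbasis k) (v k) x‖ ^ 2 : ℝ) : ℂ) =
      ∫ x, ∑ j, ∑ k, (dbarW φ (cbasis k) (v j) x * conj (dbarW φ (cbasis j) (v k) x) +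
        mixedDeriv φ j k x * v j x * conj (v k x)) := by
    rw [← integral_complex_ofReal, integral_finsetSum _ fun j _ => integrable_finsetSum _ fun k _ => i1 j k]
    simp only [integral_finsetSum _ fun k _ => i1 _ k,
      ← integral_delW_mul_conj_delW hφ (hv _) (hv _)]
    have i2 (j k : Fin n) : Integrable fun x =>
        delW φ (cbasis j) (v j) x * conj (delW φ (cbasis k) (v k) x) :=
      (IsTest.mul_left (hB j).1 (hB k).conjugate).integrable
    simp only [← integral_finsetSum _ fun k _ => i2 _ k]
    rw [← integral_finsetSum _ fun j _ => integrable_finsetSum _ fun k _ => i2 j k]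
    refine integral_congr_ae (.of_forall fun x => ?_)
    simp only [← Finset.mul_sum, ← Finset.sum_mul, ← map_sum]
    rw [Complex.mul_conj, normSq_eq_norm_sq]
  have e2 := congrArg Complex.re e1
  rw [ofReal_re] at e2
  have i3 : Integrable fun x => ∑ j, ∑ k,
      (dbarW φ (cbasis k) (v j) x * conj (dbarW φ (cbasis j) (v k) x) +
        mixedDeriv φ j k x * v j x * conj (v k x)) :=
    integrable_finsetSum _ fun j _ => integrable_finsetSum _ fun k _ => i1 j k
  have i4 : Integrable fun x => ∑ j, ∑ k,
      ‖dbarW φ (cbasis j) (v k) x - dbarW φ (cbasis k) (v j) x‖ ^ 2 :=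
    integrable_finsetSum _ fun j _ => integrable_finsetSum _ fun k _ =>
      isq ((hA j k).sub (hA k j))
  have i5 : Integrable fun x => ∑ k, ‖v k x‖ ^ 2 :=
    integrable_finsetSum _ fun k _ => isq (hv k)
  rw [e2, ← integral_const_mul, ← integral_div]
  have e3 : (∫ x, ∑ j, ∑ k, (dbarW φ (cbasis k) (v j) x * conj (dbarW φ (cbasis j) (v k) x) +
        mixedDeriv φ j k x * v j x * conj (v k x))).re =
      ∫ x, (∑ j, ∑ k, (dbarW φ (cbasis k) (v j) x * conj (dbarW φ (cbasis j) (v k) x) +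
        mixedDeriv φ j k x * v j x * conj (v k x))).re :=
    (integral_re (𝕜 := ℂ) i3).symm
  have i6 : Integrable fun x => (∑ j, ∑ k,
      (dbarW φ (cbasis k) (v j) x * conj (dbarW φ (cbasis j) (v k) x) +
        mixedDeriv φ j k x * v j x * conj (v k x))).re := i3.re
  rw [e3, ← integral_add i6 (i4.div_const 2)]
  refine integral_mono (i5.const_mul c) (i6.add (i4.div_const 2)) fun x => ?_
  have p1 := half_sum_norm_sub_sq fun j k => dbarW φ (cbasis j) (v k) x
  have p2 := hc x fun k => v k x
  have p3 : 0 ≤ ∑ j, ∑ k, ‖dbarW φ (cbasis j) (v k) x‖ ^ 2 := by positivity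
  simp only [Finset.sum_add_distrib, add_re]
  linarith

end APriori

section Mollify

variable {n : ℕ} {η : CSpace n → ℝ} {f : CSpace n → ℂ}

/-- The convolution of `f` with the real kernel `η`. -/
noncomputable def moll (η : CSpace n → ℝ) (f : CSpace n → ℂ) (x : CSpace n) : ℂ :=
  ∫ y, (η (x - y) : ℂ) * f y

theorem moll_eq_convolution :
    moll η f = convolution η f (ContinuousLinearMap.lsmul ℝ ℝ) volume := by
  ext x
  rw [convolution_lsmul_swap]
  rfl

theorem moll_eq_integral_sub (x : CSpace n) : moll η f x = ∫ t, (η t : ℂ) * f (x - t) := by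
  rw [moll_eq_convolution]
  rfl

theorem contDiff_moll (hη : ContDiff ℝ ∞ η) (hs : HasCompactSupport η)
    (hf : LocallyIntegrable f) : ContDiff ℝ ∞ (moll η f) := by
  rw [moll_eq_convolution]
  exact hs.contDiff_convolution_left _ hη hf

theorem wirt_moll {a : ℂ} {w : CSpace n} (hη : ContDiff ℝ ∞ η) (hs : HasCompactSupport η)
    (hf : LocallyIntegrable f) (x : CSpace n) :
    wirt a w (moll η f) x = -∫ y, f y * wirt a w (fun z => (η (x - z) : ℂ)) y := by
  have hη1 : ContDiff ℝ 1 η := hη.of_le (by norm_cast)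
  have hd := hs.hasFDerivAt_convolution_left (ContinuousLinearMap.lsmul ℝ ℝ) hη1 hf x
  have hs' : HasCompactSupport (fderiv ℝ η) := hs.fderiv (𝕜 := ℝ)
  have hc' : Continuous (fderiv ℝ η) := hη1.continuous_fderiv (by simp)
  have hint : Integrable fun t => fderiv ℝ η t := hc'.integrable_of_hasCompactSupport hs'
  have hce := hs'.convolutionExists_left
    ((ContinuousLinearMap.lsmul ℝ ℝ : ℝ →L[ℝ] ℂ →L[ℝ] ℂ).precompL (CSpace n)) hc' hf
  have key (v : CSpace n) : fderiv ℝ (moll η f) x v =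
      ∫ y, (fderiv ℝ η (x - y) v : ℂ) * f y := by
    rw [moll_eq_convolution, hd.fderiv, convolution_def,
      ContinuousLinearMap.integral_apply (hce x)]
    rw [← integral_sub_left_eq_self _ _ x]
    refine integral_congr_ae (.of_forall fun y => ?_)
    simp
  have hi (v : CSpace n) : Integrable fun y => (fderiv ℝ η (x - y) v : ℂ) * f y := by
    have h1 : HasCompactSupport fun y => (fderiv ℝ η (x - y) v : ℂ) := by
      have h2 : HasCompactSupport fun y => fderiv ℝ η (x - y) :=
        hs'.comp_homeomorph (Homeomorph.subLeft x)
      refine h2.mono fun y hy => ?_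
      contrapose! hy
      simp only [Function.mem_support, not_not] at hy ⊢
      simp [hy]
    have h3 : Continuous fun y => (fderiv ℝ η (x - y) v : ℂ) := by fun_prop
    exact (hf.integrable_smul_left_of_hasCompactSupport h3 h1)
  have hdη (v y : CSpace n) : fderiv ℝ (fun z => (η (x - z) : ℂ)) y v =
      -(fderiv ℝ η (x - y) v : ℂ) := by
    have h1 : HasFDerivAt η (fderiv ℝ η (x - y)) (x - y) :=
      (hη1.differentiable (by simp) _).hasFDerivAt
    have h2 : HasFDerivAt (fun z => x - z) (-ContinuousLinearMap.id ℝ (CSpace n)) y :=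
      (hasFDerivAt_id y).const_sub x
    have h3 := Complex.ofRealCLM.hasFDerivAt.comp y (h1.comp y h2)
    rw [show (fun z => (η (x - z) : ℂ)) = Complex.ofRealCLM ∘ (η ∘ fun z => x - z) from rfl,
      h3.fderiv]
    simp
  simp only [wirt, hdη, key]
  rw [← integral_const_mul, ← integral_add (hi w) ((hi (I • w)).const_mul a),
    ← integral_div, ← integral_neg]
  refine integral_congr_ae (.of_forall fun y => ?_)
  simp only
  ring

theorem isTest_translate (hη : ContDiff ℝ ∞ η) (hs : HasCompactSupport η) (x : CSpace n) :
    IsTest fun z => (η (x - z) : ℂ) := by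
  refine ⟨(hη.comp (contDiff_const.sub contDiff_id)).ofReal_comp, ?_⟩
  have h2 : HasCompactSupport fun y => η (x - y) := hs.comp_homeomorph (Homeomorph.subLeft x)
  exact h2.comp_left (g := fun r : ℝ => (r : ℂ)) (by simp)

theorem hasCompactSupport_moll (hs : HasCompactSupport η) (hf : HasCompactSupport f) :
    HasCompactSupport (moll η f) := by
  rw [moll_eq_convolution]
  exact hs.convolution _ hf

theorem moll_eq_zero {R : ℝ} (hs : Function.support η ⊆ Metric.ball 0 R) {x : CSpace n}
    (hx : ∀ y, f y ≠ 0 → R ≤ dist x y) : moll η f x = 0 := by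
  refine integral_eq_zero_of_ae (.of_forall fun y => ?_)
  by_cases hy : f y = 0
  · simp [hy]
  · have h1 : η (x - y) = 0 := by
      by_contra h
      have := hs h
      rw [mem_ball_zero_iff, ← dist_eq_norm] at this
      exact absurd (hx y hy) (not_le.2 this)
    simp [h1]

theorem moll_sub {g : CSpace n → ℂ} (hc : Continuous η) (hs : HasCompactSupport η)
    (hf : LocallyIntegrable f) (hg : LocallyIntegrable g) :
    moll η (f - g) = moll η f - moll η g := by
  have h (x : CSpace n) (u : CSpace n → ℂ) (hu : LocallyIntegrable u) :
      Integrable fun y => (η (x - y) : ℂ) * u y := by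
    have h1 : HasCompactSupport fun y => η (x - y) := hs.comp_homeomorph (Homeomorph.subLeft x)
    exact hu.integrable_smul_left_of_hasCompactSupport
      (g := fun y => η (x - y)) (by fun_prop) h1
  ext x
  simp only [moll, Pi.sub_apply, mul_sub]
  exact integral_sub (h x f hf) (h x g hg)

theorem eLpNorm_moll_le (hc : Continuous η) (h0 : ∀ x, 0 ≤ η x) (hi : Integrable η)
    (h1 : ∫ x, η x = 1) (hf : AEStronglyMeasurable f) :
    eLpNorm (moll η f) 2 volume ≤ eLpNorm f 2 volume := by
  set ν : Measure (CSpace n) := volume.withDensity fun t => ENNReal.ofReal (η t) with hν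
  have hm : Measurable fun t => ENNReal.ofReal (η t) := by fun_prop
  have : IsProbabilityMeasure ν := ⟨by
    rw [hν, withDensity_apply _ MeasurableSet.univ, Measure.restrict_univ,
      ← ofReal_integral_eq_lintegral_ofReal hi (.of_forall h0), h1, ENNReal.ofReal_one]⟩
  have hf2 : AEStronglyMeasurable (fun p : CSpace n × CSpace n => f (p.1 - p.2))
      (volume.prod volume) :=
    hf.comp_quasiMeasurePreserving (quasiMeasurePreserving_sub_of_right_invariant volume volume)
  have hpt (x : CSpace n) : ‖moll η f x‖ₑ ^ 2 ≤
      ∫⁻ t, ENNReal.ofReal (η t) * ‖f (x - t)‖ₑ ^ 2 := by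
    have hfx : AEStronglyMeasurable (fun t => f (x - t)) ν :=
      (hf.comp_quasiMeasurePreserving
        (quasiMeasurePreserving_sub_left_of_right_invariant volume x)).mono_ac
        (withDensity_absolutelyContinuous _ _)
    have a1 : ‖moll η f x‖ₑ ≤ eLpNorm (fun t => f (x - t)) 1 ν := by
      rw [moll_eq_integral_sub, eLpNorm_one_eq_lintegral_enorm, hν,
        lintegral_withDensity_eq_lintegral_mul_non_measurable _ hm (.of_forall fun _ => ENNReal.ofReal_lt_top)]
      refine (enorm_integral_le_lintegral_enorm _).trans (lintegral_mono fun t => ?_)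
      rw [enorm_mul, Pi.mul_apply]
      gcongr
      rw [← ofReal_norm, Complex.norm_of_nonneg (h0 t)]
    have a2 := a1.trans (eLpNorm_le_eLpNorm_of_exponent_le (q := 2) (by norm_num) hfx)
    calc ‖moll η f x‖ₑ ^ 2 ≤ eLpNorm (fun t => f (x - t)) 2 ν ^ 2 := by gcongr
      _ = ∫⁻ t, ‖f (x - t)‖ₑ ^ 2 ∂ν := by
        have := eLpNorm_nnreal_pow_eq_lintegral (μ := ν) (f := fun t => f (x - t)) (p := 2) (by simp)
        simpa using this
      _ = _ := by
        rw [hν, lintegral_withDensity_eq_lintegral_mul_non_measurable _ hm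
          (.of_forall fun _ => ENNReal.ofReal_lt_top)]
        rfl
  have e2 (u : CSpace n → ℂ) : eLpNorm u 2 volume ^ 2 = ∫⁻ x, ‖u x‖ₑ ^ 2 := by
    have := eLpNorm_nnreal_pow_eq_lintegral (μ := volume) (f := u) (p := 2) (by simp)
    simpa using this
  rw [← ENNReal.pow_le_pow_left_iff (n := 2) (by simp), e2, e2]
  calc ∫⁻ x, ‖moll η f x‖ₑ ^ 2 ≤ ∫⁻ x, ∫⁻ t, ENNReal.ofReal (η t) * ‖f (x - t)‖ₑ ^ 2 :=
        lintegral_mono hpt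
    _ = ∫⁻ t, ∫⁻ x, ENNReal.ofReal (η t) * ‖f (x - t)‖ₑ ^ 2 := by
        refine lintegral_lintegral_swap ?_
        exact (hm.comp measurable_snd).aemeasurable.mul (hf2.enorm.pow_const 2)
    _ = ∫⁻ t, ENNReal.ofReal (η t) * ∫⁻ x, ‖f x‖ₑ ^ 2 := by
        refine lintegral_congr fun t => ?_
        rw [lintegral_const_mul' _ _ ENNReal.ofReal_ne_top,
          lintegral_sub_right_eq_self (fun x => ‖f x‖ₑ ^ 2)]
    _ = ∫⁻ x, ‖f x‖ₑ ^ 2 := by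
        rw [lintegral_mul_const _ hm, ← ofReal_integral_eq_lintegral_ofReal hi (.of_forall h0), h1,
          ENNReal.ofReal_one, one_mul]

end Mollify

section MollifierSequence

variable {n : ℕ} {f : CSpace n → ℂ}

/-- A sequence of bump functions whose supports shrink to the origin. -/
noncomputable def shrinkingBump (n : ℕ) (m : ℕ) : ContDiffBump (0 : CSpace n) where
  rIn := 1 / (2 * (m + 1))
  rOut := 1 / (m + 1)
  rIn_pos := by positivity
  rIn_lt_rOut := by
    have : (0 : ℝ) < m + 1 := by positivity
    gcongr
    linarith

/-- The corresponding sequence of mollifiers. -/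
noncomputable def mollKer (n m : ℕ) : CSpace n → ℝ := (shrinkingBump n m).normed volume

theorem contDiff_mollKer (m : ℕ) : ContDiff ℝ ∞ (mollKer n m) :=
  (shrinkingBump n m).contDiff_normed

theorem hasCompactSupport_mollKer (m : ℕ) : HasCompactSupport (mollKer n m) :=
  (shrinkingBump n m).hasCompactSupport_normed

theorem integrable_mollKer (m : ℕ) : Integrable (mollKer n m) :=
  (shrinkingBump n m).integrable_normed

theorem mollKer_nonneg (m : ℕ) (x : CSpace n) : 0 ≤ mollKer n m x :=
  (shrinkingBump n m).nonneg_normed x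

theorem integral_mollKer (m : ℕ) : ∫ x, mollKer n m x = 1 :=
  (shrinkingBump n m).integral_normed

theorem support_mollKer (m : ℕ) :
    Function.support (mollKer n m) = Metric.ball 0 (1 / ((m : ℝ) + 1)) :=
  (shrinkingBump n m).support_normed_eq

theorem support_mollKer_subset (m : ℕ) : Function.support (mollKer n m) ⊆ Metric.ball 0 1 := by
  rw [support_mollKer]
  refine Metric.ball_subset_ball ?_
  rw [div_le_one (by positivity)]
  linarith [(Nat.cast_nonneg m : (0 : ℝ) ≤ m)]

theorem tendsto_rOut_shrinkingBump :
    Tendsto (fun m => (shrinkingBump n m).rOut) atTop (𝓝 0) :=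
  tendsto_one_div_add_atTop_nhds_zero_nat

theorem ae_tendsto_moll (hf : LocallyIntegrable f) :
    ∀ᵐ x, Tendsto (fun m => moll (mollKer n m) f x) atTop (𝓝 (f x)) := by
  simp only [moll_eq_convolution]
  refine ContDiffBump.ae_convolution_tendsto_right_of_locallyIntegrable (K := 2)
    tendsto_rOut_shrinkingBump (.of_forall fun m => ?_) hf
  simp only [shrinkingBump]
  exact le_of_eq (by field_simp)

theorem tendsto_moll_of_continuous (hf : Continuous f) (x : CSpace n) :
    Tendsto (fun m => moll (mollKer n m) f x) atTop (𝓝 (f x)) := by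
  simp only [moll_eq_convolution]
  exact ContDiffBump.convolution_tendsto_right_of_continuous tendsto_rOut_shrinkingBump hf x

theorem memLp_moll (m : ℕ) (hf : MemLp f 2) : MemLp (moll (mollKer n m) f) 2 :=
  ⟨(contDiff_moll (contDiff_mollKer m) (hasCompactSupport_mollKer m)
      (hf.locallyIntegrable (by norm_num))).continuous.aestronglyMeasurable,
    (eLpNorm_moll_le (contDiff_mollKer m).continuous (mollKer_nonneg m) (integrable_mollKer m)
      (integral_mollKer m) hf.1).trans_lt hf.2⟩

theorem tendsto_eLpNorm_moll_of_continuous (hf : Continuous f) (hs : HasCompactSupport f) :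
    Tendsto (fun m => eLpNorm (moll (mollKer n m) f - f) 2 volume) atTop (𝓝 0) := by
  obtain ⟨R, hR⟩ : ∃ R : ℝ, ∀ y, f y ≠ 0 → ‖y‖ ≤ R := by
    obtain ⟨R, hR⟩ := hs.isCompact.isBounded.exists_norm_le
    exact ⟨R, fun y hy => hR y (subset_tsupport _ hy)⟩
  set B : Set (CSpace n) := Metric.closedBall 0 (R + 1)
  have hB : volume B ≠ ⊤ := (isCompact_closedBall _ _).measure_lt_top.ne
  have hB2 : volume B ^ (2⁻¹ : ℝ) ≠ ⊤ := ENNReal.rpow_ne_top_of_nonneg (by norm_num) hB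
  have hz (m : ℕ) (x : CSpace n) (hx : x ∉ B) : (moll (mollKer n m) f - f) x = 0 := by
    have hx' : R + 1 < ‖x‖ := by simpa [B] using hx
    have hfx : f x = 0 := by
      by_contra h
      linarith [hR x h]
    rw [Pi.sub_apply, hfx, sub_zero]
    refine moll_eq_zero (support_mollKer_subset m) fun y hy => ?_
    have := hR y hy
    rw [dist_eq_norm]
    linarith [norm_sub_norm_le x y]
  have hu : ∀ ε > 0, ∀ᶠ m in atTop, ∀ x, ‖(moll (mollKer n m) f - f) x‖ ≤ ε := by
    intro ε hε
    obtain ⟨δ, hδ, hd⟩ := Metric.uniformContinuous_iff.1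
      (hs.uniformContinuous_of_continuous hf) ε hε
    filter_upwards [(tendsto_order.1 (tendsto_rOut_shrinkingBump (n := n))).2 δ hδ] with m hm x
    rw [Pi.sub_apply, ← dist_eq_norm, moll_eq_convolution]
    refine ContDiffBump.dist_normed_convolution_le hf.aestronglyMeasurable fun y hy => (hd ?_).le
    exact (Metric.mem_ball.1 hy).trans hm
  rw [ENNReal.tendsto_nhds_zero]
  intro ε hε
  rcases eq_or_ne ε ⊤ with rfl | hεt
  · exact .of_forall fun _ => le_top
  obtain ⟨c, hc, hcε⟩ : ∃ c : ℝ, 0 < c ∧ volume B ^ (2⁻¹ : ℝ) * ENNReal.ofReal c ≤ ε := by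
    have : Tendsto (fun c : ℝ => volume B ^ (2⁻¹ : ℝ) * ENNReal.ofReal c) (𝓝[>] 0) (𝓝 0) := by
      have h1 : Tendsto (fun c : ℝ => ENNReal.ofReal c) (𝓝[>] 0) (𝓝 0) := by
        have := (ENNReal.continuous_ofReal.tendsto 0).mono_left
          (nhdsWithin_le_nhds (s := Ioi (0 : ℝ)))
        simpa using this
      simpa using ENNReal.Tendsto.const_mul h1 (Or.inr hB2)
    obtain ⟨c, h1, h2⟩ := ((ENNReal.tendsto_nhds_zero.1 this ε hε).and
      self_mem_nhdsWithin).exists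
    exact ⟨c, h2, h1⟩
  filter_upwards [hu c hc] with m hm
  have : eLpNorm (moll (mollKer n m) f - f) 2 volume =
      eLpNorm (moll (mollKer n m) f - f) 2 (volume.restrict B) := by
    rw [eLpNorm_restrict_eq_of_support_subset]
    intro x hx
    by_contra h
    exact hx (hz m x h)
  rw [this]
  refine (eLpNorm_le_of_ae_bound (.of_forall hm)).trans ?_
  simpa using hcε

theorem tendsto_eLpNorm_moll (hf : MemLp f 2) :
    Tendsto (fun m => eLpNorm (moll (mollKer n m) f - f) 2 volume) atTop (𝓝 0) := by
  rw [ENNReal.tendsto_nhds_zero]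
  intro ε hε
  obtain ⟨g, hgs, hfg, hgc, hg⟩ := hf.exists_hasCompactSupport_eLpNorm_sub_le (by norm_num)
    (ε := ε / 3) (by simpa using hε.ne')
  filter_upwards [ENNReal.tendsto_nhds_zero.1 (tendsto_eLpNorm_moll_of_continuous hgc hgs) (ε / 3)
    (by simpa using hε.ne')] with m hm
  have e : moll (mollKer n m) f - f =
      moll (mollKer n m) (f - g) + ((moll (mollKer n m) g - g) + (g - f)) := by
    rw [moll_sub (contDiff_mollKer m).continuous (hasCompactSupport_mollKer m)
      (hf.locallyIntegrable (by norm_num)) (hg.locallyIntegrable (by norm_num))]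
    abel
  have m1 := (memLp_moll m (hf.sub hg)).1
  have m2 := ((memLp_moll m hg).sub hg).1
  have m3 := (hg.sub hf).1
  rw [e]
  refine (eLpNorm_add_le m1 (m2.add m3) (by norm_num)).trans ?_
  refine (add_le_add_right (eLpNorm_add_le m2 m3 (by norm_num)) _).trans ?_
  have h1 : eLpNorm (moll (mollKer n m) (f - g)) 2 volume ≤ ε / 3 :=
    (eLpNorm_moll_le (contDiff_mollKer m).continuous (mollKer_nonneg m) (integrable_mollKer m)
      (integral_mollKer m) (hf.sub hg).1).trans hfg
  have h3 : eLpNorm (g - f) 2 volume ≤ ε / 3 := by rwa [eLpNorm_sub_comm]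
  calc _ ≤ ε / 3 + (ε / 3 + ε / 3) := by gcongr
    _ = ε := by rw [← add_assoc, ENNReal.add_thirds]

end MollifierSequence

section WeakEstimate

variable {n : ℕ}

theorem integral_norm_sq_eq {f : CSpace n → ℂ} (hf : MemLp f 2) :
    ∫ x, ‖f x‖ ^ 2 = ‖hf.toLp f‖ ^ 2 := by
  have h1 : (inner ℂ (hf.toLp f) (hf.toLp f) : ℂ) = ((∫ x, ‖f x‖ ^ 2 : ℝ) : ℂ) := by
    rw [L2.inner_def, ← integral_complex_ofReal]
    refine integral_congr_ae ?_
    filter_upwards [hf.coeFn_toLp] with x hx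
    rw [hx, inner_self_eq_norm_sq_to_K]
    simp
  rw [inner_self_eq_norm_sq_to_K] at h1
  exact Complex.ofReal_injective (by rw [← h1]; norm_cast)

/-- Convergence of a sequence of functions in `L²`. -/
structure TendstoL2 (u : ℕ → CSpace n → ℂ) (f : CSpace n → ℂ) : Prop where
  memLp_seq : ∀ m, MemLp (u m) 2
  memLp : MemLp f 2
  tendsto : Tendsto (fun m => eLpNorm (u m - f) 2 volume) atTop (𝓝 0)

namespace TendstoL2

variable {u v : ℕ → CSpace n → ℂ} {f g : CSpace n → ℂ}

theorem toLp (h : TendstoL2 u f) :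
    Tendsto (fun m => (h.memLp_seq m).toLp (u m)) atTop (𝓝 (h.memLp.toLp f)) :=
  (Lp.tendsto_Lp_iff_tendsto_eLpNorm'' u h.memLp_seq f h.memLp).2 h.tendsto

theorem tendsto_integral (h : TendstoL2 u f) :
    Tendsto (fun m => ∫ x, ‖u m x‖ ^ 2) atTop (𝓝 (∫ x, ‖f x‖ ^ 2)) := by
  simp only [integral_norm_sq_eq h.memLp, integral_norm_sq_eq (h.memLp_seq _)]
  exact h.toLp.norm.pow 2

theorem add (hu : TendstoL2 u f) (hv : TendstoL2 v g) :
    TendstoL2 (fun m x => u m x + v m x) (fun x => f x + g x) where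
  memLp_seq m := (hu.memLp_seq m).add (hv.memLp_seq m)
  memLp := hu.memLp.add hv.memLp
  tendsto := by
    have h := hu.tendsto.add hv.tendsto
    rw [add_zero] at h
    refine tendsto_of_tendsto_of_tendsto_of_le_of_le tendsto_const_nhds h
      (fun _ => zero_le) fun m => ?_
    refine le_trans (le_of_eq ?_) (eLpNorm_add_le ((hu.memLp_seq m).sub hu.memLp).1
      ((hv.memLp_seq m).sub hv.memLp).1 (by norm_num))
    congr 1
    ext x
    simp only [Pi.sub_apply, Pi.add_apply]
    ring

theorem sum {ι : Type*} (s : Finset ι) {u : ι → ℕ → CSpace n → ℂ} {f : ι → CSpace n → ℂ}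
    (h : ∀ i ∈ s, TendstoL2 (u i) (f i)) :
    TendstoL2 (fun m x => ∑ i ∈ s, u i m x) (fun x => ∑ i ∈ s, f i x) := by
  classical
  induction s using Finset.induction_on with
  | empty => simpa using (⟨fun _ => MemLp.zero', MemLp.zero', by simp⟩ :
      TendstoL2 (fun _ _ => (0 : ℂ)) (fun _ : CSpace n => (0 : ℂ)))
  | insert a s ha ih =>
    simp only [Finset.sum_insert ha]
    exact (h a (Finset.mem_insert_self a s)).add
      (ih fun i hi => h i (Finset.mem_insert_of_mem hi))

end TendstoL2

theorem exists_bound_mul {a : CSpace n → ℂ} (ha : Continuous a) {B : Set (CSpace n)}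
    (hB : IsCompact B) :
    ∃ C, ∀ u : CSpace n → ℂ, (∀ x ∉ B, u x = 0) → ∀ x, ‖a x * u x‖ ≤ C * ‖u x‖ := by
  obtain ⟨C, hC⟩ := hB.exists_bound_of_continuousOn ha.continuousOn
  refine ⟨C, fun u hu x => ?_⟩
  by_cases hx : x ∈ B
  · rw [norm_mul]
    gcongr
    exact hC x hx
  · simp [hu x hx]

theorem memLp_mul_of_support {a u : CSpace n → ℂ} (ha : Continuous a) {B : Set (CSpace n)}
    (hB : IsCompact B) (hu : MemLp u 2) (h0 : ∀ x ∉ B, u x = 0) :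
    MemLp (fun x => a x * u x) 2 := by
  obtain ⟨C, hC⟩ := exists_bound_mul ha hB
  exact hu.of_le_mul (ha.aestronglyMeasurable.mul hu.1) (.of_forall (hC u h0))

theorem TendstoL2.mul {u : ℕ → CSpace n → ℂ} {f a : CSpace n → ℂ} (h : TendstoL2 u f)
    (ha : Continuous a) {B : Set (CSpace n)} (hB : IsCompact B) (hu : ∀ m, ∀ x ∉ B, u m x = 0)
    (hf : ∀ x ∉ B, f x = 0) : TendstoL2 (fun m x => a x * u m x) (fun x => a x * f x) where
  memLp_seq m := memLp_mul_of_support ha hB (h.memLp_seq m) (hu m)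
  memLp := memLp_mul_of_support ha hB h.memLp hf
  tendsto := by
    obtain ⟨C, hC⟩ := exists_bound_mul ha hB
    have h1 := ENNReal.Tendsto.const_mul (a := ENNReal.ofReal C) h.tendsto
      (Or.inr ENNReal.ofReal_ne_top)
    rw [mul_zero] at h1
    refine tendsto_of_tendsto_of_tendsto_of_le_of_le tendsto_const_nhds h1
      (fun _ => zero_le) fun m => ?_
    refine eLpNorm_le_mul_eLpNorm_of_ae_le_mul (.of_forall fun x => ?_) 2
    have := hC (u m - f) (fun x hx => by simp [hu m x hx, hf x hx]) x
    simpa [mul_sub] using this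

theorem tendstoL2_moll {f : CSpace n → ℂ} (hf : MemLp f 2) :
    TendstoL2 (fun m => moll (mollKer n m) f) f :=
  ⟨fun m => memLp_moll m hf, hf, tendsto_eLpNorm_moll hf⟩

variable {φ : CSpace n → ℝ}

/-- Half of the derivative `∂φ/∂z_k` (for `a = -i`) or `∂φ/∂z̄_k` (for `a = i`). -/
noncomputable def halfWirt (φ : CSpace n → ℝ) (a : ℂ) (k : Fin n) (x : CSpace n) : ℂ :=
  wirt a (cbasis k) (fun y => (φ y : ℂ)) x / 2

theorem continuous_halfWirt (hφ : ContDiff ℝ ∞ φ) (a : ℂ) (k : Fin n) :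
    Continuous (halfWirt φ a k) :=
  (ContDiff.wirt hφ.ofReal_comp).continuous.div_const _

/-- The basic estimate for compactly supported `L²` forms with weakly defined derivatives. -/
theorem basic_estimate_weak (hφ : ContDiff ℝ ∞ φ) {c : ℝ}
    (hc : ∀ x (w : Fin n → ℂ), c * ∑ k, ‖w k‖ ^ 2 ≤
      (∑ j, ∑ k, mixedDeriv φ j k x * w j * conj (w k)).re)
    {V : Fin n → CSpace n → ℂ} {G : CSpace n → ℂ} {S : Fin n → Fin n → CSpace n → ℂ}
    (hV : ∀ k, MemLp (V k) 2) (hs : ∀ k, HasCompactSupport (V k)) (hG : MemLp G 2)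
    (hS : ∀ j k, MemLp (S j k) 2)
    (h1 : ∀ t, IsTest t → ∑ k, ∫ y, V k y * wirt (-I) (cbasis k) t y =
      -∫ y, (G y + ∑ k, halfWirt φ (-I) k y * V k y) * t y)
    (h2 : ∀ j k t, IsTest t → (∫ y, V k y * wirt I (cbasis j) t y) -
        ∫ y, V j y * wirt I (cbasis k) t y =
      -∫ y, (S j k y + (-halfWirt φ I j y * V k y + halfWirt φ I k y * V j y)) * t y) :
    c * ∑ k, ∫ x, ‖V k x‖ ^ 2 ≤ (∫ x, ‖G x‖ ^ 2) + (∑ j, ∑ k, ∫ x, ‖S j k x‖ ^ 2) / 2 := by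
  obtain ⟨R, hR⟩ : ∃ R : ℝ, ∀ k y, V k y ≠ 0 → ‖y‖ ≤ R := by
    choose R hR using fun k => (hs k).isCompact.isBounded.exists_norm_le
    refine ⟨∑ k, |R k|, fun k y hy => (hR k y (subset_tsupport _ hy)).trans ?_⟩
    exact (le_abs_self _).trans
      (Finset.single_le_sum (f := fun k => |R k|) (fun _ _ => abs_nonneg _) (Finset.mem_univ k))
  set B : Set (CSpace n) := Metric.closedBall 0 (R + 1)
  have hB : IsCompact B := isCompact_closedBall _ _
  have hV0 (k : Fin n) (x : CSpace n) (hx : x ∉ B) : V k x = 0 := by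
    have hx' : R + 1 < ‖x‖ := by simpa [B] using hx
    by_contra h
    linarith [hR k x h]
  set v : ℕ → Fin n → CSpace n → ℂ := fun m k => moll (mollKer n m) (V k) with hv
  have hv0 (m : ℕ) (k : Fin n) (x : CSpace n) (hx : x ∉ B) : v m k x = 0 := by
    have hx' : R + 1 < ‖x‖ := by simpa [B] using hx
    refine moll_eq_zero (support_mollKer_subset m) fun y hy => ?_
    have := hR k y hy
    rw [dist_eq_norm]
    linarith [norm_sub_norm_le x y]
  have loc (k : Fin n) : LocallyIntegrable (V k) := (hV k).locallyIntegrable (by norm_num)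
  have hvT (m : ℕ) (k : Fin n) : IsTest (v m k) :=
    ⟨contDiff_moll (contDiff_mollKer m) (hasCompactSupport_mollKer m) (loc k),
      hasCompactSupport_moll (hasCompactSupport_mollKer m) (hs k)⟩
  have hconv (k : Fin n) : TendstoL2 (fun m => v m k) (V k) := tendstoL2_moll (hV k)
  have hmul (k : Fin n) {a : CSpace n → ℂ} (ha : Continuous a) :
      TendstoL2 (fun m x => a x * v m k x) (fun x => a x * V k x) :=
    (hconv k).mul ha hB (fun m => hv0 m k) (hV0 k)
  have cW (a : ℂ) (k : Fin n) : Continuous (halfWirt φ a k) := continuous_halfWirt hφ a k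
  have hT (m : ℕ) (x : CSpace n) : IsTest fun z => (mollKer n m (x - z) : ℂ) :=
    isTest_translate (contDiff_mollKer m) (hasCompactSupport_mollKer m) x
  have e1 (m : ℕ) (x : CSpace n) : ∑ k, delW φ (cbasis k) (v m k) x =
      moll (mollKer n m) (fun y => G y + ∑ k, halfWirt φ (-I) k y * V k y) x +
        ∑ k, -halfWirt φ (-I) k x * v m k x := by
    have := h1 _ (hT m x)
    simp only [delW, hv, Finset.sum_sub_distrib,
      wirt_moll (contDiff_mollKer m) (hasCompactSupport_mollKer m) (loc _), Finset.sum_neg_distrib]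
    rw [this, neg_neg, sub_eq_add_neg, ← Finset.sum_neg_distrib]
    simp only [moll, halfWirt, neg_mul, mul_comm]
  have e2 (m : ℕ) (j k : Fin n) (x : CSpace n) :
      dbarW φ (cbasis j) (v m k) x - dbarW φ (cbasis k) (v m j) x =
      moll (mollKer n m)
          (fun y => S j k y + (-halfWirt φ I j y * V k y + halfWirt φ I k y * V j y)) x +
        (halfWirt φ I j x * v m k x + -halfWirt φ I k x * v m j x) := by
    have := h2 j k _ (hT m x)
    have e : moll (mollKer n m)
          (fun y => S j k y + (-halfWirt φ I j y * V k y + halfWirt φ I k y * V j y)) x =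
        -((∫ y, V k y * wirt I (cbasis j) (fun z => (mollKer n m (x - z) : ℂ)) y) -
          ∫ y, V j y * wirt I (cbasis k) (fun z => (mollKer n m (x - z) : ℂ)) y) := by
      rw [this, neg_neg]
      simp only [moll, mul_comm]
    rw [e]
    simp only [dbarW, hv, halfWirt,
      wirt_moll (contDiff_mollKer m) (hasCompactSupport_mollKer m) (loc _)]
    ring
  have c1 : TendstoL2 (fun m x => ∑ k, delW φ (cbasis k) (v m k) x) G := by
    have mem : MemLp (fun y => G y + ∑ k, halfWirt φ (-I) k y * V k y) 2 :=
      hG.add (memLp_finsetSum _ fun k _ => (hmul k (cW _ _)).memLp)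
    have := (tendstoL2_moll mem).add
      (TendstoL2.sum Finset.univ fun k _ => hmul k (cW (-I) k).neg)
    convert this using 3 with m x x
    · exact e1 m x
    · simp [Finset.sum_neg_distrib]
  have c2 (j k : Fin n) : TendstoL2
      (fun m x => dbarW φ (cbasis j) (v m k) x - dbarW φ (cbasis k) (v m j) x) (S j k) := by
    have mem : MemLp (fun y => S j k y +
        (-halfWirt φ I j y * V k y + halfWirt φ I k y * V j y)) 2 :=
      (hS j k).add ((hmul k (cW I j).neg).memLp.add (hmul j (cW I k)).memLp)
    have := (tendstoL2_moll mem).add ((hmul k (cW I j)).add (hmul j (cW I k).neg))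
    convert this using 3 with m x x
    · exact e2 m j k x
    · simp only [Pi.neg_apply]
      ring
  have isq {h : CSpace n → ℂ} (hh : MemLp h 2) : Integrable fun x => ‖h x‖ ^ 2 :=
    (memLp_two_iff_integrable_sq_norm hh.1).1 hh
  refine le_of_tendsto_of_tendsto'
    ((tendsto_finsetSum Finset.univ fun k _ => (hconv k).tendsto_integral).const_mul c)
    (c1.tendsto_integral.add ((tendsto_finsetSum Finset.univ fun j _ =>
      tendsto_finsetSum Finset.univ fun k _ => (c2 j k).tendsto_integral).div_const 2)) fun m => ?_
  have := basic_estimate hφ hc (hvT m)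
  rw [integral_finsetSum _ fun k _ => isq (hvT m k).memLp,
    integral_finsetSum _ fun j _ => integrable_finsetSum _ fun k _ => isq ((c2 j k).memLp_seq m)]
    at this
  simp only [integral_finsetSum _ fun k _ => isq ((c2 _ k).memLp_seq m)] at this
  exact this

end WeakEstimate

section Cutoff

variable {n : ℕ}

/-- Smooth cutoff functions exhausting `ℂⁿ`. -/
noncomputable def cutoff (n m : ℕ) (x : CSpace n) : ℝ :=
  (⟨1, 2, one_pos, one_lt_two⟩ : ContDiffBump (0 : CSpace n)) (((m : ℝ) + 1)⁻¹ • x)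

theorem contDiff_cutoff (m : ℕ) : ContDiff ℝ ∞ (cutoff n m) :=
  (ContDiffBump.contDiff _).comp (contDiff_const_smul _)

theorem isTest_cutoff (m : ℕ) : IsTest fun x : CSpace n => (cutoff n m x : ℂ) := by
  refine ⟨(contDiff_cutoff m).ofReal_comp, ?_⟩
  have h : HasCompactSupport (cutoff n m) :=
    (ContDiffBump.hasCompactSupport _).comp_homeomorph
      (Homeomorph.smulOfNeZero ((m : ℝ) + 1)⁻¹ (by positivity))
  exact h.comp_left (g := fun r : ℝ => (r : ℂ)) (by simp)

theorem norm_cutoff_le (m : ℕ) (x : CSpace n) : ‖(cutoff n m x : ℂ)‖ ≤ 1 := by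
  have h0 : 0 ≤ cutoff n m x := ContDiffBump.nonneg _
  rw [Complex.norm_of_nonneg h0]
  exact ContDiffBump.le_one _

theorem cutoff_eq_one {m : ℕ} {x : CSpace n} (hx : ‖x‖ ≤ m + 1) : cutoff n m x = 1 := by
  refine ContDiffBump.one_of_mem_closedBall _ ?_
  rw [mem_closedBall_zero_iff, norm_smul, norm_inv, Real.norm_of_nonneg (by positivity)]
  exact inv_mul_le_one_of_le₀ hx (by positivity)

theorem exists_bound_wirt_cutoff (a : ℂ) (w : CSpace n) :
    ∃ C : ℝ, ∀ m x, ‖wirt a w (fun y => (cutoff n m y : ℂ)) x‖ ≤ C * ((m : ℝ) + 1)⁻¹ := by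
  set b : CSpace n → ℂ := fun y => ((⟨1, 2, one_pos, one_lt_two⟩ : ContDiffBump (0 : CSpace n)) y : ℂ)
  have hb : ContDiff ℝ ∞ b := (ContDiffBump.contDiff _).ofReal_comp
  have hs : HasCompactSupport b :=
    (ContDiffBump.hasCompactSupport _).comp_left (g := fun r : ℝ => (r : ℂ)) (by simp)
  obtain ⟨C, hC⟩ := (HasCompactSupport.wirt (a := a) (w := w) hs).exists_bound_of_continuous
    (ContDiff.wirt hb).continuous
  refine ⟨C, fun m x => ?_⟩
  have hd (v : CSpace n) : fderiv ℝ (fun y => (cutoff n m y : ℂ)) x v =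
      ((m : ℝ) + 1)⁻¹ • fderiv ℝ b (((m : ℝ) + 1)⁻¹ • x) v := by
    have h1 := ((hb.differentiable (by simp)) (((m : ℝ) + 1)⁻¹ • x)).hasFDerivAt.comp x
      ((hasFDerivAt_id x).const_smul ((m : ℝ) + 1)⁻¹)
    rw [show (fun y => (cutoff n m y : ℂ)) = b ∘ fun y => ((m : ℝ) + 1)⁻¹ • id y from rfl]
    erw [h1.fderiv]
    simp
  have e : wirt a w (fun y => (cutoff n m y : ℂ)) x =
      ((m : ℝ) + 1)⁻¹ • wirt a w b (((m : ℝ) + 1)⁻¹ • x) := by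
    simp only [wirt, hd, Complex.real_smul]
    ring
  rw [e, norm_smul, Real.norm_of_nonneg (by positivity), mul_comm]
  gcongr
  exact hC _

theorem tendstoL2_cutoff_mul {f : CSpace n → ℂ} (hf : MemLp f 2) :
    TendstoL2 (fun m x => (cutoff n m x : ℂ) * f x) f := by
  have hm (m : ℕ) : MemLp (fun x => (cutoff n m x : ℂ) * f x) 2 :=
    hf.of_le_mul (c := 1) ((isTest_cutoff m).continuous.aestronglyMeasurable.mul hf.1)
      (.of_forall fun x => by
        rw [norm_mul]
        gcongr
        exact norm_cutoff_le m x)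
  refine ⟨hm, hf, ?_⟩
  have e2 (u : CSpace n → ℂ) : eLpNorm u 2 volume ^ 2 = ∫⁻ x, ‖u x‖ₑ ^ 2 := by
    have := eLpNorm_nnreal_pow_eq_lintegral (μ := volume) (f := u) (p := 2) (by simp)
    simpa using this
  have h1 : Tendsto (fun m => eLpNorm ((fun x => (cutoff n m x : ℂ) * f x) - f) 2 volume ^ 2)
      atTop (𝓝 0) := by
    simp only [e2]
    have hb : Tendsto (fun m => ∫⁻ x, ‖((fun x => (cutoff n m x : ℂ) * f x) - f) x‖ₑ ^ 2)
        atTop (𝓝 (∫⁻ _ : CSpace n, 0)) := by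
      refine tendsto_lintegral_of_dominated_convergence' (fun x => 4 * ‖f x‖ₑ ^ 2)
        (fun m => ((hm m).1.sub hf.1).enorm.pow_const 2)
        (fun m => .of_forall fun x => ?_) ?_ (.of_forall fun x => ?_)
      · have : ‖((fun x => (cutoff n m x : ℂ) * f x) - f) x‖ₑ ≤ 2 * ‖f x‖ₑ := by
          rw [Pi.sub_apply, ← sub_one_mul, enorm_mul]
          gcongr
          rw [← ofReal_norm, ← ENNReal.ofReal_ofNat]
          refine ENNReal.ofReal_le_ofReal ((norm_sub_le _ _).trans ?_)
          have := norm_cutoff_le m x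
          simp only [norm_one]
          linarith
        calc _ ≤ (2 * ‖f x‖ₑ) ^ 2 := pow_le_pow_left₀ zero_le this 2
          _ = _ := by rw [mul_pow]; norm_num
      · rw [lintegral_const_mul' _ _ (by norm_num), ← e2]
        exact ENNReal.mul_ne_top (by norm_num) (ENNReal.pow_ne_top hf.2.ne)
      · refine tendsto_const_nhds.congr' ?_
        filter_upwards [eventually_ge_atTop ⌈‖x‖⌉₊] with m hmx
        have : ‖x‖ ≤ m + 1 := (Nat.le_ceil _).trans (by
          have : (⌈‖x‖⌉₊ : ℝ) ≤ m := by exact_mod_cast hmx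
          linarith)
        simp [cutoff_eq_one this]
    simpa using hb
  have h2 := (ENNReal.continuous_rpow_const (y := 2⁻¹)).tendsto 0 |>.comp h1
  rw [ENNReal.zero_rpow_of_pos (by norm_num)] at h2
  refine h2.congr fun m => ?_
  simp only [Function.comp]
  rw [← ENNReal.rpow_natCast, ← ENNReal.rpow_mul]
  norm_num

theorem tendstoL2_wirt_cutoff_mul {f : CSpace n → ℂ} (hf : MemLp f 2) (a : ℂ) (w : CSpace n) :
    TendstoL2 (fun m x => wirt a w (fun y => (cutoff n m y : ℂ)) x * f x) (fun _ => 0) := by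
  obtain ⟨C, hC⟩ := exists_bound_wirt_cutoff a w
  have hb (m : ℕ) (x : CSpace n) : ‖wirt a w (fun y => (cutoff n m y : ℂ)) x * f x‖ ≤
      C * ((m : ℝ) + 1)⁻¹ * ‖f x‖ := by
    rw [norm_mul]
    gcongr
    exact hC m x
  have hcont (m : ℕ) : Continuous (wirt a w fun y => (cutoff n m y : ℂ)) :=
    (isTest_cutoff m).wirt.continuous
  refine ⟨fun m => hf.of_le_mul ((hcont m).aestronglyMeasurable.mul hf.1)
    (.of_forall (hb m)), MemLp.zero', ?_⟩
  have h1 : Tendsto (fun m : ℕ => ENNReal.ofReal (C * ((m : ℝ) + 1)⁻¹) * eLpNorm f 2 volume)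
      atTop (𝓝 0) := by
    have : Tendsto (fun m : ℕ => C * ((m : ℝ) + 1)⁻¹) atTop (𝓝 0) := by
      simpa using (tendsto_one_div_add_atTop_nhds_zero_nat (𝕜 := ℝ)).const_mul C
    have := ENNReal.Tendsto.mul_const (ENNReal.tendsto_ofReal this) (Or.inr hf.2.ne)
    simpa using this
  refine tendsto_of_tendsto_of_tendsto_of_le_of_le tendsto_const_nhds h1
    (fun _ => zero_le) fun m => ?_
  refine eLpNorm_le_mul_eLpNorm_of_ae_le_mul (.of_forall fun x => ?_) 2
  simpa using hb m x

variable {φ : CSpace n → ℝ}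

theorem conj_halfWirt (a : ℂ) (k : Fin n) (x : CSpace n) :
    conj (halfWirt φ a k x) = halfWirt φ (conj a) k x := by
  simp only [halfWirt, map_div₀, conj_wirt, conj_ofReal, Complex.conj_ofNat]

/-- The basic estimate for global `L²` forms with weakly defined derivatives. -/
theorem basic_estimate_global (hφ : ContDiff ℝ ∞ φ) {c : ℝ}
    (hc : ∀ x (w : Fin n → ℂ), c * ∑ k, ‖w k‖ ^ 2 ≤
      (∑ j, ∑ k, mixedDeriv φ j k x * w j * conj (w k)).re)
    {w : Fin n → CSpace n → ℂ} {g : CSpace n → ℂ} (hw : ∀ k, MemLp (w k) 2) (hg : MemLp g 2)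
    (hA : ∀ χ, IsTest χ → ∑ k, ∫ y, w k y * conj (dbarW φ (cbasis k) χ y) =
      -∫ y, g y * conj (χ y))
    (hB : ∀ j k χ, IsTest χ → ∫ y, w k y * conj (delW φ (cbasis j) χ y) =
      ∫ y, w j y * conj (delW φ (cbasis k) χ y)) :
    c * ∑ k, ∫ x, ‖w k x‖ ^ 2 ≤ ∫ x, ‖g x‖ ^ 2 := by
  set θ : ℕ → CSpace n → ℂ := fun m x => (cutoff n m x : ℂ) with hθ
  have hT (m : ℕ) : IsTest (θ m) := isTest_cutoff m
  have cV (k : Fin n) : TendstoL2 (fun m x => θ m x * w k x) (w k) := tendstoL2_cutoff_mul (hw k)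
  have cG : TendstoL2 (fun m x => θ m x * g x + ∑ k, wirt (-I) (cbasis k) (θ m) x * w k x) g := by
    simpa using (tendstoL2_cutoff_mul hg).add
      (TendstoL2.sum Finset.univ fun k _ => tendstoL2_wirt_cutoff_mul (hw k) (-I) (cbasis k))
  have cS (j k : Fin n) : TendstoL2 (fun m x => wirt I (cbasis j) (θ m) x * w k x +
      wirt I (-cbasis k) (θ m) x * w j x) (fun _ => 0) := by
    simpa using (tendstoL2_wirt_cutoff_mul (hw k) I (cbasis j)).add
      (tendstoL2_wirt_cutoff_mul (hw j) I (-cbasis k))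
  have wneg (f : CSpace n → ℂ) (v x : CSpace n) : wirt I (-v) f x = -wirt I v f x := by
    simp only [wirt, smul_neg, map_neg]
    ring
  have key (m : ℕ) : c * ∑ k, ∫ x, ‖θ m x * w k x‖ ^ 2 ≤
      (∫ x, ‖θ m x * g x + ∑ k, wirt (-I) (cbasis k) (θ m) x * w k x‖ ^ 2) +
      (∑ j, ∑ k, ∫ x, ‖wirt I (cbasis j) (θ m) x * w k x +
        wirt I (-cbasis k) (θ m) x * w j x‖ ^ 2) / 2 := by
    have i0 {s f : CSpace n → ℂ} (hs : IsTest s) (hf : MemLp f 2) :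
        Integrable fun y => f y * s y := MemLp.integrable_mul hf hs.memLp
    refine basic_estimate_weak hφ hc (fun k => (cV k).memLp_seq m)
      (fun k => (hT m).2.mul_right) (cG.memLp_seq m) (fun j k => (cS j k).memLp_seq m) ?_ ?_
    · intro t ht
      have hst : IsTest fun y => θ m y * t y := IsTest.mul_left (hT m).1 ht
      have e1 := hA _ hst.conjugate
      have e2 (k : Fin n) (y : CSpace n) :
          conj (dbarW φ (cbasis k) (fun y => conj (θ m y * t y)) y) =
          θ m y * wirt (-I) (cbasis k) t y + (wirt (-I) (cbasis k) (θ m) y * t y +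
            halfWirt φ (-I) k y * θ m y * t y) := by
        simp only [dbarW, map_add, conj_wirt, map_mul, Complex.conj_conj, conj_I]
        rw [← halfWirt, conj_halfWirt, conj_I,
          wirt_mul ((hT m).differentiable y) (ht.differentiable y)]
        ring
      have t1 (k : Fin n) : IsTest fun y => θ m y * wirt (-I) (cbasis k) t y :=
        IsTest.mul_left (hT m).1 ht.wirt
      have t2 (k : Fin n) : IsTest fun y => wirt (-I) (cbasis k) (θ m) y * t y +
          halfWirt φ (-I) k y * θ m y * t y := by
        refine (IsTest.mul_left (hT m).wirt.1 ht).add (IsTest.mul_left (ContDiff.mul ?_ (hT m).1) ht)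
        exact (ContDiff.wirt hφ.ofReal_comp).div_const 2
      simp only [e2, mul_add (w _ _), Complex.conj_conj] at e1
      have e3 (k : Fin n) : ∫ y, (w k y * (θ m y * wirt (-I) (cbasis k) t y) +
          (w k y * (wirt (-I) (cbasis k) (θ m) y * t y) +
            w k y * (halfWirt φ (-I) k y * θ m y * t y))) =
          (∫ y, θ m y * w k y * wirt (-I) (cbasis k) t y) +
          ∫ y, w k y * (wirt (-I) (cbasis k) (θ m) y * t y +
            halfWirt φ (-I) k y * θ m y * t y) := by
        simp only [← mul_add]
        simp only [mul_add (w _ _) (θ m _ * _)]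
        rw [integral_add (i0 (t1 k) (hw k)) (i0 (t2 k) (hw k))]
        congr 2
        ext y
        ring
      simp only [e3, Finset.sum_add_distrib] at e1
      rw [eq_sub_of_add_eq e1, ← integral_finsetSum _ fun k _ => i0 (t2 k) (hw k), ← neg_add',
        ← integral_add (i0 hst hg) (integrable_finsetSum _ fun k _ => i0 (t2 k) (hw k))]
      congr 2
      ext y
      rw [add_assoc, ← Finset.sum_add_distrib, add_mul, Finset.sum_mul]
      congr 1
      · ring
      · exact Finset.sum_congr rfl fun k _ => by ring
    · intro j k t ht
      have hst : IsTest fun y => θ m y * t y := IsTest.mul_left (hT m).1 ht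
      have e1 := hB j k _ hst.conjugate
      have e2 (k : Fin n) (y : CSpace n) :
          conj (delW φ (cbasis k) (fun y => conj (θ m y * t y)) y) =
          θ m y * wirt I (cbasis k) t y + (wirt I (cbasis k) (θ m) y * t y +
            -halfWirt φ I k y * θ m y * t y) := by
        simp only [conj_delW, Complex.conj_conj]
        rw [← halfWirt, wirt_mul ((hT m).differentiable y) (ht.differentiable y)]
        ring
      have t1 (k : Fin n) : IsTest fun y => θ m y * wirt I (cbasis k) t y :=
        IsTest.mul_left (hT m).1 ht.wirt
      have t2 (k : Fin n) : IsTest fun y => wirt I (cbasis k) (θ m) y * t y +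
          -halfWirt φ I k y * θ m y * t y := by
        refine (IsTest.mul_left (hT m).wirt.1 ht).add (IsTest.mul_left (ContDiff.mul ?_ (hT m).1) ht)
        exact ((ContDiff.wirt hφ.ofReal_comp).div_const 2).neg
      have e3 (j k : Fin n) : ∫ y, w k y * (θ m y * wirt I (cbasis j) t y +
          (wirt I (cbasis j) (θ m) y * t y + -halfWirt φ I j y * θ m y * t y)) =
          (∫ y, θ m y * w k y * wirt I (cbasis j) t y) +
          ∫ y, w k y * (wirt I (cbasis j) (θ m) y * t y + -halfWirt φ I j y * θ m y * t y) := by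
        simp only [mul_add (w _ _) (θ m _ * _)]
        rw [integral_add (i0 (t1 j) (hw k)) (i0 (t2 j) (hw k))]
        congr 2
        ext y
        ring
      simp only [e2, e3] at e1
      have e4 : (∫ y, θ m y * w k y * wirt I (cbasis j) t y) -
          ∫ y, θ m y * w j y * wirt I (cbasis k) t y =
          -((∫ y, w k y * (wirt I (cbasis j) (θ m) y * t y + -halfWirt φ I j y * θ m y * t y)) -
          ∫ y, w j y * (wirt I (cbasis k) (θ m) y * t y + -halfWirt φ I k y * θ m y * t y)) := by
        linear_combination e1
      rw [e4, ← integral_sub (i0 (t2 j) (hw k)) (i0 (t2 k) (hw j))]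
      congr 2
      ext y
      rw [wneg]
      ring
  have lim := (cG.tendsto_integral.add ((tendsto_finsetSum Finset.univ fun j _ =>
      tendsto_finsetSum Finset.univ fun k _ => (cS j k).tendsto_integral).div_const 2))
  simp only [norm_zero, ne_eq, OfNat.ofNat_ne_zero, not_false_eq_true, zero_pow, integral_zero,
    Finset.sum_const_zero, zero_div, add_zero] at lim
  exact le_of_tendsto_of_tendsto'
    ((tendsto_finsetSum Finset.univ fun k _ => (cV k).tendsto_integral).const_mul c) lim key

end Cutoff

section Hormander

variable {n : ℕ} {φ : CSpace n → ℝ}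

theorem inner_toLp_toLp {f g : CSpace n → ℂ} (hf : MemLp f 2) (hg : MemLp g 2) :
    ⟪hf.toLp f, hg.toLp g⟫_ℂ = ∫ x, g x * conj (f x) := by
  rw [L2.inner_def]
  refine integral_congr_ae ?_
  filter_upwards [hf.coeFn_toLp, hg.coeFn_toLp] with x hx hy
  rw [hx, hy]
  rfl

theorem inner_toLp_left {f : CSpace n → ℂ} (hf : MemLp f 2) (g : Lp ℂ 2 (volume : Measure (CSpace n))) :
    ⟪hf.toLp f, g⟫_ℂ = ∫ x, g x * conj (f x) := by
  rw [L2.inner_def]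
  refine integral_congr_ae ?_
  filter_upwards [hf.coeFn_toLp] with x hx
  rw [hx]
  rfl

theorem delW_add {w x : CSpace n} {f g : CSpace n → ℂ} (hf : IsTest f) (hg : IsTest g) :
    delW φ w (fun y => f y + g y) x = delW φ w f x + delW φ w g x := by
  simp only [delW, wirt_add (hf.differentiable x) (hg.differentiable x)]
  ring

theorem delW_const_mul {w x : CSpace n} {f : CSpace n → ℂ} (c : ℂ) (hf : IsTest f) :
    delW φ w (fun y => c * f y) x = c * delW φ w f x := by
  simp only [delW, wirt_const_mul c (hf.differentiable x)]
  ring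

theorem IsTest.sum_delW (hφ : ContDiff ℝ ∞ φ) {v : Fin n → CSpace n → ℂ}
    (hv : ∀ k, IsTest (v k)) : IsTest fun x => ∑ k, _root_.delW φ (cbasis k) (v k) x :=
  IsTest.sum _ fun k _ => (hv k).delW hφ

/-- The space of square integrable `n`-tuples of functions on `ℂⁿ`. -/
abbrev FormSpace (n : ℕ) := PiLp 2 fun _ : Fin n => Lp ℂ 2 (volume : Measure (CSpace n))

/-- The range of the formal adjoint of `∂̄` on test forms. -/
noncomputable def adjointRange (hφ : ContDiff ℝ ∞ φ) :
    Submodule ℂ (Lp ℂ 2 (volume : Measure (CSpace n))) where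
  carrier := {x | ∃ (v : Fin n → CSpace n → ℂ) (hv : ∀ k, IsTest (v k)),
    x = (IsTest.sum_delW hφ hv).memLp.toLp _}
  add_mem' := by
    rintro _ _ ⟨v, hv, rfl⟩ ⟨u, hu, rfl⟩
    refine ⟨fun k x => v k x + u k x, fun k => (hv k).add (hu k), ?_⟩
    rw [← MemLp.toLp_add]
    refine (MemLp.toLp_eq_toLp_iff _ _).2 (.of_forall fun x => ?_)
    simp only [Pi.add_apply, delW_add (hv _) (hu _), Finset.sum_add_distrib]
  zero_mem' := by
    have h0 : IsTest (fun _ : CSpace n => (0 : ℂ)) := ⟨contDiff_const, HasCompactSupport.zero⟩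
    refine ⟨fun _ _ => 0, fun _ => h0, ?_⟩
    rw [← MemLp.toLp_zero (MemLp.zero' (ε := ℂ))]
    refine (MemLp.toLp_eq_toLp_iff _ _).2 (.of_forall fun x => ?_)
    simp [delW, wirt_const]
  smul_mem' := by
    rintro c _ ⟨v, hv, rfl⟩
    refine ⟨fun k x => c * v k x, fun k => IsTest.mul_left contDiff_const (hv k), ?_⟩
    rw [← MemLp.toLp_const_smul]
    refine (MemLp.toLp_eq_toLp_iff _ _).2 (.of_forall fun x => ?_)
    simp only [Pi.smul_apply, delW_const_mul c (hv _), Finset.mul_sum, smul_eq_mul]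

/-- The weakly `∂̄`-closed forms. -/
noncomputable def closedForms (hφ : ContDiff ℝ ∞ φ) : Submodule ℂ (FormSpace n) where
  carrier := {x | ∀ (j k : Fin n) (χ : CSpace n → ℂ) (hχ : IsTest χ),
    ⟪(hχ.delW (w := cbasis j) hφ).memLp.toLp _, x k⟫_ℂ =
      ⟪(hχ.delW (w := cbasis k) hφ).memLp.toLp _, x j⟫_ℂ}
  add_mem' := fun ha hb j k χ hχ => by
    simp only [PiLp.add_apply, inner_add_right, ha j k χ hχ, hb j k χ hχ]
  zero_mem' := fun j k χ hχ => by simp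
  smul_mem' := fun c x hx j k χ hχ => by
    simp only [PiLp.smul_apply, inner_smul_right, hx j k χ hχ]

theorem isClosed_closedForms (hφ : ContDiff ℝ ∞ φ) :
    IsClosed (closedForms hφ : Set (FormSpace n)) := by
  have : (closedForms hφ : Set (FormSpace n)) =
      ⋂ (j : Fin n) (k : Fin n) (χ : CSpace n → ℂ) (hχ : IsTest χ), {x : FormSpace n |
        ⟪(hχ.delW (w := cbasis j) hφ).memLp.toLp _, x k⟫_ℂ =
          ⟪(hχ.delW (w := cbasis k) hφ).memLp.toLp _, x j⟫_ℂ} := by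
    ext x
    simp only [mem_iInter]
    rfl
  rw [this]
  refine isClosed_iInter fun j => isClosed_iInter fun k => isClosed_iInter fun χ =>
    isClosed_iInter fun hχ => isClosed_eq ?_ ?_ <;>
  exact continuous_const.inner (PiLp.continuous_apply 2 _ _)

/-- The element of `FormSpace n` defined by a tuple of test functions. -/
noncomputable def testForm {v : Fin n → CSpace n → ℂ} (hv : ∀ k, IsTest (v k)) : FormSpace n :=
  WithLp.toLp 2 fun k => (hv k).memLp.toLp (v k)

theorem testForm_apply {v : Fin n → CSpace n → ℂ} (hv : ∀ k, IsTest (v k)) (k : Fin n) :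
    testForm hv k = (hv k).memLp.toLp (v k) := rfl

theorem dbar_mem_closedForms (hφ : ContDiff ℝ ∞ φ) {χ : CSpace n → ℂ} (hχ : IsTest χ) :
    testForm (fun k => hχ.dbarW (w := cbasis k) hφ) ∈ closedForms hφ := by
  intro j k ξ hξ
  rw [testForm_apply, testForm_apply]
  rw [inner_toLp_toLp, inner_toLp_toLp]
  have h (j k : Fin n) := integral_dbarW_mul_conj (w := cbasis j) hφ
    (hχ.dbarW (w := cbasis k) hφ).1 hξ
  rw [← neg_eq_iff_eq_neg.2 (h j k), ← neg_eq_iff_eq_neg.2 (h k j)]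
  simp only [dbarW_comm hφ hχ.1 (v := cbasis j) (w := cbasis k)]

theorem norm_form_sq (x : FormSpace n) : ‖x‖ ^ 2 = ∑ k, ‖x k‖ ^ 2 :=
  PiLp.norm_sq_eq_of_L2 _ x

/-- The a priori estimate for the projection of a test form to the closed forms. -/
theorem norm_starProjection_closedForms_le (hφ : ContDiff ℝ ∞ φ) {c : ℝ}
    (hc : ∀ x (w : Fin n → ℂ), c * ∑ k, ‖w k‖ ^ 2 ≤
      (∑ j, ∑ k, mixedDeriv φ j k x * w j * conj (w k)).re)
    {v : Fin n → CSpace n → ℂ} (hv : ∀ k, IsTest (v k)) :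
    ∃ x ∈ closedForms hφ, testForm hv - x ∈ (closedForms hφ)ᗮ ∧
      c * ‖x‖ ^ 2 ≤ ‖(IsTest.sum_delW hφ hv).memLp.toLp _‖ ^ 2 := by
  have : CompleteSpace (closedForms hφ) :=
    (isClosed_closedForms hφ).isComplete.completeSpace_coe
  obtain ⟨x, hx, y, hy, hxy⟩ := (closedForms hφ).exists_add_mem_mem_orthogonal (testForm hv)
  have hsub : testForm hv - x = y := by rw [hxy]; abel
  refine ⟨x, hx, hsub ▸ hy, ?_⟩
  have mem (k : Fin n) : MemLp (x k : CSpace n → ℂ) 2 := Lp.memLp _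
  have hnorm : ‖x‖ ^ 2 = ∑ k, ∫ z, ‖x k z‖ ^ 2 := by
    rw [norm_form_sq]
    refine Finset.sum_congr rfl fun k _ => ?_
    rw [integral_norm_sq_eq (mem k), Lp.toLp_coeFn]
  rw [hnorm, ← integral_norm_sq_eq (IsTest.sum_delW hφ hv).memLp]
  refine basic_estimate_global hφ hc mem (IsTest.sum_delW hφ hv).memLp ?_ ?_
  · intro χ hχ
    have h1 : ⟪testForm (fun k => hχ.dbarW (w := cbasis k) hφ), x⟫_ℂ =
        ⟪testForm (fun k => hχ.dbarW (w := cbasis k) hφ), testForm hv⟫_ℂ := by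
      rw [hxy, inner_add_right, hy _ (dbar_mem_closedForms hφ hχ), add_zero]
    rw [PiLp.inner_apply, PiLp.inner_apply] at h1
    simp only [testForm_apply, inner_toLp_toLp] at h1
    simp only [inner_toLp_left] at h1
    rw [h1]
    have h2 (k : Fin n) : ∫ y, v k y * conj (dbarW φ (cbasis k) χ y) =
        -∫ y, delW φ (cbasis k) (v k) y * conj (χ y) := by
      have := congrArg conj (integral_dbarW_mul_conj (w := cbasis k) hφ hχ.1 (hv k))
      rw [map_neg, ← integral_conj, ← integral_conj] at this
      simp only [map_mul, Complex.conj_conj] at this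
      simpa only [mul_comm] using this
    simp only [h2, Finset.sum_neg_distrib, Finset.sum_mul]
    rw [integral_finsetSum]
    exact fun k _ => (IsTest.mul_left ((hv k).delW hφ).1 hχ.conjugate).integrable
  · intro j k χ hχ
    have := hx j k χ hχ
    simpa only [inner_toLp_left] using this

/-- Hörmander's `L²` estimate: a test function `σ` is within `c⁻¹ ‖∂̄σ‖²` of the
weak solutions of `∂̄ f = 0` (all twisted by the weight). -/
theorem exists_weakly_holomorphic_near (hφ : ContDiff ℝ ∞ φ) {c : ℝ} (hc0 : 0 < c)
    (hc : ∀ x (w : Fin n → ℂ), c * ∑ k, ‖w k‖ ^ 2 ≤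
      (∑ j, ∑ k, mixedDeriv φ j k x * w j * conj (w k)).re)
    {σ : CSpace n → ℂ} (hσ : IsTest σ) :
    ∃ f : CSpace n → ℂ, MemLp f 2 ∧
      (∀ k χ, IsTest χ → ∫ x, f x * conj (delW φ (cbasis k) χ x) = 0) ∧
      c * ∫ x, ‖σ x - f x‖ ^ 2 ≤ ∑ k, ∫ x, ‖dbarW φ (cbasis k) σ x‖ ^ 2 := by
  set s := hσ.memLp.toLp σ
  set α := testForm (fun k => hσ.dbarW (w := cbasis k) hφ) with hα
  set M := (adjointRange hφ).topologicalClosure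
  have hMc : IsClosed (M : Set (Lp ℂ 2 (volume : Measure (CSpace n)))) :=
    (adjointRange hφ).isClosed_topologicalClosure
  have : CompleteSpace M := hMc.isComplete.completeSpace_coe
  obtain ⟨u, hu, f, hf, huf⟩ := M.exists_add_mem_mem_orthogonal s
  have hbound : ∀ g ∈ adjointRange hφ, c * ‖⟪g, s⟫_ℂ‖ ^ 2 ≤ ‖α‖ ^ 2 * ‖g‖ ^ 2 := by
    rintro _ ⟨v, hv, rfl⟩
    obtain ⟨x, hx, hxv, hle⟩ := norm_starProjection_closedForms_le hφ hc hv
    have h1 : ⟪α, testForm hv⟫_ℂ = ⟪α, x⟫_ℂ := by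
      have := hxv α (dbar_mem_closedForms hφ hσ)
      rw [inner_sub_right, sub_eq_zero] at this
      exact this
    have h2 : ⟪s, (IsTest.sum_delW hφ hv).memLp.toLp _⟫_ℂ = -⟪α, testForm hv⟫_ℂ := by
      rw [PiLp.inner_apply]
      simp only [hα, testForm_apply, inner_toLp_toLp, s]
      have h2 (k : Fin n) : ∫ y, v k y * conj (dbarW φ (cbasis k) σ y) =
          -∫ y, delW φ (cbasis k) (v k) y * conj (σ y) := by
        have := congrArg conj (integral_dbarW_mul_conj (w := cbasis k) hφ hσ.1 (hv k))
        rw [map_neg, ← integral_conj, ← integral_conj] at this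
        simp only [map_mul, Complex.conj_conj] at this
        simpa only [mul_comm] using this
      simp only [h2, Finset.sum_neg_distrib, Finset.sum_mul, neg_neg]
      rw [integral_finsetSum]
      exact fun k _ => (IsTest.mul_left ((hv k).delW hφ).1 hσ.conjugate).integrable
    rw [norm_inner_symm, h2, norm_neg, h1]
    have h3 : ‖⟪α, x⟫_ℂ‖ ^ 2 ≤ ‖α‖ ^ 2 * ‖x‖ ^ 2 := by
      rw [← mul_pow]
      gcongr
      exact norm_inner_le_norm α x
    calc c * ‖⟪α, x⟫_ℂ‖ ^ 2 ≤ c * (‖α‖ ^ 2 * ‖x‖ ^ 2) := by gcongr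
      _ = ‖α‖ ^ 2 * (c * ‖x‖ ^ 2) := by ring
      _ ≤ _ := by gcongr
  have hboundM : ∀ g ∈ M, c * ‖⟪g, s⟫_ℂ‖ ^ 2 ≤ ‖α‖ ^ 2 * ‖g‖ ^ 2 := by
    have hcl : IsClosed {g : Lp ℂ 2 (volume : Measure (CSpace n)) |
        c * ‖⟪g, s⟫_ℂ‖ ^ 2 ≤ ‖α‖ ^ 2 * ‖g‖ ^ 2} :=
      isClosed_le (by fun_prop) (by fun_prop)
    intro g hg
    exact closure_minimal hbound hcl hg
  have hus : ⟪u, s⟫_ℂ = (‖u‖ : ℂ) ^ 2 := by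
    rw [huf, inner_add_right, hf u hu, add_zero, inner_self_eq_norm_sq_to_K]
    rfl
  have hfin : c * ‖u‖ ^ 2 ≤ ‖α‖ ^ 2 := by
    have := hboundM u hu
    rw [hus, norm_pow, Complex.norm_real, norm_norm] at this
    rcases (norm_nonneg u).eq_or_lt with h | h
    · rw [← h]
      simp
    · have h2 : 0 < ‖u‖ ^ 2 := by positivity
      refine le_of_mul_le_mul_right ?_ h2
      calc _ = c * (‖u‖ ^ 2) ^ 2 := by ring
        _ ≤ _ := this
  refine ⟨f, Lp.memLp _, fun k χ hχ => ?_, ?_⟩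
  · set v : Fin n → CSpace n → ℂ := fun i => if i = k then χ else fun _ => 0 with hv
    have h0 : IsTest (fun _ : CSpace n => (0 : ℂ)) := ⟨contDiff_const, HasCompactSupport.zero⟩
    have hvt (i : Fin n) : IsTest (v i) := by
      simp only [hv]
      split_ifs
      exacts [hχ, h0]
    have := hf _ ((adjointRange hφ).le_topologicalClosure ⟨v, hvt, rfl⟩)
    rw [inner_toLp_left] at this
    convert this using 6 with x
    rw [Finset.sum_eq_single k]
    · simp [hv]
    · intro i _ hi
      simp [hv, hi, delW, wirt_const]
    · simp
  · have e1 : ‖α‖ ^ 2 = ∑ k, ∫ x, ‖dbarW φ (cbasis k) σ x‖ ^ 2 := by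
      rw [norm_form_sq]
      refine Finset.sum_congr rfl fun k _ => ?_
      rw [integral_norm_sq_eq (hσ.dbarW hφ).memLp]
      rfl
    have e2 : ∫ x, ‖σ x - f x‖ ^ 2 = ‖u‖ ^ 2 := by
      have hm : MemLp (fun x => σ x - f x) 2 := hσ.memLp.sub (Lp.memLp f)
      rw [integral_norm_sq_eq hm]
      congr 2
      rw [show u = s - f by rw [huf]; abel]
      refine Lp.ext ?_
      filter_upwards [hm.coeFn_toLp, Lp.coeFn_sub s f, hσ.memLp.coeFn_toLp] with x h1 h2 h3
      rw [h1, h2, Pi.sub_apply, h3]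
    rw [e2, ← e1]
    exact hfin

end Hormander

section MeanValue

variable {n : ℕ} {η : CSpace n → ℝ} {f F : CSpace n → ℂ} {x : CSpace n} {r : ℝ}

/-- Multiplication by a complex number of modulus one, as a real isometry of `ℂⁿ`. -/
noncomputable def rotateIso (n : ℕ) (c : ℂ) (hc : ‖c‖ = 1) : CSpace n ≃ₗᵢ[ℝ] CSpace n where
  toLinearEquiv := (LinearEquiv.smulOfNeZero ℂ (CSpace n) c
    (norm_ne_zero_iff.1 (by simp [hc]))).restrictScalars ℝ
  norm_map' v := by
    change ‖c • v‖ = ‖v‖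
    rw [norm_smul, hc, one_mul]

theorem integral_comp_rotate (c : ℂ) (hc : ‖c‖ = 1) (g : CSpace n → ℂ) :
    ∫ t, g (c • t) = ∫ t, g t :=
  (rotateIso n c hc).measurePreserving.integral_comp
    (rotateIso n c hc).toHomeomorph.measurableEmbedding g

theorem continuous_mul_comp_of_vanishing {r' : ℝ} {Y : Type*} [TopologicalSpace Y]
    (hF : ContinuousOn F (Metric.ball x r)) (hη : Continuous η) (hr : r' < r)
    (h0 : ∀ t, r' ≤ ‖t‖ → η t = 0) {u : Y → ℂ} (hu : Continuous u) (hu1 : ∀ y, ‖u y‖ = 1) :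
    Continuous fun p : Y × CSpace n => (η p.2 : ℂ) * F (x - u p.1 • p.2) := by
  rw [continuous_iff_continuousAt]
  rintro ⟨y, t⟩
  by_cases ht : ‖t‖ < r
  · have h1 : ContinuousAt F (x - u y • t) := by
      refine hF.continuousAt (Metric.isOpen_ball.mem_nhds ?_)
      rw [mem_ball_iff_norm]
      simpa [norm_smul, hu1] using ht
    have h2 : ContinuousAt (fun p : Y × CSpace n => F (x - u p.1 • p.2)) (y, t) :=
      ContinuousAt.comp (f := fun p : Y × CSpace n => x - u p.1 • p.2) (x := (y, t)) h1 (by fun_prop)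
    have h3 : Continuous fun p : Y × CSpace n => (η p.2 : ℂ) := by fun_prop
    exact h3.continuousAt.mul h2
  · have : (fun p : Y × CSpace n => (η p.2 : ℂ) * F (x - u p.1 • p.2)) =ᶠ[𝓝 (y, t)] fun _ => 0 := by
      have h4 : ∀ᶠ p : Y × CSpace n in 𝓝 (y, t), r' < ‖p.2‖ :=
        (continuous_snd.norm.tendsto (y, t)).eventually (lt_mem_nhds (hr.trans_le (not_lt.1 ht)))
      filter_upwards [h4] with p hp
      simp [h0 _ hp.le]
    exact continuousAt_const.congr this.symm

theorem hasCompactSupport_of_vanishing {r' : ℝ} (h0 : ∀ t, r' ≤ ‖t‖ → η t = 0) :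
    HasCompactSupport η := by
  refine HasCompactSupport.of_support_subset_isCompact (isCompact_closedBall 0 r') fun t ht => ?_
  rw [mem_closedBall_zero_iff]
  by_contra h
  exact ht (h0 t (not_le.1 h).le)

theorem moll_eq_of_differentiableOn {r' : ℝ} (hF : DifferentiableOn ℂ F (Metric.ball x r))
    (hη : Continuous η) (hr : r' < r) (h0 : ∀ t, r' ≤ ‖t‖ → η t = 0)
    (hrot : ∀ (c : ℂ) t, ‖c‖ = 1 → η (c • t) = η t) :
    moll η F x = F x * (∫ t, η t : ℝ) := by
  have hs : HasCompactSupport η := hasCompactSupport_of_vanishing h0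
  have hcont := continuous_mul_comp_of_vanishing hF.continuousOn hη hr h0
    (u := fun θ : ℝ => circleMap 0 1 θ) (continuous_circleMap 0 1) (by simp)
  have hconst (θ : ℝ) : ∫ t, (η t : ℂ) * F (x - circleMap 0 1 θ • t) = moll η F x := by
    rw [moll_eq_integral_sub,
      ← integral_comp_rotate (circleMap 0 1 θ) (by simp) fun t => (η t : ℂ) * F (x - t)]
    simp [hrot]
  have hmean (t : CSpace n) : ∫ θ in (0)..(2 * Real.pi), (η t : ℂ) * F (x - circleMap 0 1 θ • t) =
      2 * Real.pi * ((η t : ℂ) * F x) := by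
    by_cases ht : r' ≤ ‖t‖
    · simp [h0 t ht]
    · have h1 : DiffContOnCl ℂ (fun z : ℂ => F (x - z • t)) (Metric.ball 0 |1|) := by
        apply DifferentiableOn.diffContOnCl
        intro z hz
        have hz' : ‖z‖ ≤ 1 := by
          have := Metric.closure_ball_subset_closedBall hz
          simpa using this
        have h2 : DifferentiableAt ℂ F (x - z • t) := by
          refine hF.differentiableAt (Metric.isOpen_ball.mem_nhds ?_)
          rw [mem_ball_iff_norm]
          rw [sub_sub_cancel_left, norm_neg, norm_smul]
          have := not_le.1 ht
          nlinarith [norm_nonneg t, norm_nonneg z]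
        exact (h2.comp z (f := fun z : ℂ => x - z • t) (by fun_prop)).differentiableWithinAt
      have h3 := h1.circleAverage
      rw [Real.circleAverage] at h3
      rw [intervalIntegral.integral_const_mul]
      have h4 : (∫ θ in (0)..(2 * Real.pi), F (x - circleMap 0 1 θ • t)) = 2 * Real.pi * F x := by
        simp only [zero_smul, sub_zero] at h3
        rw [← h3]
        have : (Real.pi : ℂ) ≠ 0 := by simp [Real.pi_ne_zero]
        simp only [Complex.real_smul]
        push_cast
        field_simp
      rw [h4]
      ring
  have hswap := intervalIntegral_integral_swap (μ := (volume : Measure (CSpace n)))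
    (a := 0) (b := 2 * Real.pi) (f := fun θ t => (η t : ℂ) * F (x - circleMap 0 1 θ • t)) (by
      have hb : Integrable (fun p : ℝ × CSpace n => (η p.2 : ℂ) * F (x - circleMap 0 1 p.1 • p.2))
          ((volume.restrict (Icc 0 (2 * Real.pi))).prod volume) := by
        rw [← Measure.restrict_univ (μ := (volume : Measure (CSpace n))), Measure.prod_restrict]
        have h5 : IntegrableOn (fun p : ℝ × CSpace n => (η p.2 : ℂ) * F (x - circleMap 0 1 p.1 • p.2))
            (Icc 0 (2 * Real.pi) ×ˢ Metric.closedBall 0 r') (volume.prod volume) :=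
          hcont.continuousOn.integrableOn_compact (isCompact_Icc.prod (isCompact_closedBall _ _))
        refine h5.of_forall_sdiff_eq_zero (measurableSet_Icc.prod MeasurableSet.univ) ?_
        rintro ⟨θ, t⟩ ⟨h6, h7⟩
        have : r' ≤ ‖t‖ := by
          by_contra h
          exact h7 ⟨h6.1, by simpa using (not_le.1 h).le⟩
        simp [h0 t this]
      refine hb.mono_measure (Measure.prod_mono ?_ le_rfl)
      rw [uIoc_of_le (by positivity)]
      exact Measure.restrict_mono Ioc_subset_Icc_self le_rfl)
  simp only [hconst, hmean] at hswap
  rw [intervalIntegral.integral_const, integral_const_mul, integral_mul_const,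
    integral_complex_ofReal] at hswap
  have hpi : (Real.pi : ℂ) ≠ 0 := by simp [Real.pi_ne_zero]
  simp only [sub_zero, Complex.real_smul] at hswap
  push_cast at hswap
  have h2pi : (2 * Real.pi : ℂ) ≠ 0 := by simp [Real.pi_ne_zero]
  have := mul_left_cancel₀ h2pi hswap
  rw [this, mul_comm]

end MeanValue

section Weyl

variable {n : ℕ} {η κ : CSpace n → ℝ} {f F : CSpace n → ℂ} {x : CSpace n} {r : ℝ}

/-- An unnormalized smooth radial function supported in the ball of radius `r / 2`. -/
noncomputable def radialBump (n : ℕ) (r : ℝ) (x : CSpace n) : ℝ :=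
  Real.smoothTransition (1 - ‖x‖ ^ 2 / (r / 2) ^ 2)

theorem contDiff_radialBump : ContDiff ℝ ∞ (radialBump n r) :=
  Real.smoothTransition.contDiff.comp
    (contDiff_const.sub ((contDiff_norm_sq ℝ).div_const _))

theorem radialBump_eq_zero (hr : 0 < r) (t : CSpace n) (ht : r / 2 ≤ ‖t‖) :
    radialBump n r t = 0 := by
  rw [radialBump, Real.smoothTransition.zero_iff_nonpos, sub_nonpos, one_le_div (by positivity)]
  gcongr

theorem integral_radialBump_pos (hr : 0 < r) : 0 < ∫ t, radialBump n r t :=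
  contDiff_radialBump.continuous.integral_pos_of_hasCompactSupport_nonneg_nonzero
    (hasCompactSupport_of_vanishing (radialBump_eq_zero hr))
    (fun _ => Real.smoothTransition.nonneg _) (x := 0) (by simp [radialBump])

/-- The smooth radial mollifier of integral one supported in the ball of radius `r / 2`. -/
noncomputable def radialKer (n : ℕ) (r : ℝ) (x : CSpace n) : ℝ :=
  (∫ t, radialBump n r t)⁻¹ * radialBump n r x

theorem contDiff_radialKer : ContDiff ℝ ∞ (radialKer n r) :=
  contDiff_const.mul contDiff_radialBump

theorem radialKer_eq_zero (hr : 0 < r) (t : CSpace n) (ht : r / 2 ≤ ‖t‖) :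
    radialKer n r t = 0 := by
  rw [radialKer, radialBump_eq_zero hr t ht, mul_zero]

theorem hasCompactSupport_radialKer (hr : 0 < r) : HasCompactSupport (radialKer n r) :=
  hasCompactSupport_of_vanishing (radialKer_eq_zero hr)

theorem moll_radialKer (hr : 0 < r) (hF : DifferentiableOn ℂ F (Metric.ball x r)) :
    moll (radialKer n r) F x = F x := by
  rw [moll_eq_of_differentiableOn hF contDiff_radialKer.continuous (half_lt_self hr)
    (radialKer_eq_zero hr) fun c t hc => by simp [radialKer, radialBump, norm_smul, hc]]
  simp [radialKer, integral_const_mul, inv_mul_cancel₀ (integral_radialBump_pos hr).ne']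

theorem contDiff_of_differentiable (hF : Differentiable ℂ F) : ContDiff ℝ ∞ F := by
  have : moll (radialKer n 1) F = F := by
    ext x
    exact moll_radialKer one_pos hF.differentiableOn
  rw [← this]
  exact contDiff_moll contDiff_radialKer (hasCompactSupport_radialKer one_pos)
    hF.continuous.locallyIntegrable

/-- The constant in the sub-mean value inequality for square norms. -/
noncomputable def meanConst (n : ℕ) (r : ℝ) : ℝ := ∫ t, radialKer n r t ^ 2

theorem norm_sq_le_of_differentiableOn (hr : 0 < r) (hF : DifferentiableOn ℂ F (Metric.ball x r))
    (hi : IntegrableOn (fun y => ‖F y‖ ^ 2) (Metric.ball x r)) :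
    ‖F x‖ ^ 2 ≤ meanConst n r * ∫ y in Metric.ball x r, ‖F y‖ ^ 2 := by
  have hb : MeasurableSet (Metric.ball x r) := measurableSet_ball
  set u := (Metric.ball x r).indicator F with hu
  have hsq : (fun y => ‖u y‖ ^ 2) = (Metric.ball x r).indicator fun y => ‖F y‖ ^ 2 := by
    ext y
    by_cases hy : y ∈ Metric.ball x r <;> simp [hu, hy]
  have hum : MemLp u 2 := by
    rw [memLp_two_iff_integrable_sq_norm, hsq]
    · exact (integrable_indicator_iff hb).2 hi
    · exact (aestronglyMeasurable_indicator_iff hb).2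
        (hF.continuousOn.aestronglyMeasurable hb)
  have hg : IsTest fun y => (radialKer n r (x - y) : ℂ) :=
    isTest_translate contDiff_radialKer (hasCompactSupport_radialKer hr) x
  have h1 : ⟪hg.memLp.toLp _, hum.toLp u⟫_ℂ = F x := by
    rw [inner_toLp_toLp, ← moll_radialKer hr hF]
    refine integral_congr_ae (.of_forall fun y => ?_)
    by_cases hy : y ∈ Metric.ball x r
    · simp [hu, hy, mul_comm]
    · rw [mem_ball_iff_norm, norm_sub_rev, not_lt] at hy
      simp [radialKer_eq_zero hr (x - y) (by linarith)]
  have h2 : ‖hum.toLp u‖ ^ 2 = ∫ y in Metric.ball x r, ‖F y‖ ^ 2 := by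
    rw [← integral_norm_sq_eq, hsq, integral_indicator hb]
  have h3 : ‖hg.memLp.toLp _‖ ^ 2 = meanConst n r := by
    rw [← integral_norm_sq_eq, meanConst,
      ← integral_sub_left_eq_self (fun t => radialKer n r t ^ 2) _ x]
    simp
  rw [← h1, ← h2, ← h3, ← mul_pow]
  gcongr
  exact norm_inner_le_norm _ _

theorem moll_comm (hη : Continuous η) (hηs : HasCompactSupport η) (hκ : Continuous κ)
    (hκs : HasCompactSupport κ) (hf : LocallyIntegrable f) :
    moll η (moll κ f) = moll κ (moll η f) := by
  ext x
  have key (η κ : CSpace n → ℝ) (hη : Continuous η) (hηs : HasCompactSupport η)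
      (hκ : Continuous κ) (hκs : HasCompactSupport κ) :
      moll η (moll κ f) x = ∫ z, (∫ y, ((η (x - y) * κ (y - z) : ℝ) : ℂ)) * f z := by
    have hint : Integrable (fun p : CSpace n × CSpace n =>
        (η (x - p.1) : ℂ) * ((κ (p.1 - p.2) : ℂ) * f p.2)) (volume.prod volume) := by
      obtain ⟨R, hR⟩ := hηs.isCompact.isBounded.subset_closedBall 0
      obtain ⟨S, hS⟩ := hκs.isCompact.isBounded.subset_closedBall 0
      have h1 : Integrable fun y => (η (x - y) : ℂ) := by
        have h2 : HasCompactSupport fun y => η (x - y) :=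
          hηs.comp_homeomorph (Homeomorph.subLeft x)
        exact ((by fun_prop : Continuous fun y => η (x - y)).integrable_of_hasCompactSupport
          h2).ofReal
      have h3 : Integrable ((Metric.closedBall x (R + S)).indicator f) :=
        (integrable_indicator_iff measurableSet_closedBall).2
          (hf.integrableOn_isCompact (isCompact_closedBall _ _))
      obtain ⟨C, hC⟩ := hκs.exists_bound_of_continuous hκ
      have h4 := (h1.mul_prod h3).bdd_mul (f := fun p : CSpace n × CSpace n => (κ (p.1 - p.2) : ℂ))
        (c := C) (by fun_prop) (.of_forall fun p => by simpa using hC _)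
      refine h4.congr (.of_forall fun p => ?_)
      simp only
      by_cases ha : η (x - p.1) = 0
      · simp [ha]
      by_cases hb : κ (p.1 - p.2) = 0
      · simp [hb]
      have ha' := hR (subset_tsupport _ ha)
      have hb' := hS (subset_tsupport _ hb)
      rw [mem_closedBall_zero_iff] at ha' hb'
      have : p.2 ∈ Metric.closedBall x (R + S) := by
        rw [mem_closedBall_iff_norm, norm_sub_rev, show x - p.2 = (x - p.1) + (p.1 - p.2) by abel]
        exact (norm_add_le _ _).trans (add_le_add ha' hb')
      rw [indicator_of_mem this]
      ring
    calc moll η (moll κ f) x = ∫ y, ∫ z, (η (x - y) : ℂ) * ((κ (y - z) : ℂ) * f z) := by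
          simp only [moll, integral_const_mul]
      _ = ∫ z, ∫ y, (η (x - y) : ℂ) * ((κ (y - z) : ℂ) * f z) := integral_integral_swap hint
      _ = _ := by
          refine integral_congr_ae (.of_forall fun z => ?_)
          simp only
          rw [← integral_mul_const]
          refine integral_congr_ae (.of_forall fun y => ?_)
          push_cast
          ring
  rw [key η κ hη hηs hκ hκs, key κ η hκ hκs hη hηs]
  refine integral_congr_ae (.of_forall fun z => ?_)
  simp only
  congr 1
  rw [← integral_sub_left_eq_self _ _ (x + z)]
  refine integral_congr_ae (.of_forall fun y => ?_)
  simp only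
  rw [mul_comm, show x + z - y - z = x - y by abel, show x - (x + z - y) = y - z by abel]

theorem differentiable_of_wirt_eq_zero (hf : Differentiable ℝ f)
    (h : ∀ k x, wirt I (cbasis k) f x = 0) : Differentiable ℂ f := by
  intro x
  have hI (k : Fin n) : fderiv ℝ f x (I • cbasis k) = I * fderiv ℝ f x (cbasis k) := by
    have h1 := h k x
    rw [wirt] at h1
    have h2 : fderiv ℝ f x (cbasis k) + I * fderiv ℝ f x (I • cbasis k) = 0 := by
      simpa using h1
    linear_combination (-I) * h2 + (fderiv ℝ f x (I • cbasis k)) * I_mul_I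
  have hlin (c : ℂ) (k : Fin n) : fderiv ℝ f x (c • cbasis k) = c * fderiv ℝ f x (cbasis k) := by
    conv_lhs => rw [← Complex.re_add_im c, add_smul, mul_smul]
    rw [map_add, Complex.coe_smul, Complex.coe_smul, map_smul, map_smul, hI]
    simp only [Complex.real_smul]
    conv_rhs => rw [← Complex.re_add_im c]
    ring
  have hsum (v : CSpace n) : v = ∑ k, v k • (cbasis k : CSpace n) := by
    ext j
    simp [cbasis, Pi.single_apply]
  have hv (v : CSpace n) : fderiv ℝ f x v = ∑ k, v k * fderiv ℝ f x (cbasis k) := by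
    conv_lhs => rw [hsum v, map_sum]
    simp [hlin]
  let g : CSpace n →ₗ[ℂ] ℂ :=
    { toFun := fderiv ℝ f x
      map_add' := map_add _
      map_smul' := fun c v => by
        rw [hv, hv v]
        simp [Finset.mul_sum, mul_assoc] }
  exact (hasFDerivAt_of_restrictScalars ℝ (f' := g.toContinuousLinearMap)
    (hf x).hasFDerivAt (by ext v; rfl)).differentiableAt

/-- Weyl's lemma for the Cauchy–Riemann system on `ℂⁿ`. -/
theorem exists_differentiable_ae_eq (hf : LocallyIntegrable f)
    (h : ∀ k χ, IsTest χ → ∫ x, f x * wirt I (cbasis k) χ x = 0) :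
    ∃ F, Differentiable ℂ F ∧ f =ᵐ[volume] F := by
  have hhol (η : CSpace n → ℝ) (hη : ContDiff ℝ ∞ η) (hs : HasCompactSupport η) :
      Differentiable ℂ (moll η f) := by
    refine differentiable_of_wirt_eq_zero
      ((contDiff_moll hη hs hf).differentiable (by simp)) fun k x => ?_
    rw [wirt_moll hη hs hf, h k _ (isTest_translate hη hs x), neg_zero]
  have hη : ContDiff ℝ ∞ (radialKer n 1) := contDiff_radialKer
  have hs : HasCompactSupport (radialKer n 1) := hasCompactSupport_radialKer one_pos
  refine ⟨moll (radialKer n 1) f, hhol _ hη hs, ?_⟩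
  filter_upwards [ae_tendsto_moll hf] with x hx
  have h1 := tendsto_moll_of_continuous (hhol _ hη hs).continuous x
  refine tendsto_nhds_unique hx (h1.congr fun m => ?_)
  rw [← moll_comm hη.continuous hs (contDiff_mollKer m).continuous (hasCompactSupport_mollKer m) hf]
  exact moll_radialKer one_pos
    (hhol _ (contDiff_mollKer m) (hasCompactSupport_mollKer m)).differentiableOn

end Weyl

section Levi

variable {n : ℕ} {φ : CSpace n → ℝ}

theorem leviForm_eq (φ : CSpace n → ℝ) (x w : CSpace n) :
    leviForm φ x w = fderiv ℝ (fderiv ℝ φ) x w w + fderiv ℝ (fderiv ℝ φ) x (I • w) (I • w) := by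
  simp [leviForm, iteratedFDeriv_two_apply]

/-- The sesquilinear form whose diagonal is the Levi form of a function with second derivative
`B`. -/
noncomputable def hermForm (B : CSpace n →L[ℝ] CSpace n →L[ℝ] ℝ) (u v : CSpace n) : ℂ :=
  ((B u v + B (I • u) (I • v) : ℝ) : ℂ) + ((B (I • u) v - B u (I • v) : ℝ) : ℂ) * I

variable {B : CSpace n →L[ℝ] CSpace n →L[ℝ] ℝ} {u v u' v' : CSpace n}

theorem hermForm_add_right : hermForm B u (v + v') = hermForm B u v + hermForm B u v' := by
  simp only [hermForm, smul_add, map_add]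
  push_cast
  ring

theorem hermForm_add_left : hermForm B (u + u') v = hermForm B u v + hermForm B u' v := by
  simp only [hermForm, smul_add, map_add, add_apply]
  push_cast
  ring

theorem hermForm_I_right : hermForm B u (I • v) = I * hermForm B u v := by
  simp only [hermForm, smul_smul, I_mul_I, neg_smul, one_smul, map_neg]
  push_cast
  linear_combination (-(B (I • u) v : ℂ) + (B u (I • v) : ℂ)) * I_mul_I

theorem hermForm_I_left : hermForm B (I • u) v = -I * hermForm B u v := by
  simp only [hermForm, smul_smul, I_mul_I, neg_smul, one_smul, map_neg, neg_apply]
  push_cast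
  linear_combination ((B (I • u) v : ℂ) - (B u (I • v) : ℂ)) * I_mul_I

theorem hermForm_ofReal_right (r : ℝ) : hermForm B u ((r : ℂ) • v) = r * hermForm B u v := by
  simp only [hermForm, Complex.coe_smul, smul_comm I r, map_smul, smul_eq_mul]
  push_cast
  ring

theorem hermForm_ofReal_left (r : ℝ) : hermForm B ((r : ℂ) • u) v = r * hermForm B u v := by
  simp only [hermForm, Complex.coe_smul, smul_comm I r, map_smul, smul_eq_mul,
    smul_apply]
  push_cast
  ring

theorem hermForm_smul_right (c : ℂ) : hermForm B u (c • v) = c * hermForm B u v := by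
  conv_lhs => rw [← Complex.re_add_im c, add_smul, mul_smul]
  rw [hermForm_add_right, hermForm_ofReal_right, hermForm_ofReal_right, hermForm_I_right]
  conv_rhs => rw [← Complex.re_add_im c]
  ring

theorem hermForm_smul_left (c : ℂ) : hermForm B (c • u) v = conj c * hermForm B u v := by
  conv_lhs => rw [← Complex.re_add_im c, add_smul, mul_smul]
  rw [hermForm_add_left, hermForm_ofReal_left, hermForm_ofReal_left, hermForm_I_left]
  rw [show conj c = (c.re : ℂ) - c.im * I from by apply Complex.ext <;> simp]
  ring

theorem hermForm_sum_right {ι : Type*} (s : Finset ι) (f : ι → CSpace n) :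
    hermForm B u (∑ i ∈ s, f i) = ∑ i ∈ s, hermForm B u (f i) :=
  map_sum (AddMonoidHom.mk' (hermForm B u) fun _ _ => hermForm_add_right) f s

theorem hermForm_sum_left {ι : Type*} (s : Finset ι) (f : ι → CSpace n) :
    hermForm B (∑ i ∈ s, f i) v = ∑ i ∈ s, hermForm B (f i) v :=
  map_sum (AddMonoidHom.mk' (hermForm B · v) fun _ _ => hermForm_add_left) f s

theorem mixedDeriv_eq_hermForm (hφ : ContDiff ℝ ∞ φ) (j k : Fin n) (x : CSpace n) :
    mixedDeriv φ j k x = hermForm (fderiv ℝ (fderiv ℝ φ) x) (cbasis k) (cbasis j) / 4 := by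
  have h1 (y v : CSpace n) : fderiv ℝ (fun y => (φ y : ℂ)) y v = (fderiv ℝ φ y v : ℂ) := by
    have := Complex.ofRealCLM.hasFDerivAt.comp y ((hφ.differentiable (by simp)) y).hasFDerivAt
    rw [show (fun y => (φ y : ℂ)) = Complex.ofRealCLM ∘ φ from rfl, this.fderiv]
    rfl
  have hd : Differentiable ℝ (fderiv ℝ φ) :=
    (hφ.fderiv_right (m := ∞) (by simp)).differentiable (by simp)
  have h2 (u v : CSpace n) : fderiv ℝ (fderiv ℝ fun y => (φ y : ℂ)) x u v =
      (fderiv ℝ (fderiv ℝ φ) x u v : ℂ) := by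
    have hd' : DifferentiableAt ℝ (fderiv ℝ fun y => (φ y : ℂ)) x :=
      (hφ.ofReal_comp.fderiv_right (m := ∞) (by simp)).differentiable (by simp) x
    have h5 : HasFDerivAt (fun y => fderiv ℝ (fun y => (φ y : ℂ)) y v) _ x :=
      hd'.hasFDerivAt.clm_apply (hasFDerivAt_const v x)
    have h6 : fderiv ℝ (fun y => fderiv ℝ (fun y => (φ y : ℂ)) y v) x u =
        fderiv ℝ (fderiv ℝ fun y => (φ y : ℂ)) x u v := by
      rw [h5.fderiv]
      simp
    rw [← h6]
    simp only [h1]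
    have h3 : HasFDerivAt (fun y => fderiv ℝ φ y v) _ x :=
      (hd x).hasFDerivAt.clm_apply (hasFDerivAt_const v x)
    have := Complex.ofRealCLM.hasFDerivAt.comp x h3
    rw [show (fun y => ((fderiv ℝ φ y v : ℝ) : ℂ)) = Complex.ofRealCLM ∘ fun y => fderiv ℝ φ y v
      from rfl, this.fderiv]
    simp
  rw [mixedDeriv, wirt, fderiv_wirt hφ.ofReal_comp, fderiv_wirt hφ.ofReal_comp]
  simp only [h2, hermForm]
  push_cast
  ring_nf
  simp only [I_sq]
  ring

theorem sum_smul_cbasis (v : CSpace n) : ∑ k, v k • (cbasis k : CSpace n) = v := by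
  ext j
  simp [cbasis, Pi.single_apply]

theorem re_sum_mixedDeriv (hφ : ContDiff ℝ ∞ φ) (x w : CSpace n) :
    (∑ j, ∑ k, mixedDeriv φ j k x * w j * conj (w k)).re = leviForm φ x w / 4 := by
  have h : ∑ j, ∑ k, mixedDeriv φ j k x * w j * conj (w k) =
      hermForm (fderiv ℝ (fderiv ℝ φ) x) w w / 4 := by
    conv_rhs => rw [← sum_smul_cbasis w, hermForm_sum_right]
    simp only [hermForm_sum_left, hermForm_smul_left, hermForm_smul_right,
      mixedDeriv_eq_hermForm hφ, Finset.sum_div, Finset.mul_sum]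
    refine Finset.sum_congr rfl fun j _ => Finset.sum_congr rfl fun k _ => ?_
    ring
  rw [h, leviForm_eq, hermForm]
  rw [show (4 : ℂ) = ((4 : ℝ) : ℂ) by norm_num, Complex.div_ofReal_re]
  simp

theorem wirt_cexp_mul {a : ℂ} {w : CSpace n} (b : ℂ) (hφ : ContDiff ℝ ∞ φ) {g : CSpace n → ℂ}
    (hg : ContDiff ℝ ∞ g) (x : CSpace n) :
    wirt a w (fun y => cexp (b * φ y) * g y) x =
      cexp (b * φ x) * (b * wirt a w (fun y => (φ y : ℂ)) x * g x + wirt a w g x) := by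
  have h1 : Differentiable ℝ fun y => (φ y : ℂ) := hφ.ofReal_comp.differentiable (by simp)
  have h2 : DifferentiableAt ℝ (fun y => b * (φ y : ℂ)) x := (h1 x).const_mul b
  rw [wirt_mul h2.cexp (hg.differentiable (by simp) x), wirt_exp h2, wirt_const_mul b (h1 x)]
  ring

/-- Hörmander's theorem on `ℂⁿ`: approximating a test function by an entire function in the
weighted norm, with an error controlled by its `∂̄`-derivative. -/
theorem exists_differentiable_near (hφ : ContDiff ℝ ∞ φ) {c : ℝ} (hc0 : 0 < c)
    (hc : ∀ x w, 4 * c * ‖w‖ ^ 2 ≤ leviForm φ x w) {s : CSpace n → ℂ} (hs : IsTest s) :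
    ∃ F : CSpace n → ℂ, Differentiable ℂ F ∧
      Integrable (fun x => ‖s x - F x‖ ^ 2 * Real.exp (-φ x)) ∧
      c * ∫ x, ‖s x - F x‖ ^ 2 * Real.exp (-φ x) ≤
        ∑ k, ∫ x, ‖wirt I (cbasis k) s x‖ ^ 2 * Real.exp (-φ x) := by
  have hE (b : ℂ) : ContDiff ℝ ∞ fun y => cexp (b * φ y) :=
    (contDiff_const.mul hφ.ofReal_comp).cexp
  have hσ : IsTest fun y => cexp ((-1 / 2 : ℂ) * φ y) * s y := IsTest.mul_left (hE _) hs
  obtain ⟨f, hf2, hf, hle⟩ := exists_weakly_holomorphic_near hφ hc0 (fun x w => by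
    have h1 := re_sum_mixedDeriv hφ x (WithLp.toLp 2 w)
    have h2 := hc x (WithLp.toLp 2 w)
    rw [EuclideanSpace.norm_sq_eq] at h2
    simp only [] at h1 h2
    rw [h1]
    linarith) hσ
  have hG : LocallyIntegrable fun x => cexp ((1 / 2 : ℂ) * φ x) * f x := by
    have h3 := hf2.locallyIntegrable (by norm_num)
    have := (h3.locallyIntegrableOn univ).continuousOn_mul (hE (1 / 2)).continuous.continuousOn
      isOpen_univ.isLocallyClosed
    exact locallyIntegrableOn_univ.1 this
  obtain ⟨F, hF, hae⟩ := exists_differentiable_ae_eq hG (fun k χ hχ => by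
    have h4 := hf k (fun y => conj (cexp ((1 / 2 : ℂ) * φ y) * χ y))
      (IsTest.mul_left (hE _) hχ).conjugate
    simp only [conj_delW, Complex.conj_conj, wirt_cexp_mul _ hφ hχ.1] at h4
    rw [← h4]
    refine integral_congr_ae (.of_forall fun x => ?_)
    simp only
    ring)
  have hnorm (x : CSpace n) : ‖cexp ((-1 / 2 : ℂ) * φ x)‖ ^ 2 = Real.exp (-φ x) := by
    rw [Complex.norm_exp, ← Real.exp_nat_mul]
    congr 1
    simp
    ring
  have hcancel (x : CSpace n) : cexp ((-1 / 2 : ℂ) * φ x) * cexp ((1 / 2 : ℂ) * φ x) = 1 := by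
    rw [← Complex.exp_add]
    ring_nf
    simp
  have heq : (fun x => ‖cexp ((-1 / 2 : ℂ) * φ x) * s x - f x‖ ^ 2) =ᵐ[volume]
      fun x => ‖s x - F x‖ ^ 2 * Real.exp (-φ x) := by
    filter_upwards [hae] with x hx
    rw [← hx, ← hnorm, ← mul_pow, ← norm_mul]
    congr 2
    linear_combination f x * hcancel x
  refine ⟨F, hF, ?_, ?_⟩
  · refine Integrable.congr ?_ heq
    have := hσ.memLp.sub hf2
    exact (memLp_two_iff_integrable_sq_norm this.1).1 this
  · rw [← integral_congr_ae heq]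
    refine hle.trans_eq (Finset.sum_congr rfl fun k _ => integral_congr_ae (.of_forall fun x => ?_))
    simp only [dbarW, wirt_cexp_mul _ hφ hs.1]
    rw [← hnorm, ← mul_pow, ← norm_mul]
    congr 2
    ring

end Levi

section LeviCalculus

variable {n : ℕ} {φ ψ : CSpace n → ℝ} {x w : CSpace n}

theorem two_le_infty : (2 : WithTop ℕ∞) ≤ ∞ :=
  WithTop.coe_le_coe.2 le_top

theorem leviForm_congr (h : φ =ᶠ[𝓝 x] ψ) : leviForm φ x w = leviForm ψ x w := by
  rw [leviForm_eq, leviForm_eq, h.fderiv.fderiv_eq]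

theorem ContDiffAt.eventually_differentiableAt (hφ : ContDiffAt ℝ 2 φ x) :
    ∀ᶠ y in 𝓝 x, DifferentiableAt ℝ φ y :=
  (hφ.eventually (by simp)).mono fun _ hy => hy.differentiableAt (by simp)

theorem ContDiffAt.differentiableAt_fderiv (hφ : ContDiffAt ℝ 2 φ x) :
    DifferentiableAt ℝ (fderiv ℝ φ) x :=
  (hφ.fderiv_right (m := 1) (by norm_num)).differentiableAt (by simp)

theorem leviForm_add (hφ : ContDiffAt ℝ 2 φ x) (hψ : ContDiffAt ℝ 2 ψ x) :
    leviForm (fun y => φ y + ψ y) x w = leviForm φ x w + leviForm ψ x w := by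
  have h : fderiv ℝ (fun y => φ y + ψ y) =ᶠ[𝓝 x] fun y => fderiv ℝ φ y + fderiv ℝ ψ y := by
    filter_upwards [hφ.eventually_differentiableAt, hψ.eventually_differentiableAt] with y h1 h2
    exact fderiv_fun_add h1 h2
  rw [leviForm_eq, leviForm_eq, leviForm_eq, h.fderiv_eq,
    fderiv_fun_add hφ.differentiableAt_fderiv hψ.differentiableAt_fderiv]
  simp only [add_apply]
  ring

theorem leviForm_const_mul (c : ℝ) (hφ : ContDiffAt ℝ 2 φ x) :
    leviForm (fun y => c * φ y) x w = c * leviForm φ x w := by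
  have h : fderiv ℝ (fun y => c * φ y) =ᶠ[𝓝 x] fun y => c • fderiv ℝ φ y := by
    filter_upwards [hφ.eventually_differentiableAt] with y h1
    exact fderiv_const_mul h1 c
  rw [leviForm_eq, leviForm_eq, h.fderiv_eq, fderiv_fun_const_smul hφ.differentiableAt_fderiv]
  simp only [smul_apply, smul_eq_mul]
  ring

theorem leviForm_const (c : ℝ) : leviForm (fun _ : CSpace n => c) x w = 0 := by
  simp [leviForm_eq]

theorem leviForm_sub (hφ : ContDiffAt ℝ 2 φ x) (hψ : ContDiffAt ℝ 2 ψ x) :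
    leviForm (fun y => φ y - ψ y) x w = leviForm φ x w - leviForm ψ x w := by
  have h : (fun y => φ y - ψ y) = fun y => φ y + (-1) * ψ y := by
    ext y
    ring
  rw [h, leviForm_add hφ (contDiffAt_const.mul hψ), leviForm_const_mul _ hψ]
  ring

theorem leviForm_sum {ι : Type*} (s : Finset ι) {f : ι → CSpace n → ℝ}
    (hf : ∀ i ∈ s, ContDiffAt ℝ 2 (f i) x) :
    leviForm (fun y => ∑ i ∈ s, f i y) x w = ∑ i ∈ s, leviForm (f i) x w := by
  classical
  induction s using Finset.induction_on with
  | empty => simpa using leviForm_const (x := x) (w := w) 0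
  | insert i s hi ih =>
    simp only [Finset.sum_insert hi]
    rw [leviForm_add (hf i (by simp)) (ContDiffAt.sum fun j hj => hf j (by simp [hj])),
      ih fun j hj => hf j (by simp [hj])]

theorem leviForm_comp (hφ : ContDiffAt ℝ 2 φ x) {g g' : ℝ → ℝ} {g'' : ℝ}
    (hg : ∀ᶠ t in 𝓝 (φ x), HasDerivAt g (g' t) t) (hg' : HasDerivAt g' g'' (φ x)) :
    leviForm (fun y => g (φ y)) x w = g' (φ x) * leviForm φ x w +
      g'' * (fderiv ℝ φ x w ^ 2 + fderiv ℝ φ x (I • w) ^ 2) := by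
  have h : fderiv ℝ (fun y => g (φ y)) =ᶠ[𝓝 x] fun y => g' (φ y) • fderiv ℝ φ y := by
    filter_upwards [hφ.eventually_differentiableAt, hφ.continuousAt.eventually hg] with y h1 h2
    exact (h2.comp_hasFDerivAt y h1.hasFDerivAt).fderiv
  have h1 : HasFDerivAt (fun y => g' (φ y)) (g'' • fderiv ℝ φ x) x :=
    hg'.comp_hasFDerivAt x (hφ.differentiableAt (by simp)).hasFDerivAt
  have h2 : HasFDerivAt (fun y => g' (φ y) • fderiv ℝ φ y) _ x :=
    h1.smul hφ.differentiableAt_fderiv.hasFDerivAt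
  rw [leviForm_eq, leviForm_eq, h.fderiv_eq, h2.fderiv]
  simp
  ring

theorem fderiv_real_apply_I {f : CSpace n → ℂ} (hf : DifferentiableAt ℂ f x) (v : CSpace n) :
    fderiv ℝ f x (I • v) = I * fderiv ℝ f x v := by
  rw [hf.fderiv_restrictScalars ℝ]
  simp

theorem fderiv_re {f : CSpace n → ℂ} (hf : DifferentiableAt ℝ f x) (v : CSpace n) :
    fderiv ℝ (fun y => (f y).re) x v = (fderiv ℝ f x v).re := by
  have := Complex.reCLM.hasFDerivAt.comp x hf.hasFDerivAt
  rw [show (fun y => (f y).re) = Complex.reCLM ∘ f from rfl, this.fderiv]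
  rfl

theorem fderiv_normSq {f : CSpace n → ℂ} (hf : Differentiable ℂ f) (v : CSpace n) :
    fderiv ℝ (fun y => ‖f y‖ ^ 2) x v = 2 * (conj (f x) * fderiv ℝ f x v).re := by
  have h := ((hf x).restrictScalars ℝ).hasFDerivAt.norm_sq
  rw [h.fderiv]
  simp [Complex.inner]
  ring

theorem fderiv_normSq_sq_add {f : CSpace n → ℂ} (hf : Differentiable ℂ f) (w : CSpace n) :
    fderiv ℝ (fun y => ‖f y‖ ^ 2) x w ^ 2 + fderiv ℝ (fun y => ‖f y‖ ^ 2) x (I • w) ^ 2 =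
      4 * (‖f x‖ ^ 2 * ‖fderiv ℝ f x w‖ ^ 2) := by
  rw [fderiv_normSq hf, fderiv_normSq hf, fderiv_real_apply_I (hf x)]
  simp only [← Complex.normSq_eq_norm_sq, Complex.normSq_apply]
  simp
  ring

theorem leviForm_re {f : CSpace n → ℂ} (hf : Differentiable ℂ f) :
    leviForm (fun y => (f y).re) x w = 0 := by
  have hs : ContDiff ℝ ∞ f := contDiff_of_differentiable hf
  have hd : Differentiable ℝ (fderiv ℝ f) :=
    (hs.fderiv_right (m := ∞) (by simp)).differentiable (by simp)
  have hfd : Differentiable ℝ f := hs.differentiable (by simp)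
  have happ (u v : CSpace n) : fderiv ℝ (fun y => fderiv ℝ f y v) x u =
      fderiv ℝ (fderiv ℝ f) x u v := by
    rw [((hd x).hasFDerivAt.clm_apply (hasFDerivAt_const v x)).fderiv]
    simp
  have h1 (u v : CSpace n) : fderiv ℝ (fderiv ℝ f) x u (I • v) = I * fderiv ℝ (fderiv ℝ f) x u v := by
    rw [← happ, ← happ]
    simp only [fun y => fderiv_real_apply_I (hf y) v]
    have h3 : DifferentiableAt ℝ (fun y => fderiv ℝ f y v) x :=
      ((hd x).hasFDerivAt.clm_apply (hasFDerivAt_const v x)).differentiableAt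
    rw [fderiv_const_mul h3]
    simp
  have h2 (u : CSpace n) : fderiv ℝ (fderiv ℝ fun y => (f y).re) x u u =
      (fderiv ℝ (fderiv ℝ f) x u u).re := by
    have hre : fderiv ℝ (fun y => (f y).re) = fun y => Complex.reCLM.comp (fderiv ℝ f y) := by
      ext y v
      exact fderiv_re (hfd y) v
    rw [hre, fderiv_clm_comp (differentiableAt_const _) (hd x)]
    simp
  rw [leviForm_eq, h2, h2, h1, fderiv_fderiv_symm hs (I • w) w, h1, ← mul_assoc, I_mul_I]
  simp

theorem leviForm_normSq {f : CSpace n → ℂ} (hf : Differentiable ℂ f) :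
    leviForm (fun y => ‖f y‖ ^ 2) x w = 4 * ‖fderiv ℝ f x w‖ ^ 2 := by
  have hs : ContDiff ℝ ∞ f := contDiff_of_differentiable hf
  have hre {g : CSpace n → ℂ} (hg : Differentiable ℂ g) :
      ContDiffAt ℝ 2 (fun y => (g y).re) x :=
    ((Complex.reCLM.contDiff.comp (contDiff_of_differentiable hg)).contDiffAt).of_le two_le_infty
  have hsq {g : CSpace n → ℂ} (hg : Differentiable ℂ g) :
      leviForm (fun y => (g y).re ^ 2) x w = 2 * ‖fderiv ℝ g x w‖ ^ 2 := by
    rw [leviForm_comp (hre hg) (g := fun t => t ^ 2) (g' := fun t => 2 * t) (g'' := 2)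
      (.of_forall fun t => by simpa using hasDerivAt_pow 2 t)
      (by simpa using (hasDerivAt_id ((g x).re)).const_mul 2), leviForm_re hg,
      fderiv_re ((hg x).restrictScalars ℝ), fderiv_re ((hg x).restrictScalars ℝ),
      fderiv_real_apply_I (hg x), ← Complex.normSq_eq_norm_sq, Complex.normSq_apply]
    simp
    ring
  have hIf : Differentiable ℂ fun y => I * f y := hf.const_mul I
  have h : (fun y => ‖f y‖ ^ 2) = fun y => (f y).re ^ 2 + (I * f y).re ^ 2 := by
    ext y
    rw [← Complex.normSq_eq_norm_sq, Complex.normSq_apply]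
    simp
    ring
  rw [h, leviForm_add ((hre hf).pow 2) ((hre hIf).pow 2), hsq hf, hsq hIf,
    fderiv_const_mul ((hf x).restrictScalars ℝ)]
  simp
  ring

theorem contDiff_normSq_of_differentiable {f : CSpace n → ℂ} (hf : Differentiable ℂ f) :
    ContDiff ℝ ∞ fun y => ‖f y‖ ^ 2 :=
  (contDiff_of_differentiable hf).norm_sq ℝ

theorem leviForm_log_add_normSq {f : CSpace n → ℂ} (hf : Differentiable ℂ f) {c : ℝ}
    (hc : 0 < c + ‖f x‖ ^ 2) :
    leviForm (fun y => Real.log (c + ‖f y‖ ^ 2)) x w =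
      4 * ‖fderiv ℝ f x w‖ ^ 2 * c / (c + ‖f x‖ ^ 2) ^ 2 := by
  have hq : ContDiffAt ℝ 2 (fun y => ‖f y‖ ^ 2) x :=
    (contDiff_normSq_of_differentiable hf).contDiffAt.of_le two_le_infty
  have hd (t : ℝ) (ht : 0 < c + t) : HasDerivAt (fun t => Real.log (c + t)) (c + t)⁻¹ t := by
    simpa using ((hasDerivAt_id t).const_add c).log ht.ne'
  rw [leviForm_comp hq (g := fun t => Real.log (c + t)) (g' := fun t => (c + t)⁻¹)
    (g'' := -1 / (c + ‖f x‖ ^ 2) ^ 2) ?_ ?_, leviForm_normSq hf, fderiv_normSq_sq_add hf]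
  · field_simp
    ring
  · have : ∀ᶠ t in 𝓝 (‖f x‖ ^ 2), 0 < c + t :=
      (continuous_const.add continuous_id).continuousAt.eventually (lt_mem_nhds hc)
    exact this.mono hd
  · have h := ((hasDerivAt_id (‖f x‖ ^ 2)).const_add c).fun_inv hc.ne'
    simpa using h

theorem real_inner_eq_re (u v : CSpace n) : ⟪u, v⟫_ℝ = (⟪u, v⟫_ℂ).re := by
  simp [PiLp.inner_apply, Complex.inner]

theorem fderiv_norm_sub_sq (a v : CSpace n) :
    fderiv ℝ (fun y : CSpace n => ‖y - a‖ ^ 2) x v = 2 * ⟪x - a, v⟫_ℝ := by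
  have h : HasFDerivAt (fun y : CSpace n => y - a) (ContinuousLinearMap.id ℝ (CSpace n)) x :=
    (hasFDerivAt_id x).sub_const a
  rw [h.norm_sq.fderiv]
  change (2 : ℕ) • ⟪x - a, v⟫_ℝ = _
  simp only [nsmul_eq_mul, Nat.cast_ofNat]

theorem leviForm_norm_sub_sq (a : CSpace n) :
    leviForm (fun y : CSpace n => ‖y - a‖ ^ 2) x w = 4 * ‖w‖ ^ 2 := by
  have h : fderiv ℝ (fun y : CSpace n => ‖y - a‖ ^ 2) = fun y => (2 : ℝ) • innerSL ℝ (y - a) := by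
    ext y v
    rw [fderiv_norm_sub_sq]
    rfl
  have h2 : HasFDerivAt (fun y => (2 : ℝ) • innerSL ℝ (y - a)) ((2 : ℝ) • innerSL ℝ) x :=
    (((innerSL ℝ).hasFDerivAt.comp x ((hasFDerivAt_id x).sub_const a))).const_smul (2 : ℝ)
  rw [leviForm_eq, h, h2.fderiv]
  have hI (u : CSpace n) : innerSL ℝ u u = ‖u‖ ^ 2 := real_inner_self_eq_norm_sq u
  change 2 * innerSL ℝ w w + 2 * innerSL ℝ (I • w) (I • w) = 4 * ‖w‖ ^ 2
  rw [hI, hI, norm_smul, norm_I, one_mul]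
  ring

theorem leviForm_log_norm_sub_sq_nonneg (a : CSpace n) {c : ℝ} (hc : 0 < c) :
    0 ≤ leviForm (fun y : CSpace n => Real.log (c + ‖y - a‖ ^ 2)) x w := by
  have hq : ContDiffAt ℝ 2 (fun y : CSpace n => ‖y - a‖ ^ 2) x :=
    (((contDiff_id.sub contDiff_const).norm_sq ℝ).contDiffAt)
  have hd (t : ℝ) (ht : 0 < c + t) : HasDerivAt (fun t => Real.log (c + t)) (c + t)⁻¹ t := by
    simpa using ((hasDerivAt_id t).const_add c).log ht.ne'
  have h0 : 0 < c + ‖x - a‖ ^ 2 := by positivity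
  rw [leviForm_comp hq (g := fun t => Real.log (c + t)) (g' := fun t => (c + t)⁻¹)
    (g'' := -1 / (c + ‖x - a‖ ^ 2) ^ 2) ?_ ?_, leviForm_norm_sub_sq, fderiv_norm_sub_sq,
    fderiv_norm_sub_sq]
  · have h1 : ⟪x - a, w⟫_ℝ ^ 2 + ⟪x - a, I • w⟫_ℝ ^ 2 ≤ ‖x - a‖ ^ 2 * ‖w‖ ^ 2 := by
      rw [real_inner_eq_re, real_inner_eq_re, inner_smul_right, ← mul_pow]
      calc _ = ‖⟪x - a, w⟫_ℂ‖ ^ 2 := by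
            generalize ⟪x - a, w⟫_ℂ = z
            rw [← Complex.normSq_eq_norm_sq, Complex.normSq_apply]
            simp
            ring
        _ ≤ _ := by
            gcongr
            exact norm_inner_le_norm _ _
    have h4 : (c + ‖x - a‖ ^ 2)⁻¹ * (4 * ‖w‖ ^ 2) + -1 / (c + ‖x - a‖ ^ 2) ^ 2 *
        ((2 * ⟪x - a, w⟫_ℝ) ^ 2 + (2 * ⟪x - a, I • w⟫_ℝ) ^ 2) =
        4 * ((c + ‖x - a‖ ^ 2) * ‖w‖ ^ 2 - (⟪x - a, w⟫_ℝ ^ 2 + ⟪x - a, I • w⟫_ℝ ^ 2)) /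
          (c + ‖x - a‖ ^ 2) ^ 2 := by
      field_simp
      ring
    rw [h4]
    have : 0 ≤ c * ‖w‖ ^ 2 := by positivity
    apply div_nonneg _ (by positivity)
    nlinarith
  · have : ∀ᶠ t in 𝓝 (‖x - a‖ ^ 2), 0 < c + t :=
      (continuous_const.add continuous_id).continuousAt.eventually (lt_mem_nhds h0)
    exact this.mono hd
  · have h := ((hasDerivAt_id (‖x - a‖ ^ 2)).const_add c).fun_inv h0.ne'
    simpa using h

end LeviCalculus

section Forward

variable {n : ℕ} {K U : Set (CSpace n)}

theorem exists_entire_small_of_notMem (hK : IsCompact K) (hP : PrincipalConvex K) {a : CSpace n}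
    (ha : a ∉ K) : ∃ g : CSpace n → ℂ, Differentiable ℂ g ∧ g a = 0 ∧ ∀ z ∈ K, 2 ≤ ‖g z‖ := by
  obtain ⟨f, hf, hfa, hfK⟩ := hP a ha
  rcases K.eq_empty_or_nonempty with rfl | hne
  · exact ⟨f, hf, hfa, by simp⟩
  obtain ⟨z₀, hz₀, hmin⟩ := hK.exists_isMinOn hne hf.continuous.norm.continuousOn
  have h0 : 0 < ‖f z₀‖ := norm_pos_iff.2 (hfK z₀ hz₀)
  refine ⟨fun z => (2 / ‖f z₀‖ : ℝ) * f z, hf.const_mul _, by simp [hfa], fun z hz => ?_⟩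
  have h1 : ‖f z₀‖ ≤ ‖f z‖ := hmin hz
  rw [norm_mul, Complex.norm_of_nonneg (by positivity), div_mul_eq_mul_div, le_div_iff₀ h0]
  gcongr

theorem log_add_sub_log_eq {q : ℝ} (hq : 0 < q) :
    Real.log (1 + q) - Real.log (0 + q) = Real.log (1 + q⁻¹) := by
  rw [zero_add, ← Real.log_div (by positivity) hq.ne']
  congr 1
  field_simp
  ring

theorem forward_direction (hK : IsCompact K) (hP : PrincipalConvex K) (hU : IsOpen U)
    (hKU : K ⊆ U) :
    ∃ (Ω W : Set (CSpace n)) (ρ : CSpace n → ℝ),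
      IsOpen Ω ∧ IsOpen W ∧ closure Ω ⊆ W ∧ ContDiffOn ℝ ∞ ρ W ∧
      (∀ x ∈ W, ∀ w : CSpace n, w ≠ 0 → 0 < leviForm ρ x w) ∧
      K ⊆ Ω ∧ Ω ⊆ U ∧ IsCompact (closure Ω) ∧ Ω = {z | z ∈ W ∧ ρ z < 0} ∧
      ∃ ψ : CSpace n → ℝ, ContDiff ℝ ∞ ψ ∧
        (∀ x w : CSpace n, w ≠ 0 → 0 < leviForm ψ x w) ∧
        ∃ N : Set (CSpace n), IsOpen N ∧ closure Ω ⊆ N ∧ N ⊆ W ∧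
          ∀ x ∈ N, ∀ w : CSpace n, leviForm (fun z => ψ z - ρ z) x w = 0 := by
  obtain ⟨R, hR0, hR⟩ := hK.isBounded.exists_pos_norm_le
  set c : ℝ := 1 / (4 * R ^ 2) with hc
  have hc0 : 0 < c := by positivity
  have hcK : ∀ z ∈ K, c * ‖z‖ ^ 2 ≤ 1 / 4 := fun z hz => by
    have h1 : ‖z‖ ^ 2 ≤ R ^ 2 := by
      gcongr
      exact hR z hz
    calc c * ‖z‖ ^ 2 ≤ c * R ^ 2 := by gcongr
      _ = 1 / 4 := by rw [hc]; field_simp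
  have hball : ∀ z : CSpace n, c * ‖z‖ ^ 2 ≤ 1 / 2 → z ∈ Metric.closedBall (0 : CSpace n) (2 * R) :=
    fun z hz => by
      rw [mem_closedBall_zero_iff]
      rw [hc, div_mul_eq_mul_div, div_le_iff₀ (by positivity)] at hz
      nlinarith [norm_nonneg z]
  set C : Set (CSpace n) := Metric.closedBall 0 (2 * R) \ U with hC
  have hCc : IsCompact C := (isCompact_closedBall _ _).diff hU
  have hg (a : CSpace n) : ∃ g : CSpace n → ℂ, Differentiable ℂ g ∧
      (a ∈ C → g a = 0) ∧ ∀ z ∈ K, 2 ≤ ‖g z‖ := by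
    by_cases ha : a ∈ K
    · exact ⟨fun _ => 2, differentiable_const _, fun h => absurd (hKU ha) h.2, by simp⟩
    · obtain ⟨g, h1, h2, h3⟩ := exists_entire_small_of_notMem hK hP ha
      exact ⟨g, h1, fun _ => h2, h3⟩
  choose g hgd hga hgK using hg
  obtain ⟨t, htC, ht⟩ := hCc.elim_nhds_subcover (fun a => {z | ‖g a z‖ < 1}) fun a ha =>
    (isOpen_lt (hgd a).continuous.norm continuous_const).mem_nhds (by simp [hga a ha])
  obtain ⟨m, hm⟩ := exists_pow_lt_of_lt_one (x := 1 / (4 * (t.card + 1 : ℝ))) (by positivity)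
    (show (1 / 4 : ℝ) < 1 by norm_num)
  set G : CSpace n → CSpace n → ℂ := fun a z => g a z ^ m with hG
  have hGd (a : CSpace n) : Differentiable ℂ (G a) := (hgd a).pow m
  have hsm (a : CSpace n) : ContDiff ℝ ∞ fun z => ‖G a z‖ ^ 2 :=
    contDiff_normSq_of_differentiable (hGd a)
  set W : Set (CSpace n) := {z | ∀ a ∈ t, G a z ≠ 0} with hW
  have hWo : IsOpen W := by
    have : W = ⋂ a ∈ t, {z | G a z ≠ 0} := by
      ext z
      simp [hW]
    rw [this]
    exact isOpen_biInter_finset fun a _ => isOpen_ne_fun (hGd a).continuous continuous_const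
  have hpos {a z : CSpace n} (ha : a ∈ t) (hz : z ∈ W) : 0 < ‖G a z‖ ^ 2 := by
    have := norm_pos_iff.2 (hz a ha)
    positivity
  set L1 : CSpace n → ℝ := fun z => ∑ a ∈ t, Real.log (1 + ‖G a z‖ ^ 2) with hL1
  set L0 : CSpace n → ℝ := fun z => ∑ a ∈ t, Real.log (0 + ‖G a z‖ ^ 2) with hL0
  set Q : CSpace n → ℝ := fun z => c * ‖z - 0‖ ^ 2 with hQ
  set ρ : CSpace n → ℝ := fun z => (L1 z - L0 z) + (Q z + -(1 / 2)) with hρ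
  set ψ : CSpace n → ℝ := fun z => L1 z + Q z with hψ
  have sL1 : ContDiff ℝ ∞ L1 := ContDiff.sum fun a _ =>
    (contDiff_const.add (hsm a)).log fun z => by positivity
  have sL0 {z : CSpace n} (hz : z ∈ W) : ContDiffAt ℝ ∞ L0 z := ContDiffAt.sum fun a ha =>
    (contDiff_const.add (hsm a)).contDiffAt.log (by simpa using (hpos ha hz).ne')
  have sQ : ContDiff ℝ ∞ Q := contDiff_const.mul ((contDiff_id.sub contDiff_const).norm_sq ℝ)
  have sρ {z : CSpace n} (hz : z ∈ W) : ContDiffAt ℝ ∞ ρ z :=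
    (sL1.contDiffAt.sub (sL0 hz)).add (sQ.contDiffAt.add contDiffAt_const)
  have sψ : ContDiff ℝ ∞ ψ := sL1.add sQ
  have two {φ : CSpace n → ℝ} {z : CSpace n} (h : ContDiffAt ℝ ∞ φ z) : ContDiffAt ℝ 2 φ z :=
    h.of_le two_le_infty
  have lL1 (z w : CSpace n) : 0 ≤ leviForm L1 z w := by
    rw [hL1, leviForm_sum _ fun a _ => two ((contDiff_const.add (hsm a)).log fun z => by
      positivity).contDiffAt]
    refine Finset.sum_nonneg fun a _ => ?_
    rw [leviForm_log_add_normSq (hGd a) (by positivity)]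
    positivity
  have lL0 {z : CSpace n} (hz : z ∈ W) (w : CSpace n) : leviForm L0 z w = 0 := by
    rw [hL0, leviForm_sum _ fun a ha => two ((contDiff_const.add (hsm a)).contDiffAt.log
      (by simpa using (hpos ha hz).ne'))]
    refine Finset.sum_eq_zero fun a ha => ?_
    rw [leviForm_log_add_normSq (hGd a) (by simpa using hpos ha hz)]
    simp
  have lQ (z w : CSpace n) : leviForm Q z w = c * (4 * ‖w‖ ^ 2) := by
    have h : ContDiffAt ℝ 2 (fun y : CSpace n => ‖y - 0‖ ^ 2) z :=
      two ((contDiff_id.sub contDiff_const).norm_sq ℝ).contDiffAt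
    rw [hQ, leviForm_const_mul c h, leviForm_norm_sub_sq]
  have lρ {z : CSpace n} (hz : z ∈ W) (w : CSpace n) :
      leviForm ρ z w = leviForm L1 z w + leviForm Q z w := by
    rw [hρ, leviForm_add (two (sL1.contDiffAt.sub (sL0 hz)))
      (two (sQ.contDiffAt.add contDiffAt_const)), leviForm_sub (two sL1.contDiffAt) (two (sL0 hz)),
      leviForm_add (two sQ.contDiffAt) contDiffAt_const, leviForm_const, lL0 hz]
    ring
  have lψ (z w : CSpace n) : leviForm ψ z w = leviForm L1 z w + leviForm Q z w :=
    leviForm_add (two sL1.contDiffAt) (two sQ.contDiffAt)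
  have strict (z w : CSpace n) (hw : w ≠ 0) : 0 < leviForm L1 z w + leviForm Q z w := by
    rw [lQ]
    have := norm_pos_iff.2 hw
    have := lL1 z w
    positivity
  have hdiff {z : CSpace n} (hz : z ∈ W) :
      L1 z - L0 z = ∑ a ∈ t, Real.log (1 + (‖G a z‖ ^ 2)⁻¹) := by
    rw [← Finset.sum_sub_distrib]
    exact Finset.sum_congr rfl fun a ha => log_add_sub_log_eq (hpos ha hz)
  have hterm (a z : CSpace n) : 0 ≤ Real.log (1 + (‖G a z‖ ^ 2)⁻¹) :=
    Real.log_nonneg (le_add_of_nonneg_right (by positivity))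
  set Ω : Set (CSpace n) := {z | z ∈ W ∧ ρ z < 0} with hΩ
  have hQ0 (z : CSpace n) : 0 ≤ Q z := by positivity
  have hΩB : ∀ z ∈ Ω, z ∈ Metric.closedBall (0 : CSpace n) (2 * R) := fun z hz => by
    apply hball
    have h1 : 0 ≤ L1 z - L0 z := by
      rw [hdiff hz.1]
      exact Finset.sum_nonneg fun a _ => hterm a z
    have h2 : L1 z - L0 z + (Q z + -(1 / 2)) < 0 := hz.2
    have h3 : Q z = c * ‖z‖ ^ 2 := by simp [hQ]
    linarith
  have hΩ1 : ∀ z ∈ Ω, ∀ a ∈ t, 1 < ‖G a z‖ ^ 2 := fun z hz a ha => by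
    by_contra! h
    have h2 : L1 z - L0 z + (Q z + -(1 / 2)) < 0 := hz.2
    rw [hdiff hz.1] at h2
    have h3 := Finset.single_le_sum (fun b _ => hterm b z) ha
    have h4 : Real.log 2 ≤ Real.log (1 + (‖G a z‖ ^ 2)⁻¹) := by
      apply Real.log_le_log (by norm_num)
      have := (one_le_inv₀ (hpos ha hz.1)).2 h
      linarith
    have h5 := Real.log_two_gt_d9
    have h6 := hQ0 z
    linarith
  have hcl : closure Ω ⊆ W := by
    have h1 : IsClosed {z : CSpace n | ∀ a ∈ t, 1 ≤ ‖G a z‖ ^ 2} := by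
      have : {z : CSpace n | ∀ a ∈ t, 1 ≤ ‖G a z‖ ^ 2} = ⋂ a ∈ t, {z | 1 ≤ ‖G a z‖ ^ 2} := by
        ext z
        simp
      rw [this]
      exact isClosed_biInter fun a _ => isClosed_le continuous_const (hsm a).continuous
    refine (closure_minimal (fun z hz a ha => (hΩ1 z hz a ha).le) h1).trans fun z hz a ha h0 => ?_
    have := hz a ha
    rw [h0] at this
    norm_num at this
  refine ⟨Ω, W, ρ, ?_, hWo, hcl, fun z hz => (sρ hz).contDiffWithinAt, fun z hz w hw => ?_, ?_, ?_,
    (isCompact_closedBall _ _).closure_of_subset hΩB, rfl, ψ, sψ, fun z w hw => ?_, W, hWo, hcl,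
    Subset.rfl, fun z hz w => ?_⟩
  · have h1 : ContinuousOn ρ W := fun z hz => (sρ hz).continuousAt.continuousWithinAt
    exact h1.isOpen_inter_preimage hWo isOpen_Iio
  · rw [lρ hz]
    exact strict z w hw
  · intro z hz
    have h1 (a : CSpace n) : (4 : ℝ) ^ m ≤ ‖G a z‖ ^ 2 := by
      rw [hG, norm_pow, ← pow_mul, mul_comm, pow_mul]
      gcongr
      nlinarith [hgK a z hz]
    have h2 : z ∈ W := fun a _ h0 => by
      have := h1 a
      rw [h0] at this
      have h4 : (0 : ℝ) < 4 ^ m := by positivity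
      norm_num at this
      linarith
    refine ⟨h2, ?_⟩
    have h3 : L1 z - L0 z < 1 / 4 := by
      rw [hdiff h2]
      calc ∑ a ∈ t, Real.log (1 + (‖G a z‖ ^ 2)⁻¹) ≤ ∑ a ∈ t, (1 / 4 : ℝ) ^ m := by
            refine Finset.sum_le_sum fun a ha => ?_
            have h5 : 0 < ‖G a z‖ ^ 2 := hpos ha h2
            calc Real.log (1 + (‖G a z‖ ^ 2)⁻¹) ≤ (1 + (‖G a z‖ ^ 2)⁻¹) - 1 :=
                  Real.log_le_sub_one_of_pos (by positivity)
              _ = (‖G a z‖ ^ 2)⁻¹ := by ring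
              _ ≤ (4 ^ m)⁻¹ := by
                gcongr
                exact h1 a
              _ = (1 / 4 : ℝ) ^ m := by rw [one_div, inv_pow]
        _ = t.card * (1 / 4 : ℝ) ^ m := by simp
        _ ≤ (t.card + 1) * (1 / 4 : ℝ) ^ m := by gcongr; linarith
        _ < (t.card + 1) * (1 / (4 * (t.card + 1 : ℝ))) := by gcongr
        _ = 1 / 4 := by field_simp
    have h6 : Q z = c * ‖z‖ ^ 2 := by simp [hQ]
    have h7 := hcK z hz
    change L1 z - L0 z + (Q z + -(1 / 2)) < 0
    linarith
  · intro z hz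
    by_contra hzU
    have h1 := ht (show z ∈ C from ⟨hΩB z hz, hzU⟩)
    simp only [mem_iUnion, mem_ofPred_eq, exists_prop] at h1
    obtain ⟨a, ha, h2⟩ := h1
    have h3 := hΩ1 z hz a ha
    have h4 : ‖G a z‖ ≤ 1 := by
      rw [hG, norm_pow]
      exact pow_le_one₀ (norm_nonneg _) h2.le
    nlinarith [norm_nonneg (G a z)]
  · rw [lψ]
    exact strict z w hw
  · rw [leviForm_sub (two sψ.contDiffAt) (two (sρ hz)), lψ, lρ hz, sub_self]

end Forward

section Pluriharmonic

variable {n : ℕ} {h : CSpace n → ℝ} {B : Set (CSpace n)}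

theorem fderiv_fderiv_I_of_leviForm_eq_zero {x : CSpace n} (hh : ContDiffAt ℝ 2 h x)
    (h0 : ∀ w, leviForm h x w = 0) (u v : CSpace n) :
    fderiv ℝ (fderiv ℝ h) x u (I • v) = fderiv ℝ (fderiv ℝ h) x v (I • u) := by
  have hsymm (u v : CSpace n) :
      fderiv ℝ (fderiv ℝ h) x u v = fderiv ℝ (fderiv ℝ h) x v u :=
    (hh.isSymmSndFDerivAt (by simp)) u v
  have hpol (u v : CSpace n) :
      fderiv ℝ (fderiv ℝ h) x u v + fderiv ℝ (fderiv ℝ h) x (I • u) (I • v) = 0 := by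
    have h1 := h0 (u + v)
    have h2 := h0 u
    have h3 := h0 v
    rw [leviForm_eq] at h1 h2 h3
    simp only [smul_add, map_add, add_apply] at h1
    rw [hsymm v u, hsymm (I • v) (I • u)] at h1
    linarith
  have h1 := hpol u (I • v)
  rw [smul_smul, I_mul_I, neg_one_smul, map_neg, hsymm (I • u) v] at h1
  linarith

theorem exists_differentiableOn_re_eq (hB : Convex ℝ B) (hBo : IsOpen B)
    (hs : ∀ x ∈ B, ContDiffAt ℝ ∞ h x) (h0 : ∀ x ∈ B, ∀ w, leviForm h x w = 0) :
    ∃ G : CSpace n → ℂ, ContDiffOn ℝ ∞ G B ∧ DifferentiableOn ℂ G B ∧ ∀ x ∈ B, (G x).re = h x := by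
  rcases B.eq_empty_or_nonempty with rfl | ⟨p, hp⟩
  · exact ⟨0, contDiffOn_empty, by simp [DifferentiableOn], by simp⟩
  have hh (x) (hx : x ∈ B) : ContDiffAt ℝ 2 h x := (hs x hx).of_le two_le_infty
  let J : CSpace n →L[ℝ] CSpace n := (I • ContinuousLinearMap.id ℂ (CSpace n)).restrictScalars ℝ
  let Λ : (CSpace n →L[ℝ] ℝ) →L[ℝ] (CSpace n →L[ℝ] ℂ) :=
    ContinuousLinearMap.compL ℝ (CSpace n) ℝ ℂ ofRealCLM -
      (ContinuousLinearMap.compL ℝ (CSpace n) ℝ ℂ (I • ofRealCLM)) ∘L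
        ((ContinuousLinearMap.compL ℝ (CSpace n) (CSpace n) ℝ).flip J)
  have hΛ (l : CSpace n →L[ℝ] ℝ) (v : CSpace n) : Λ l v = l v - I * l (I • v) := rfl
  have hd (x) (hx : x ∈ B) : HasFDerivAt (fun y => Λ (fderiv ℝ h y))
      (Λ ∘L fderiv ℝ (fderiv ℝ h) x) x :=
    Λ.hasFDerivAt.comp x (hh x hx).differentiableAt_fderiv.hasFDerivAt
  obtain ⟨G, hG⟩ := hB.exists_forall_hasFDerivAt_of_fderiv_symmetric hBo
    (show DifferentiableOn ℝ (fun y => Λ (fderiv ℝ h y)) B from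
      fun x hx => (hd x hx).differentiableAt.differentiableWithinAt)
    fun x hx u v => by
      rw [(hd x hx).fderiv]
      exact congrArg₂ (fun p q : ℝ => (p : ℂ) - I * q)
        ((hh x hx).isSymmSndFDerivAt (by simp) u v)
        (fderiv_fderiv_I_of_leviForm_eq_zero (hh x hx) (h0 x hx) u v)
  have hre : ∃ c : ℝ, ∀ x ∈ B, (G x).re - h x = c := by
    have hz (x) (hx : x ∈ B) : HasFDerivAt (fun y => (G y).re - h y)
        (0 : CSpace n →L[ℝ] ℝ) x := by
      have := (Complex.reCLM.hasFDerivAt.comp x (hG x hx)).sub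
        ((hh x hx).differentiableAt (by simp)).hasFDerivAt
      have h0 : Complex.reCLM ∘L Λ (fderiv ℝ h x) - fderiv ℝ h x = 0 := by
        ext v
        simp [hΛ]
      rwa [h0] at this
    refine ⟨(G p).re - h p, fun x hx => ?_⟩
    exact hB.is_const_of_fderivWithin_eq_zero
      (fun y hy => (hz y hy).differentiableAt.differentiableWithinAt)
      (fun y hy => by rw [fderivWithin_of_isOpen hBo hy, (hz y hy).fderiv]) hx hp
  obtain ⟨c, hc⟩ := hre
  refine ⟨fun x => G x - c, .sub ?_ contDiffOn_const, fun x hx => ?_, fun x hx => ?_⟩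
  · rw [contDiffOn_infty_iff_fderiv_of_isOpen hBo]
    refine ⟨fun x hx => (hG x hx).differentiableAt.differentiableWithinAt, ?_⟩
    have hΛs : ContDiffOn ℝ ∞ (fun y => Λ (fderiv ℝ h y)) B := fun x hx =>
      (Λ.contDiff.contDiffAt.comp x ((hs x hx).fderiv_right (by simp))).contDiffWithinAt
    exact hΛs.congr fun x hx => (hG x hx).fderiv
  · refine DifferentiableAt.differentiableWithinAt (.sub_const ?_ _)
    rw [differentiableAt_iff_restrictScalars ℝ (hG x hx).differentiableAt, (hG x hx).fderiv]
    let T : CSpace n →ₗ[ℂ] ℂ :=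
      { toFun := Λ (fderiv ℝ h x)
        map_add' := map_add _
        map_smul' := fun z v => by
          have hI (v : CSpace n) : Λ (fderiv ℝ h x) (I • v) = I * Λ (fderiv ℝ h x) v := by
            rw [hΛ, hΛ, smul_smul, I_mul_I, neg_one_smul, map_neg, mul_sub, ← mul_assoc, I_mul_I]
            push_cast
            ring
          have hz : z • v = z.re • v + z.im • (I • v) := by
            conv_lhs => rw [← re_add_im z, add_smul, mul_smul]
            rfl
          rw [hz, map_add, map_smul, map_smul, hI]
          simp only [RingHom.id_apply, smul_eq_mul, real_smul]
          linear_combination (Λ (fderiv ℝ h x) v) * re_add_im z }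
    exact ⟨LinearMap.toContinuousLinearMap T, by ext v; rfl⟩
  · have := hc x hx
    simp
    linarith

theorem exists_eqOn_I_mul_of_re_eq {G H : CSpace n → ℂ} (hB : Convex ℝ B) (hBo : IsOpen B)
    (hG : DifferentiableOn ℂ G B) (hH : DifferentiableOn ℂ H B)
    (hre : ∀ x ∈ B, (G x).re = (H x).re) : ∃ c : ℝ, ∀ x ∈ B, G x = H x + c * I := by
  rcases B.eq_empty_or_nonempty with rfl | ⟨p, hp⟩
  · exact ⟨0, by simp⟩
  have hd : DifferentiableOn ℂ (fun y => G y - H y) B := hG.sub hH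
  have hconst (x) (hx : x ∈ B) : G x - H x = G p - H p := by
    refine (hB.is_const_of_fderivWithin_eq_zero (𝕜 := ℂ) hd (fun y hy => ?_) hx hp)
    have hdy := hd.differentiableAt (hBo.mem_nhds hy)
    have hR := hdy.restrictScalars ℝ
    rw [fderivWithin_of_isOpen hBo hy]
    have hz (v : CSpace n) : (fderiv ℝ (fun y => G y - H y) y v).re = 0 := by
      rw [← fderiv_re hR]
      have : (fun y => (G y - H y).re) =ᶠ[𝓝 y] fun _ => 0 := by
        filter_upwards [hBo.mem_nhds hy] with z hz
        simp [hre z hz]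
      rw [this.fderiv_eq]
      simp
    ext v
    have h1 := hz v
    have h2 := hz (I • v)
    rw [fderiv_real_apply_I hdy] at h2
    have h3 : fderiv ℝ (fun y => G y - H y) y v = fderiv ℂ (fun y => G y - H y) y v := by
      rw [hdy.fderiv_restrictScalars ℝ]
      rfl
    rw [← h3]
    apply Complex.ext
    · simpa using h1
    · simpa using h2
  refine ⟨(G p - H p).im, fun x hx => ?_⟩
  have h1 := hconst x hx
  have h2 : G p - H p = ((G p - H p).im : ℂ) * I := by
    conv_lhs => rw [← re_add_im (G p - H p)]
    simp [hre p hp]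
  rw [← h2, ← h1]
  ring

end Pluriharmonic

theorem exists_nat_norm_exp_sub_one_lt {ι : Type*} [Fintype ι] (c : ι → ℝ) {ε : ℝ} (hε : 0 < ε)
    (N₀ : ℕ) : ∃ N : ℕ, N₀ ≤ N ∧ ∀ i, ‖cexp (N * (c i * I)) - 1‖ < ε := by
  let u : ℕ → ι → ℂ := fun m i => cexp (m * (c i * I))
  have hn (m : ℕ) (i : ι) : ‖u m i‖ = 1 := by
    have : (m : ℂ) * (c i * I) = ((m * c i : ℝ) : ℂ) * I := by
      push_cast
      ring
    simp only [u, this, norm_exp_ofReal_mul_I]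
  have hu (m : ℕ) : u m ∈ Metric.closedBall (0 : ι → ℂ) 1 := by
    rw [mem_closedBall_zero_iff, pi_norm_le_iff_of_nonneg zero_le_one]
    exact fun i => (hn m i).le
  obtain ⟨l, -, φ, hφ, hl⟩ := (isCompact_closedBall (0 : ι → ℂ) 1).tendsto_subseq hu
  obtain ⟨M, hM⟩ := Metric.cauchySeq_iff.1 hl.cauchySeq ε hε
  refine ⟨φ (M + N₀ + φ M) - φ M, ?_, fun i => ?_⟩
  · have := hφ.id_le (M + N₀ + φ M)
    simp only [id] at this
    omega
  · have hle : φ M ≤ φ (M + N₀ + φ M) := hφ.monotone (by omega)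
    have h1 := hM (M + N₀ + φ M) (by omega) M le_rfl
    have h2 : ‖u (φ (M + N₀ + φ M)) i - u (φ M) i‖ < ε :=
      (norm_le_pi_norm (u (φ (M + N₀ + φ M)) - u (φ M)) i).trans_lt (by rwa [← dist_eq_norm])
    have h3 : u (φ (M + N₀ + φ M)) i - u (φ M) i =
        u (φ M) i * (cexp ((φ (M + N₀ + φ M) - φ M : ℕ) * (c i * I)) - 1) := by
      simp only [u]
      rw [mul_sub, ← Complex.exp_add, Nat.cast_sub hle]
      ring_nf
    rwa [h3, norm_mul, hn, one_mul] at h2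

theorem exists_isTest_sum_eq_one {n : ℕ} {ι : Type*} [Fintype ι] {T : Set (CSpace n)}
    (hT : IsClosed T) {V : ι → Set (CSpace n)} (hV : ∀ i, IsOpen (V i))
    (hb : ∀ i, Bornology.IsBounded (V i)) (hTV : T ⊆ ⋃ i, V i) :
    ∃ χ : ι → CSpace n → ℝ, (∀ i, ContDiff ℝ ∞ (χ i)) ∧ (∀ i, HasCompactSupport (χ i)) ∧
      (∀ i, tsupport (χ i) ⊆ V i) ∧ (∀ i x, 0 ≤ χ i x) ∧ ∀ x ∈ T, ∑ i, χ i x = 1 := by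
  obtain ⟨f, hf⟩ := SmoothPartitionOfUnity.exists_isSubordinate
    (modelWithCornersSelf ℝ (CSpace n)) hT V hV hTV
  refine ⟨fun i => f i, fun i => (f i).contMDiff.contDiff, fun i => ?_, hf, fun i => f.nonneg i,
    fun x hx => ?_⟩
  · exact Metric.isCompact_of_isClosed_isBounded (isClosed_tsupport _) ((hb i).subset (hf i))
  · rw [← finsum_eq_sum_of_fintype]
    exact f.sum_eq_one hx

section WeightedEstimate

variable {n : ℕ}

theorem finrank_real_cSpace (n : ℕ) : Module.finrank ℝ (CSpace n) = 2 * n := by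
  rw [finrank_real_of_complex, finrank_euclideanSpace, Fintype.card_fin]

theorem norm_sq_le_of_differentiable {F : CSpace n → ℂ} (hF : Differentiable ℂ F) (x : CSpace n)
    {r : ℝ} (hr : 0 < r) :
    ‖F x‖ ^ 2 ≤ meanConst n 1 * ((r ^ (2 * n))⁻¹ * ∫ y in Metric.ball x r, ‖F y‖ ^ 2) := by
  have hG : Differentiable ℂ fun z => F (x + r • z) :=
    hF.comp ((differentiable_id.const_smul r).const_add x)
  have h1 := norm_sq_le_of_differentiableOn (x := 0) one_pos hG.differentiableOn
    ((hG.continuous.norm.pow 2).locallyIntegrable.integrableOn_isCompact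
      (isCompact_closedBall 0 1) |>.mono_set Metric.ball_subset_closedBall)
  have h2 := Measure.setIntegral_comp_smul_of_pos volume (fun y => ‖F (x + y)‖ ^ 2)
    (Metric.ball (0 : CSpace n) 1) hr
  have h3 : ∫ y in Metric.ball (0 : CSpace n) r, ‖F (x + y)‖ ^ 2 =
      ∫ y in Metric.ball x r, ‖F y‖ ^ 2 := by
    rw [← integral_indicator measurableSet_ball, ← integral_indicator measurableSet_ball,
      ← integral_add_left_eq_self ((Metric.ball x r).indicator fun y => ‖F y‖ ^ 2) x]
    congr 1
    ext y
    simp [indicator, Metric.mem_ball, dist_eq_norm]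
  rw [h2, smul_unitBall_of_pos hr, h3, finrank_real_cSpace] at h1
  simpa using h1

/-- A continuous positive function on ℂⁿ which bounds from below all the weights used to force
smallness at the point `a`. -/
noncomputable def tameWeight (a x : CSpace n) : ℝ :=
  Real.exp (-‖x - 0‖ ^ 2) * ((1 + ‖x - a‖ ^ 2) ^ (n + 1))⁻¹

theorem tameWeight_pos (a x : CSpace n) : 0 < tameWeight a x := by
  unfold tameWeight
  positivity

theorem continuous_tameWeight (a : CSpace n) : Continuous (tameWeight a) := by
  unfold tameWeight
  refine .mul (by fun_prop) (.inv₀ (by fun_prop) fun x => by positivity)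

noncomputable def poleWeight (Ψ : CSpace n → ℝ) (a : CSpace n) (τ : ℝ) (x : CSpace n) : ℝ :=
  Ψ x + (‖x - 0‖ ^ 2 + (n + 1 : ℝ) * Real.log (τ ^ 2 + ‖x - a‖ ^ 2))

variable {Ψ : CSpace n → ℝ} {a : CSpace n} {τ : ℝ}

theorem exp_neg_poleWeight (hτ : 0 < τ) (x : CSpace n) :
    Real.exp (-poleWeight Ψ a τ x) =
      Real.exp (-Ψ x) * (Real.exp (-‖x - 0‖ ^ 2) * ((τ ^ 2 + ‖x - a‖ ^ 2) ^ (n + 1))⁻¹) := by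
  have h : 0 < τ ^ 2 + ‖x - a‖ ^ 2 := by positivity
  have h1 : ((τ ^ 2 + ‖x - a‖ ^ 2) ^ (n + 1))⁻¹ =
      Real.exp (-((n + 1 : ℝ) * Real.log (τ ^ 2 + ‖x - a‖ ^ 2))) := by
    rw [Real.exp_neg, ← Nat.cast_add_one, Real.exp_nat_mul, Real.exp_log h]
  rw [h1, poleWeight, ← Real.exp_add, ← Real.exp_add]
  ring_nf

theorem contDiff_poleWeight (hΨ : ContDiff ℝ ∞ Ψ) (hτ : 0 < τ) :
    ContDiff ℝ ∞ (poleWeight Ψ a τ) :=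
  hΨ.add (((contDiff_id.sub contDiff_const).norm_sq ℝ).add (contDiff_const.mul
    ((contDiff_const.add ((contDiff_id.sub contDiff_const).norm_sq ℝ)).log
      fun x => by positivity)))

theorem le_leviForm_poleWeight (hΨ : ContDiff ℝ ∞ Ψ) (h0 : ∀ x w, 0 ≤ leviForm Ψ x w)
    (hτ : 0 < τ) (x w : CSpace n) : 4 * ‖w‖ ^ 2 ≤ leviForm (poleWeight Ψ a τ) x w := by
  have s1 (b : CSpace n) : ContDiff ℝ 2 fun y : CSpace n => ‖y - b‖ ^ 2 :=
    (contDiff_id.sub contDiff_const).norm_sq ℝ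
  have s2 : ContDiff ℝ 2 fun y : CSpace n => Real.log (τ ^ 2 + ‖y - a‖ ^ 2) :=
    (contDiff_const.add (s1 a)).log fun y => by positivity
  have h2 : 0 ≤ leviForm (fun y : CSpace n => Real.log (τ ^ 2 + ‖y - a‖ ^ 2)) x w :=
    leviForm_log_norm_sub_sq_nonneg a (by positivity)
  unfold poleWeight
  rw [leviForm_add (hΨ.contDiffAt.of_le two_le_infty)
    ((s1 0).add (contDiff_const.mul s2)).contDiffAt,
    leviForm_add (s1 0).contDiffAt (contDiff_const.mul s2).contDiffAt,
    leviForm_const_mul _ s2.contDiffAt, leviForm_norm_sub_sq]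
  have := h0 x w
  have : 0 ≤ (n + 1 : ℝ) * leviForm (fun y : CSpace n => Real.log (τ ^ 2 + ‖y - a‖ ^ 2)) x w := by
    positivity
  linarith

theorem integral_wirt_mul_exp_neg_poleWeight_le {L : Set (CSpace n)} (hL : IsCompact L) {d : ℝ}
    (hd : 0 < d) (hdL : ∀ x ∈ L, d ≤ ‖x - a‖) {s : CSpace n → ℂ} (hsL : tsupport s ⊆ L) {b : ℝ}
    (hb : 0 ≤ b) {w : CSpace n} (hsb : ∀ x, ‖wirt I w s x‖ ^ 2 ≤ b * Real.exp (Ψ x))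
    (hτ : 0 < τ) :
    ∫ x, ‖wirt I w s x‖ ^ 2 * Real.exp (-poleWeight Ψ a τ x) ≤
      volume.real L * (b * ((d ^ 2) ^ (n + 1))⁻¹) := by
  rw [← smul_eq_mul, ← setIntegral_const, ← integral_indicator hL.measurableSet]
  refine integral_mono_of_nonneg (.of_forall fun x => by positivity)
    ((integrable_indicator_iff hL.measurableSet).2
      (integrableOn_const hL.measure_lt_top.ne)) (.of_forall fun x => ?_)
  by_cases hx : x ∈ L
  · simp only [indicator_of_mem hx]
    rw [exp_neg_poleWeight hτ]
    have h1 : ((τ ^ 2 + ‖x - a‖ ^ 2) ^ (n + 1))⁻¹ ≤ ((d ^ 2) ^ (n + 1))⁻¹ := by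
      have := hdL x hx
      gcongr
      nlinarith [sq_nonneg τ]
    have h2 : Real.exp (-‖x - 0‖ ^ 2) ≤ 1 := Real.exp_le_one_iff.2 (by simp)
    calc _ ≤ b * Real.exp (Ψ x) * (Real.exp (-Ψ x) * (1 * ((d ^ 2) ^ (n + 1))⁻¹)) := by
          gcongr
          exact hsb x
      _ = b * (Real.exp (Ψ x) * Real.exp (-Ψ x)) * ((d ^ 2) ^ (n + 1))⁻¹ := by ring
      _ = b * ((d ^ 2) ^ (n + 1))⁻¹ := by rw [← Real.exp_add]; simp
  · have : wirt I w s x = 0 := by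
      have h : s =ᶠ[𝓝 x] fun _ => 0 :=
        notMem_tsupport_iff_eventuallyEq.1 fun h => hx (hsL h)
      rw [wirt_congr h, wirt_const]
    simp [indicator_of_notMem hx, this]

theorem setIntegral_ball_le_of_poleWeight {f : CSpace n → ℂ} (hf : Continuous f) {m B : ℝ}
    (hm : 0 < m) (hτ : 0 < τ)
    (hmτ : ∀ y ∈ Metric.ball a τ, m ≤ Real.exp (-Ψ y) * Real.exp (-‖y - 0‖ ^ 2))
    (hi : Integrable fun x => ‖f x‖ ^ 2 * Real.exp (-poleWeight Ψ a τ x))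
    (hB : ∫ x, ‖f x‖ ^ 2 * Real.exp (-poleWeight Ψ a τ x) ≤ B) :
    ∫ y in Metric.ball a τ, ‖f y‖ ^ 2 ≤ (2 * τ ^ 2) ^ (n + 1) * m⁻¹ * B := by
  calc _ ≤ ∫ y in Metric.ball a τ, (2 * τ ^ 2) ^ (n + 1) * m⁻¹ *
        (‖f y‖ ^ 2 * Real.exp (-poleWeight Ψ a τ y)) := by
        refine setIntegral_mono_on ((hf.norm.pow 2).locallyIntegrable.integrableOn_isCompact
          (isCompact_closedBall a τ) |>.mono_set Metric.ball_subset_closedBall)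
          (hi.integrableOn.const_mul _) measurableSet_ball fun y hy => ?_
        have h1 := hmτ y hy
        rw [mem_ball_iff_norm] at hy
        have h2 : ((2 * τ ^ 2) ^ (n + 1))⁻¹ ≤ ((τ ^ 2 + ‖y - a‖ ^ 2) ^ (n + 1))⁻¹ := by
          gcongr
          nlinarith [norm_nonneg (y - a)]
        rw [exp_neg_poleWeight hτ]
        calc ‖f y‖ ^ 2 = (2 * τ ^ 2) ^ (n + 1) * m⁻¹ *
              (‖f y‖ ^ 2 * (m * ((2 * τ ^ 2) ^ (n + 1))⁻¹)) := by field_simp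
          _ ≤ _ := by
              rw [← mul_assoc (Real.exp (-Ψ y))]
              gcongr
    _ = (2 * τ ^ 2) ^ (n + 1) * m⁻¹ *
        ∫ y in Metric.ball a τ, ‖f y‖ ^ 2 * Real.exp (-poleWeight Ψ a τ y) :=
      integral_const_mul _ _
    _ ≤ _ := by
      gcongr
      exact (setIntegral_le_integral hi (.of_forall fun x => by positivity)).trans hB

theorem norm_sq_le_of_setIntegral_ball_le {F : CSpace n → ℂ} (hF : Differentiable ℂ F) {M : ℝ}
    (hτ : 0 < τ) (hM : ∫ y in Metric.ball a τ, ‖F y‖ ^ 2 ≤ (2 * τ ^ 2) ^ (n + 1) * M) :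
    ‖F a‖ ^ 2 ≤ meanConst n 1 * (2 ^ (n + 1) * M) * τ ^ 2 := by
  have hmc : 0 ≤ meanConst n 1 := integral_nonneg fun t => sq_nonneg _
  calc ‖F a‖ ^ 2 ≤ meanConst n 1 * ((τ ^ (2 * n))⁻¹ * ∫ y in Metric.ball a τ, ‖F y‖ ^ 2) :=
        norm_sq_le_of_differentiable hF a hτ
    _ ≤ meanConst n 1 * ((τ ^ (2 * n))⁻¹ * ((2 * τ ^ 2) ^ (n + 1) * M)) := by
        gcongr
    _ = meanConst n 1 * (2 ^ (n + 1) * M) * τ ^ 2 := by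
        have h1 : (2 * τ ^ 2) ^ (n + 1) = 2 ^ (n + 1) * (τ ^ (2 * n) * τ ^ 2) := by
          rw [mul_pow, ← pow_mul]
          ring
        have h2 : (τ ^ (2 * n))⁻¹ * τ ^ (2 * n) = 1 := inv_mul_cancel₀ (by positivity)
        rw [h1]
        linear_combination (meanConst n 1 * (2 ^ (n + 1) * M) * τ ^ 2) * h2

theorem exists_differentiable_small_at {L : Set (CSpace n)} (hL : IsCompact L) (ha : a ∉ L) :
    ∃ C : ℝ, 0 < C ∧ ∀ Ψ : CSpace n → ℝ, ContDiff ℝ ∞ Ψ → (∀ x w, 0 ≤ leviForm Ψ x w) →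
      ∀ s : CSpace n → ℂ, IsTest s → tsupport s ⊆ L → ∀ b : ℝ, 0 ≤ b →
      (∀ k x, ‖wirt I (cbasis k) s x‖ ^ 2 ≤ b * Real.exp (Ψ x)) → ∀ ε : ℝ, 0 < ε →
      ∃ F : CSpace n → ℂ, Differentiable ℂ F ∧ ‖F a‖ ^ 2 ≤ ε ∧
        Integrable (fun x => ‖s x - F x‖ ^ 2 * (Real.exp (-Ψ x) * tameWeight a x)) ∧
        ∫ x, ‖s x - F x‖ ^ 2 * (Real.exp (-Ψ x) * tameWeight a x) ≤ C * b := by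
  obtain ⟨d₀, hd₀, hd₀L⟩ := Metric.isOpen_iff.1 hL.isClosed.isOpen_compl a ha
  set d := min d₀ 1 with hd
  have hd0 : 0 < d := lt_min hd₀ one_pos
  have hdL (x) (hx : x ∈ L) : d ≤ ‖x - a‖ := by
    by_contra! h
    exact hd₀L (by rw [Metric.mem_ball, dist_eq_norm]; exact h.trans_le (min_le_left _ _)) hx
  refine ⟨n * (volume.real L * ((d ^ 2) ^ (n + 1))⁻¹) + 1, by positivity,
    fun Ψ hΨ h0 s hs hsL b hb hsb ε hε => ?_⟩
  set C := n * (volume.real L * ((d ^ 2) ^ (n + 1))⁻¹) + 1 with hC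
  have hC0 : 0 < C := by positivity
  obtain ⟨p, -, hp⟩ := (isCompact_closedBall a 1).exists_isMinOn
    (Metric.nonempty_closedBall.2 zero_le_one)
    (f := fun x => Real.exp (-Ψ x) * Real.exp (-‖x - 0‖ ^ 2))
    (have := hΨ.continuous; by fun_prop)
  set m := Real.exp (-Ψ p) * Real.exp (-‖p - 0‖ ^ 2) with hm
  have hm0 : 0 < m := by positivity
  have hmc : 0 ≤ meanConst n 1 := integral_nonneg fun t => sq_nonneg _
  set D := meanConst n 1 * (2 ^ (n + 1) * (m⁻¹ * (C * b))) with hD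
  have hD0 : 0 ≤ D := by positivity
  set τ := min d (ε / (D + 1)) with hτ
  have hτ0 : 0 < τ := lt_min hd0 (by positivity)
  have hτd : τ ≤ d := min_le_left _ _
  have hτ1 : τ ≤ 1 := hτd.trans (min_le_right _ _)
  have hDτ : D * τ ^ 2 ≤ ε := by
    have h1 : τ * (D + 1) ≤ ε := (le_div_iff₀ (by positivity)).1 (min_le_right _ _)
    have h2 : D * τ ^ 2 ≤ D * τ := by
      gcongr
      nlinarith
    nlinarith
  obtain ⟨F, hF, hFi, hFb⟩ := exists_differentiable_near (contDiff_poleWeight (a := a) hΨ hτ0)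
    one_pos (fun x w => by simpa using le_leviForm_poleWeight hΨ h0 hτ0 x w) hs
  have hbound : ∫ x, ‖s x - F x‖ ^ 2 * Real.exp (-poleWeight Ψ a τ x) ≤ C * b := by
    rw [one_mul] at hFb
    calc _ ≤ ∑ _k : Fin n, volume.real L * (b * ((d ^ 2) ^ (n + 1))⁻¹) :=
          hFb.trans (Finset.sum_le_sum fun k _ =>
            integral_wirt_mul_exp_neg_poleWeight_le hL hd0 hdL hsL hb (hsb k) hτ0)
      _ = n * (volume.real L * ((d ^ 2) ^ (n + 1))⁻¹) * b := by simp; ring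
      _ ≤ C * b := by rw [hC]; gcongr; linarith
  have hcomp (x : CSpace n) : ‖s x - F x‖ ^ 2 * (Real.exp (-Ψ x) * tameWeight a x) ≤
      ‖s x - F x‖ ^ 2 * Real.exp (-poleWeight Ψ a τ x) := by
    rw [exp_neg_poleWeight hτ0, tameWeight]
    gcongr
    nlinarith
  have hint : Integrable fun x => ‖s x - F x‖ ^ 2 * (Real.exp (-Ψ x) * tameWeight a x) := by
    refine hFi.mono' (Continuous.aestronglyMeasurable ?_) (.of_forall fun x => ?_)
    · have h1 := hs.continuous
      have h2 := hF.continuous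
      have h3 := hΨ.continuous
      have h4 := continuous_tameWeight a
      fun_prop
    · have := tameWeight_pos a x
      rw [Real.norm_of_nonneg (by positivity)]
      exact hcomp x
  have hball := setIntegral_ball_le_of_poleWeight (hs.continuous.sub hF.continuous) hm0 hτ0
    (fun y hy => hp (mem_closedBall_iff_norm.2 ((mem_ball_iff_norm.1 hy).le.trans hτ1))) hFi hbound
  have hs0 : ∫ y in Metric.ball a τ, ‖F y‖ ^ 2 = ∫ y in Metric.ball a τ, ‖s y - F y‖ ^ 2 := by
    refine setIntegral_congr_fun measurableSet_ball fun y hy => ?_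
    rw [mem_ball_iff_norm] at hy
    have hs0 : s y = 0 := by
      by_contra h
      have := hdL y (hsL (subset_tsupport s h))
      linarith
    simp [hs0]
  rw [mul_assoc] at hball
  exact ⟨F, hF, (norm_sq_le_of_setIntegral_ball_le hF hτ0 (hs0.trans_le hball)).trans hDτ, hint,
    (integral_mono hint hFi hcomp).trans hbound⟩

end WeightedEstimate

/-- Local holomorphic functions with real part `h`, agreeing up to imaginary constants on
overlaps, together with cutoff functions subordinate to their domains. -/
structure PhaseCover (n : ℕ) (ι : Type*) [Fintype ι] (h : CSpace n → ℝ) where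
  domain : ι → Set (CSpace n)
  phase : ι → CSpace n → ℂ
  shift : ι → ι → ℝ
  cutoff : ι → CSpace n → ℝ
  isOpen_domain : ∀ i, IsOpen (domain i)
  contDiffOn_phase : ∀ i, ContDiffOn ℝ ∞ (phase i) (domain i)
  differentiableOn_phase : ∀ i, DifferentiableOn ℂ (phase i) (domain i)
  re_phase : ∀ i, ∀ x ∈ domain i, (phase i x).re = h x
  phase_eq : ∀ i j, ∀ x ∈ domain i ∩ domain j, phase i x = phase j x + shift i j * I
  contDiff_cutoff : ∀ i, ContDiff ℝ ∞ (cutoff i)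
  hasCompactSupport_cutoff : ∀ i, HasCompactSupport (cutoff i)
  tsupport_cutoff : ∀ i, tsupport (cutoff i) ⊆ domain i
  cutoff_nonneg : ∀ i x, 0 ≤ cutoff i x

namespace PhaseCover

variable {n : ℕ} {ι : Type*} [Fintype ι] {h : CSpace n → ℝ} (P : PhaseCover n ι h) {x : CSpace n}
  {N : ℕ} {δ : ℝ} {i j : ι}

/-- The patched function `∑ χᵢ exp (N gᵢ)`. -/
noncomputable def patch (N : ℕ) (x : CSpace n) : ℂ :=
  ∑ i, P.cutoff i x * cexp (N * P.phase i x)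

theorem norm_cexp_phase (hx : x ∈ P.domain i) :
    ‖cexp (N * P.phase i x)‖ = Real.exp (N * h x) := by
  rw [norm_exp, ← P.re_phase i x hx]
  simp

theorem norm_cexp_phase_sub_le (hδ : ∀ i j, ‖cexp (N * (P.shift i j * I)) - 1‖ ≤ δ)
    (hi : x ∈ P.domain i) (hj : x ∈ P.domain j) :
    ‖cexp (N * P.phase i x) - cexp (N * P.phase j x)‖ ≤ δ * Real.exp (N * h x) := by
  have h1 : cexp (N * P.phase i x) - cexp (N * P.phase j x) =
      (cexp (N * (P.shift i j * I)) - 1) * cexp (N * P.phase j x) := by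
    rw [P.phase_eq i j x ⟨hi, hj⟩, mul_add, Complex.exp_add]
    ring
  rw [h1, norm_mul, P.norm_cexp_phase hj]
  gcongr
  exact hδ i j

theorem isTest_cutoff (i : ι) : IsTest fun y => (P.cutoff i y : ℂ) :=
  ⟨(P.contDiff_cutoff i).ofReal_comp, (P.hasCompactSupport_cutoff i).comp_left ofReal_zero⟩

theorem eventually_cutoff_eq_zero (hx : x ∉ P.domain i) : P.cutoff i =ᶠ[𝓝 x] fun _ => 0 :=
  notMem_tsupport_iff_eventuallyEq.1 fun h => hx (P.tsupport_cutoff i h)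

theorem contDiffAt_phase (hx : x ∈ P.domain i) : ContDiffAt ℝ ∞ (P.phase i) x :=
  (P.contDiffOn_phase i).contDiffAt ((P.isOpen_domain i).mem_nhds hx)

theorem isTest_cutoff_mul (N : ℕ) (i : ι) :
    IsTest fun y => P.cutoff i y * cexp (N * P.phase i y) := by
  refine ⟨contDiff_iff_contDiffAt.2 fun x => ?_, (P.isTest_cutoff i).2.mul_right⟩
  by_cases hx : x ∈ P.domain i
  · exact (P.isTest_cutoff i).1.contDiffAt.mul (contDiffAt_const.mul (P.contDiffAt_phase hx)).cexp
  · refine (contDiffAt_const (c := (0 : ℂ))).congr_of_eventuallyEq ?_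
    filter_upwards [P.eventually_cutoff_eq_zero hx] with y hy
    simp [hy]

theorem isTest_patch (N : ℕ) : IsTest (P.patch N) :=
  IsTest.sum _ fun i _ => P.isTest_cutoff_mul N i

theorem wirt_cutoff_mul (N : ℕ) (i : ι) (w : CSpace n) :
    wirt I w (fun y => P.cutoff i y * cexp (N * P.phase i y)) x =
      wirt I w (fun y => (P.cutoff i y : ℂ)) x * cexp (N * P.phase i x) := by
  by_cases hx : x ∈ P.domain i
  · have hd : DifferentiableAt ℂ (fun y => cexp (N * P.phase i y)) x :=
      (((P.differentiableOn_phase i).differentiableAt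
        ((P.isOpen_domain i).mem_nhds hx)).const_mul _).cexp
    have h0 : wirt I w (fun y => cexp (N * P.phase i y)) x = 0 := by
      rw [wirt, fderiv_real_apply_I hd, ← mul_assoc, I_mul_I]
      ring
    rw [wirt_mul (P.isTest_cutoff i).differentiable.differentiableAt (hd.restrictScalars ℝ), h0]
    ring
  · have h1 : (fun y => (P.cutoff i y : ℂ)) =ᶠ[𝓝 x] fun _ => 0 := by
      filter_upwards [P.eventually_cutoff_eq_zero hx] with y hy
      simp [hy]
    have h2 : (fun y => P.cutoff i y * cexp (N * P.phase i y)) =ᶠ[𝓝 x] fun _ => 0 := by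
      filter_upwards [h1] with y hy
      simp [hy]
    rw [wirt_congr h1, wirt_congr h2]
    simp [wirt_const]

theorem wirt_cutoff_eq_zero (w : CSpace n) (hx : x ∉ P.domain i) :
    wirt I w (fun y => (P.cutoff i y : ℂ)) x = 0 := by
  have h1 : (fun y => (P.cutoff i y : ℂ)) =ᶠ[𝓝 x] fun _ => 0 := by
    filter_upwards [P.eventually_cutoff_eq_zero hx] with y hy
    simp [hy]
  rw [wirt_congr h1, wirt_const]

theorem wirt_patch (N : ℕ) (w : CSpace n) : wirt I w (P.patch N) x =
    ∑ i, wirt I w (fun y => (P.cutoff i y : ℂ)) x * cexp (N * P.phase i x) := by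
  unfold patch
  rw [wirt_sum _ fun i _ => (P.isTest_cutoff_mul N i).differentiable.differentiableAt]
  exact Finset.sum_congr rfl fun i _ => P.wirt_cutoff_mul N i w

theorem norm_wirt_patch_le (N : ℕ) (w : CSpace n) : ‖wirt I w (P.patch N) x‖ ≤
    (∑ i, ‖wirt I w (fun y => (P.cutoff i y : ℂ)) x‖) * Real.exp (N * h x) := by
  rw [wirt_patch, Finset.sum_mul]
  refine (norm_sum_le _ _).trans (Finset.sum_le_sum fun i _ => ?_)
  by_cases hx : x ∈ P.domain i
  · rw [norm_mul, P.norm_cexp_phase hx]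
  · simp [P.wirt_cutoff_eq_zero w hx]

theorem exists_mem_domain (hx : ∑ i, P.cutoff i x = 1) : ∃ j, x ∈ P.domain j := by
  by_contra! hn
  have : ∑ i, P.cutoff i x = 0 :=
    Finset.sum_eq_zero fun i _ => (P.eventually_cutoff_eq_zero (hn i)).eq_of_nhds
  simp [this] at hx

theorem norm_wirt_patch_le_of_sum_eq_one
    (hδ : ∀ i j, ‖cexp (N * (P.shift i j * I)) - 1‖ ≤ δ)
    (w : CSpace n) (hx : ∀ᶠ y in 𝓝 x, ∑ i, P.cutoff i y = 1) : ‖wirt I w (P.patch N) x‖ ≤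
      (∑ i, ‖wirt I w (fun y => (P.cutoff i y : ℂ)) x‖) * (δ * Real.exp (N * h x)) := by
  obtain ⟨j, hj⟩ := P.exists_mem_domain hx.self_of_nhds
  have h0 : ∑ i, wirt I w (fun y => (P.cutoff i y : ℂ)) x = 0 := by
    rw [← wirt_sum _ fun i _ => (P.isTest_cutoff i).differentiable.differentiableAt]
    have : (fun y => ∑ i, (P.cutoff i y : ℂ)) =ᶠ[𝓝 x] fun _ => 1 := by
      filter_upwards [hx] with y hy
      exact_mod_cast hy
    rw [wirt_congr this, wirt_const]
  have h1 : wirt I w (P.patch N) x = ∑ i, wirt I w (fun y => (P.cutoff i y : ℂ)) x *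
      (cexp (N * P.phase i x) - cexp (N * P.phase j x)) := by
    simp only [mul_sub, Finset.sum_sub_distrib, ← Finset.sum_mul, h0]
    rw [wirt_patch, zero_mul, sub_zero]
  rw [h1, Finset.sum_mul]
  refine (norm_sum_le _ _).trans (Finset.sum_le_sum fun i _ => ?_)
  by_cases hi : x ∈ P.domain i
  · rw [norm_mul]
    gcongr
    exact P.norm_cexp_phase_sub_le hδ hi hj
  · simp [P.wirt_cutoff_eq_zero w hi]

theorem norm_patch_sub_le (hδ : ∀ i j, ‖cexp (N * (P.shift i j * I)) - 1‖ ≤ δ)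
    (hx : ∑ i, P.cutoff i x = 1) (hj : x ∈ P.domain j) :
    ‖P.patch N x - cexp (N * P.phase j x)‖ ≤ δ * Real.exp (N * h x) := by
  have h1 : P.patch N x - cexp (N * P.phase j x) =
      ∑ i, P.cutoff i x * (cexp (N * P.phase i x) - cexp (N * P.phase j x)) := by
    simp only [mul_sub, Finset.sum_sub_distrib, ← Finset.sum_mul, patch]
    rw [← ofReal_sum, hx, ofReal_one, one_mul]
  rw [h1, ← one_mul (δ * _), ← hx, Finset.sum_mul]
  refine (norm_sum_le _ _).trans (Finset.sum_le_sum fun i _ => ?_)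
  by_cases hi : x ∈ P.domain i
  · rw [norm_mul, norm_real, Real.norm_of_nonneg (P.cutoff_nonneg i x)]
    have := P.cutoff_nonneg i x
    gcongr
    exact P.norm_cexp_phase_sub_le hδ hi hj
  · simp [(P.eventually_cutoff_eq_zero hi).eq_of_nhds]

theorem exists_sum_norm_wirt_cutoff_le :
    ∃ A : ℝ, 0 ≤ A ∧ ∀ k x, ∑ i, ‖wirt I (cbasis k) (fun y => (P.cutoff i y : ℂ)) x‖ ≤ A := by
  have hb (k : Fin n) (i : ι) :
      ∃ C, ∀ x, ‖wirt I (cbasis k) (fun y => (P.cutoff i y : ℂ)) x‖ ≤ C :=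
    (P.isTest_cutoff i).wirt.2.exists_bound_of_continuous (P.isTest_cutoff i).wirt.continuous
  choose C hC using hb
  have h0 (k : Fin n) : 0 ≤ ∑ i, C k i :=
    Finset.sum_nonneg fun i _ => (norm_nonneg _).trans (hC k i 0)
  exact ⟨∑ k, ∑ i, C k i, Finset.sum_nonneg fun k _ => h0 k, fun k x =>
    (Finset.sum_le_sum fun i _ => hC k i x).trans
      (Finset.single_le_sum (f := fun k => ∑ i, C k i) (fun k _ => h0 k) (Finset.mem_univ k))⟩

theorem tsupport_patch_subset {L : Set (CSpace n)} (hL : IsClosed L)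
    (hcut : ∀ i, tsupport (P.cutoff i) ⊆ L) (N : ℕ) : tsupport (P.patch N) ⊆ L := by
  refine closure_minimal (fun x hx => ?_) hL
  obtain ⟨i, -, hi⟩ := Finset.exists_ne_zero_of_sum_ne_zero (Function.mem_support.1 hx)
  refine hcut i (subset_tsupport _ fun h0 => hi ?_)
  simp [h0]

theorem norm_wirt_patch_sq_le {L T : Set (CSpace n)} {Ψ : CSpace n → ℝ} {κ A : ℝ}
    (hL : IsClosed L) (hcut : ∀ i, tsupport (P.cutoff i) ⊆ L)
    (hT : ∀ x ∈ T, ∑ i, P.cutoff i x = 1) (hΨL : ∀ x ∈ L, h x ≤ Ψ x)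
    (hΨT : ∀ x ∈ L, x ∉ interior T → h x + κ ≤ Ψ x)
    (hδ : ∀ i j, ‖cexp (N * (P.shift i j * I)) - 1‖ ≤ δ) {w : CSpace n}
    (hA : ∀ x, ∑ i, ‖wirt I w (fun y => (P.cutoff i y : ℂ)) x‖ ≤ A) (x : CSpace n) :
    ‖wirt I w (P.patch N) x‖ ^ 2 ≤
      A ^ 2 * (δ ^ 2 + Real.exp (-(2 * N * κ))) * Real.exp (2 * N * Ψ x) := by
  have hA0 : 0 ≤ A := (Finset.sum_nonneg fun i _ => norm_nonneg _).trans (hA x)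
  by_cases hx : x ∈ L
  · by_cases hxT : x ∈ interior T
    · have hev : ∀ᶠ y in 𝓝 x, ∑ i, P.cutoff i y = 1 := by
        filter_upwards [mem_interior_iff_mem_nhds.1 hxT] with y hy using hT y hy
      obtain ⟨j, -⟩ := P.exists_mem_domain hev.self_of_nhds
      have hδ0 : 0 ≤ δ := (norm_nonneg _).trans (hδ j j)
      calc _ ≤ (A * (δ * Real.exp (N * Ψ x))) ^ 2 := by
            gcongr
            refine (P.norm_wirt_patch_le_of_sum_eq_one hδ w hev).trans ?_
            gcongr
            · exact hA x
            · exact hΨL x hx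
        _ = A ^ 2 * (δ ^ 2 + 0) * Real.exp (2 * N * Ψ x) := by
            rw [mul_pow, mul_pow, ← Real.exp_nat_mul]
            push_cast
            ring_nf
        _ ≤ _ := by
            gcongr
            positivity
    · calc _ ≤ (A * Real.exp (N * (Ψ x - κ))) ^ 2 := by
            gcongr
            refine (P.norm_wirt_patch_le N w).trans ?_
            gcongr
            · exact hA x
            · linarith [hΨT x hx hxT]
        _ = A ^ 2 * (0 + Real.exp (-(2 * N * κ))) * Real.exp (2 * N * Ψ x) := by
            rw [mul_pow, ← Real.exp_nat_mul, zero_add, mul_assoc, ← Real.exp_add]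
            push_cast
            ring_nf
        _ ≤ _ := by
            gcongr
            positivity
  · have h0 : P.patch N =ᶠ[𝓝 x] fun _ => 0 :=
      notMem_tsupport_iff_eventuallyEq.1 fun h => hx (P.tsupport_patch_subset hL hcut N h)
    rw [wirt_congr h0, wirt_const]
    simp only [norm_zero, ne_eq, OfNat.ofNat_ne_zero, not_false_eq_true, zero_pow]
    positivity

end PhaseCover

theorem exists_phaseCover {n : ℕ} {h : CSpace n → ℝ} {L T N : Set (CSpace n)} (hL : IsCompact L)
    (hN : IsOpen N) (hT : IsClosed T) (hTL : T ⊆ interior L) (hLN : L ⊆ N)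
    (hh : ∀ x ∈ N, ContDiffAt ℝ ∞ h x) (h0 : ∀ x ∈ N, ∀ w, leviForm h x w = 0) :
    ∃ (t : Finset (CSpace n)) (P : PhaseCover n t h), (∀ i, tsupport (P.cutoff i) ⊆ L) ∧
      ∀ x ∈ T, ∑ i, P.cutoff i x = 1 := by
  have hr (x : CSpace n) : ∃ r > 0, x ∈ L → Metric.ball x r ⊆ N := by
    by_cases hx : x ∈ L
    · obtain ⟨r, hr, hrN⟩ := Metric.isOpen_iff.1 hN x (hLN hx)
      exact ⟨r, hr, fun _ => hrN⟩
    · exact ⟨1, one_pos, fun h => absurd h hx⟩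
  choose r hr0 hrN using hr
  obtain ⟨t, htL, ht⟩ := hL.elim_nhds_subcover (fun x => Metric.ball x (r x))
    fun x _ => Metric.ball_mem_nhds x (hr0 x)
  have hG (i : t) : ∃ G : CSpace n → ℂ, ContDiffOn ℝ ∞ G (Metric.ball i (r i)) ∧
      DifferentiableOn ℂ G (Metric.ball i (r i)) ∧ ∀ x ∈ Metric.ball (i : CSpace n) (r i),
        (G x).re = h x :=
    exists_differentiableOn_re_eq (convex_ball _ _) Metric.isOpen_ball
      (fun x hx => hh x (hrN i (htL i i.2) hx)) fun x hx => h0 x (hrN i (htL i i.2) hx)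
  choose G hGs hGd hGre using hG
  have hc (i j : t) : ∃ c : ℝ, ∀ x ∈ Metric.ball (i : CSpace n) (r i) ∩ Metric.ball j (r j),
      G i x = G j x + c * I :=
    exists_eqOn_I_mul_of_re_eq ((convex_ball _ _).inter (convex_ball _ _))
      (Metric.isOpen_ball.inter Metric.isOpen_ball) ((hGd i).mono inter_subset_left)
      ((hGd j).mono inter_subset_right) fun x hx => by rw [hGre i x hx.1, hGre j x hx.2]
  choose c hc using hc
  obtain ⟨χ, hχ, hχc, hχV, hχ0, hχT⟩ := exists_isTest_sum_eq_one hT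
    (V := fun i : t => Metric.ball (i : CSpace n) (r i) ∩ interior L)
    (fun i => Metric.isOpen_ball.inter isOpen_interior)
    (fun i => Metric.isBounded_ball.subset inter_subset_left) fun x hx => by
      obtain ⟨i, hi, hxi⟩ := mem_iUnion₂.1 (ht (interior_subset (hTL hx)))
      exact mem_iUnion.2 ⟨⟨i, hi⟩, hxi, hTL hx⟩
  exact ⟨t,
    { domain := fun i => Metric.ball i (r i)
      phase := G
      shift := c
      cutoff := χ
      isOpen_domain := fun i => Metric.isOpen_ball
      contDiffOn_phase := hGs
      differentiableOn_phase := hGd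
      re_phase := hGre
      phase_eq := hc
      contDiff_cutoff := hχ
      hasCompactSupport_cutoff := hχc
      tsupport_cutoff := fun i => (hχV i).trans inter_subset_left
      cutoff_nonneg := hχ0 },
    fun i => (hχV i).trans (inter_subset_right.trans interior_subset), hχT⟩

namespace PhaseCover

variable {n : ℕ} {ι : Type*} [Fintype ι] {h : CSpace n → ℝ} (P : PhaseCover n ι h) {x : CSpace n}
  {N : ℕ} {δ : ℝ} {j : ι} {Ψ q : CSpace n → ℝ}

theorem norm_mul_cexp_neg_sub_one_sq_le (hδ : ∀ i j, ‖cexp (N * (P.shift i j * I)) - 1‖ ≤ δ)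
    {r : ℝ} (hr : 0 < r) (hrj : Metric.ball x r ⊆ P.domain j)
    (hsum : ∀ y ∈ Metric.ball x r, ∑ i, P.cutoff i y = 1)
    (hΨ : ∀ y ∈ Metric.ball x r, Ψ y = h y) {q₀ B : ℝ} (hq₀ : 0 < q₀) (hq0 : ∀ y, 0 ≤ q y)
    (hq : ∀ y ∈ Metric.ball x r, q₀ ≤ q y) {F : CSpace n → ℂ} (hF : Differentiable ℂ F)
    (hi : Integrable fun y => ‖P.patch N y - F y‖ ^ 2 * (Real.exp (-(2 * N * Ψ y)) * q y))
    (hB : ∫ y, ‖P.patch N y - F y‖ ^ 2 * (Real.exp (-(2 * N * Ψ y)) * q y) ≤ B) :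
    ‖F x * cexp (-(N * P.phase j x)) - 1‖ ^ 2 ≤
      meanConst n r * (2 / q₀ * B + 2 * δ ^ 2 * volume.real (Metric.ball (0 : CSpace n) r)) := by
  have hmc : 0 ≤ meanConst n r := integral_nonneg fun t => sq_nonneg _
  set H : CSpace n → ℂ := fun y => F y * cexp (-(N * P.phase j y)) - 1 with hH
  have hHd : DifferentiableOn ℂ H (Metric.ball x r) :=
    (hF.differentiableOn.mul
      (((P.differentiableOn_phase j).mono hrj).const_mul _).neg.cexp).sub_const 1
  have hpt (y) (hy : y ∈ Metric.ball x r) : ‖H y‖ ^ 2 ≤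
      2 / q₀ * (‖P.patch N y - F y‖ ^ 2 * (Real.exp (-(2 * N * Ψ y)) * q y)) + 2 * δ ^ 2 := by
    set E := cexp (N * P.phase j y) with hE
    have hE0 : ‖E‖ = Real.exp (N * h y) := P.norm_cexp_phase (hrj hy)
    have hEne : E ≠ 0 := Complex.exp_ne_zero _
    have h1 : H y = (F y - P.patch N y) * E⁻¹ + (P.patch N y - E) * E⁻¹ := by
      simp only [hH, Complex.exp_neg]
      rw [← hE]
      field_simp
      ring
    have h2 : ‖(P.patch N y - E) * E⁻¹‖ ≤ δ := by
      rw [norm_mul, norm_inv, ← div_eq_mul_inv, div_le_iff₀ (norm_pos_iff.2 hEne), hE0]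
      exact P.norm_patch_sub_le hδ (hsum y hy) (hrj hy)
    have h3 : ‖(F y - P.patch N y) * E⁻¹‖ ^ 2 =
        ‖P.patch N y - F y‖ ^ 2 * Real.exp (-(2 * N * Ψ y)) := by
      rw [norm_mul, norm_inv, hE0, hΨ y hy, norm_sub_rev, mul_pow, ← Real.exp_neg,
        ← Real.exp_nat_mul]
      push_cast
      ring_nf
    have h4 : ‖H y‖ ^ 2 ≤ 2 * ‖(F y - P.patch N y) * E⁻¹‖ ^ 2 + 2 * δ ^ 2 := by
      have h5 : ‖H y‖ ≤ ‖(F y - P.patch N y) * E⁻¹‖ + δ := by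
        rw [h1]
        exact (norm_add_le _ _).trans (by gcongr)
      have h6 := norm_nonneg (H y)
      nlinarith [sq_nonneg (‖(F y - P.patch N y) * E⁻¹‖ - δ)]
    have h7 : ‖P.patch N y - F y‖ ^ 2 * Real.exp (-(2 * N * Ψ y)) ≤
        1 / q₀ * (‖P.patch N y - F y‖ ^ 2 * (Real.exp (-(2 * N * Ψ y)) * q y)) := by
      rw [div_mul_eq_mul_div, one_mul, le_div_iff₀ hq₀, mul_assoc]
      gcongr
      exact hq y hy
    rw [h3] at h4
    have h8 : 2 / q₀ = 2 * (1 / q₀) := by ring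
    rw [h8]
    linarith
  have hmaj : IntegrableOn (fun y => 2 / q₀ *
      (‖P.patch N y - F y‖ ^ 2 * (Real.exp (-(2 * N * Ψ y)) * q y)) + 2 * δ ^ 2)
      (Metric.ball x r) :=
    (hi.integrableOn.const_mul _).add (integrableOn_const measure_ball_lt_top.ne)
  have hHi : IntegrableOn (fun y => ‖H y‖ ^ 2) (Metric.ball x r) := by
    refine Integrable.mono' hmaj ?_ ((ae_restrict_iff' measurableSet_ball).2
      (.of_forall fun y hy => ?_))
    · exact (hHd.continuousOn.norm.pow 2).aestronglyMeasurable measurableSet_ball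
    · rw [Real.norm_of_nonneg (sq_nonneg _)]
      exact hpt y hy
  refine (norm_sq_le_of_differentiableOn hr hHd hHi).trans ?_
  gcongr
  calc _ ≤ ∫ y in Metric.ball x r, (2 / q₀ *
        (‖P.patch N y - F y‖ ^ 2 * (Real.exp (-(2 * N * Ψ y)) * q y)) + 2 * δ ^ 2) :=
        setIntegral_mono_on hHi hmaj measurableSet_ball hpt
    _ = 2 / q₀ * (∫ y in Metric.ball x r,
          ‖P.patch N y - F y‖ ^ 2 * (Real.exp (-(2 * N * Ψ y)) * q y)) +
        2 * δ ^ 2 * volume.real (Metric.ball (0 : CSpace n) r) := by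
        rw [integral_add (hi.integrableOn.const_mul _)
          (integrableOn_const measure_ball_lt_top.ne), integral_const_mul, setIntegral_const,
          smul_eq_mul, mul_comm (volume.real _), Measure.real, Measure.real,
          Measure.addHaar_ball_center]
    _ ≤ _ := by
        gcongr
        refine (setIntegral_le_integral hi (.of_forall fun y => ?_)).trans hB
        have := hq0 y
        positivity

end PhaseCover

/-- A continuous positive function on a compact set has a positive lower bound. -/
theorem IsCompact.exists_pos_forall_le {X : Type*} [TopologicalSpace X] {s : Set X} {f : X → ℝ}
    (hs : IsCompact s) (hf : ContinuousOn f s) (h0 : ∀ x ∈ s, 0 < f x) :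
    ∃ m, 0 < m ∧ ∀ x ∈ s, m ≤ f x := by
  obtain rfl | hne := s.eq_empty_or_nonempty
  · exact ⟨1, one_pos, by simp⟩
  · obtain ⟨x, hx, hmin⟩ := hs.exists_isMinOn hne hf
    exact ⟨f x, h0 x hx, fun y hy => hmin hy⟩

theorem exists_nat_forall_exp_neg_le {κ η : ℝ} (hκ : 0 < κ) (hη : 0 < η) :
    ∃ N₀ : ℕ, ∀ N : ℕ, N₀ ≤ N → Real.exp (-(2 * N * κ)) ≤ η := by
  have h : Tendsto (fun N : ℕ => Real.exp (-(2 * N * κ))) atTop (𝓝 0) := by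
    refine Real.tendsto_exp_neg_atTop_nhds_zero.comp ?_
    exact (tendsto_natCast_atTop_atTop.const_mul_atTop two_pos).atTop_mul_const hκ
  exact eventually_atTop.1 (h.eventually (ge_mem_nhds hη))

namespace PhaseCover

variable {n : ℕ} {ι : Type*} [Fintype ι] {h Ψ : CSpace n → ℝ} (P : PhaseCover n ι h)
  {L T V K : Set (CSpace n)} {κ : ℝ} {a : CSpace n}

theorem exists_ball_subset (hK : IsCompact K) (hV : IsOpen V) (hKV : K ⊆ V)
    (hsum : ∀ x ∈ V, ∑ i, P.cutoff i x = 1) :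
    ∃ r, 0 < r ∧ ∀ x ∈ K, ∃ j, Metric.ball x r ⊆ V ∩ P.domain j := by
  refine lebesgue_number_lemma_of_metric hK (fun j => hV.inter (P.isOpen_domain j)) fun x hx => ?_
  obtain ⟨j, hj⟩ := P.exists_mem_domain (hsum x (hKV hx))
  exact mem_iUnion.2 ⟨j, hKV hx, hj⟩

theorem exists_differentiable_ne_zero (hL : IsCompact L) (haL : a ∉ L)
    (hcut : ∀ i, tsupport (P.cutoff i) ⊆ L) (hT : ∀ x ∈ T, ∑ i, P.cutoff i x = 1)
    (hK : IsCompact K) (hh : ContinuousOn h K) (hV : IsOpen V) (hKV : K ⊆ V) (hVT : V ⊆ T)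
    (hΨ : ContDiff ℝ ∞ Ψ) (hΨ0 : ∀ x w, 0 ≤ leviForm Ψ x w) (hΨV : ∀ x ∈ V, Ψ x = h x)
    (hΨL : ∀ x ∈ L, h x ≤ Ψ x) (hκ : 0 < κ)
    (hΨT : ∀ x ∈ L, x ∉ interior T → h x + κ ≤ Ψ x) :
    ∃ f : CSpace n → ℂ, Differentiable ℂ f ∧ f a = 0 ∧ ∀ z ∈ K, f z ≠ 0 := by
  obtain ⟨r, hr, hrV⟩ := P.exists_ball_subset hK hV hKV fun x hx => hT x (hVT hx)
  obtain ⟨q₀, hq₀, hq⟩ := (hK.cthickening (r := r)).exists_pos_forall_le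
    (continuous_tameWeight a).continuousOn fun x _ => tameWeight_pos a x
  obtain ⟨C, hC, hsmall⟩ := exists_differentiable_small_at hL haL
  obtain ⟨A, hA0, hA⟩ := P.exists_sum_norm_wirt_cutoff_le
  have hmc : 0 ≤ meanConst n r := integral_nonneg fun t => sq_nonneg _
  set v := volume.real (Metric.ball (0 : CSpace n) r)
  set Q := meanConst n r * (4 / q₀ * (C * A ^ 2) + 2 * v) with hQ
  have hQ0 : 0 ≤ Q := by positivity
  set η := 1 / (4 * (Q + 1)) with hη
  have hη0 : 0 < η := by positivity
  have hδ0 : 0 < min η 1 := lt_min hη0 one_pos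
  obtain ⟨N₀, hN₀⟩ := exists_nat_forall_exp_neg_le hκ hη0
  obtain ⟨N, hN, hshift⟩ := exists_nat_norm_exp_sub_one_lt
    (fun p : ι × ι => P.shift p.1 p.2) hδ0 N₀
  have hδ (i j) : ‖cexp (N * (P.shift i j * I)) - 1‖ ≤ min η 1 := (hshift (i, j)).le
  have hδη : min η 1 ^ 2 ≤ η := by
    nlinarith [min_le_left η 1, min_le_right η 1]
  set b := A ^ 2 * (min η 1 ^ 2 + Real.exp (-(2 * N * κ))) with hb
  have hbη : b ≤ A ^ 2 * (2 * η) := by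
    have := hN₀ N hN
    rw [hb]
    gcongr
    linarith
  obtain ⟨m, hm, hmK⟩ := hK.exists_pos_forall_le (f := fun x => 1 / 2 * Real.exp (N * h x))
    (by fun_prop) fun x _ => by positivity
  have hlevi (x w) : 0 ≤ leviForm (fun y => 2 * N * Ψ y) x w := by
    rw [leviForm_const_mul _ (hΨ.contDiffAt.of_le two_le_infty)]
    exact mul_nonneg (by positivity) (hΨ0 x w)
  obtain ⟨F, hF, hFa, hFi, hFb⟩ := hsmall (fun y => 2 * N * Ψ y) (contDiff_const.mul hΨ) hlevi
    (P.patch N) (P.isTest_patch N) (P.tsupport_patch_subset hL.isClosed hcut N) b (by positivity)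
    (fun k x => P.norm_wirt_patch_sq_le hL.isClosed hcut hT hΨL hΨT hδ (hA k) x)
    ((m / 2) ^ 2) (by positivity)
  have hFK (x) (hx : x ∈ K) : m ≤ ‖F x‖ := by
    obtain ⟨j, hj⟩ := hrV x hx
    have h1 := P.norm_mul_cexp_neg_sub_one_sq_le hδ hr (hj.trans inter_subset_right)
      (fun y hy => hT y (hVT (hj hy).1)) (fun y hy => hΨV y (hj hy).1) hq₀
      (fun y => (tameWeight_pos a y).le)
      (fun y hy => hq y (Metric.closedBall_subset_cthickening hx r
        (Metric.ball_subset_closedBall hy))) hF hFi hFb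
    have h2 : meanConst n r * (2 / q₀ * (C * b) + 2 * min η 1 ^ 2 * v) ≤ (1 / 2) ^ 2 := by
      calc _ ≤ meanConst n r * (2 / q₀ * (C * (A ^ 2 * (2 * η))) + 2 * η * v) := by gcongr
        _ = Q * η := by rw [hQ]; ring
        _ ≤ (Q + 1) * η := by gcongr; linarith
        _ = (1 / 2) ^ 2 := by rw [hη]; field_simp; norm_num
    have h3 := abs_le_of_sq_le_sq (h1.trans h2) (by norm_num)
    rw [abs_of_nonneg (norm_nonneg _)] at h3
    have hxj : x ∈ P.domain j := (hj (Metric.mem_ball_self hr)).2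
    have h4 : 1 / 2 ≤ ‖F x * cexp (-(N * P.phase j x))‖ := by
      have := norm_sub_norm_le (1 : ℂ) (F x * cexp (-(N * P.phase j x)))
      rw [norm_one, norm_sub_rev] at this
      linarith
    rw [norm_mul, Complex.exp_neg, norm_inv, P.norm_cexp_phase hxj, ← div_eq_mul_inv,
      le_div_iff₀ (Real.exp_pos _)] at h4
    exact (hmK x hx).trans h4
  have hFa' : ‖F a‖ ≤ m / 2 := by
    have := abs_le_of_sq_le_sq hFa (by positivity)
    rwa [abs_of_nonneg (norm_nonneg _)] at this
  refine ⟨fun z => F z - F a, hF.sub_const _, sub_self _, fun z hz h0 => ?_⟩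
  have h1 := hFK z hz
  rw [sub_eq_zero.1 h0] at h1
  linarith

end PhaseCover

/-- A smooth convex nondecreasing function vanishing on `(-∞, -3δ]` and equal to `t + C`
on `[-δ, ∞)`. -/
theorem exists_convex_cutoff {δ : ℝ} (hδ : 0 < δ) : ∃ (g g' g'' : ℝ → ℝ) (C κ : ℝ),
    ContDiff ℝ ∞ g ∧ (∀ t, HasDerivAt g (g' t) t) ∧ (∀ t, HasDerivAt g' (g'' t) t) ∧
      (∀ t, 0 ≤ g' t) ∧ (∀ t, 0 ≤ g'' t) ∧ (∀ t, 0 ≤ g t) ∧ (∀ t ≤ -(3 * δ), g t = 0) ∧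
      (∀ t, -δ ≤ t → g t = t + C) ∧ 0 < κ ∧ ∀ t, -(2 * δ) ≤ t → κ ≤ g t := by
  set σ : ℝ → ℝ := fun t => Real.smoothTransition ((t + 3 * δ) / (2 * δ)) with hσ
  have hσs : ContDiff ℝ ∞ σ := Real.smoothTransition.contDiff.comp
    ((contDiff_id.add contDiff_const).div_const _)
  have hσc : Continuous σ := hσs.continuous
  have hσ0 (t : ℝ) : 0 ≤ σ t := Real.smoothTransition.nonneg _
  have hσm : Monotone σ := fun s t hst =>
    Real.smoothTransition.monotone (by gcongr)
  have hσd (t : ℝ) : HasDerivAt σ (deriv σ t) t :=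
    (hσs.differentiable (by simp) t).hasDerivAt
  set g : ℝ → ℝ := fun t => ∫ s in (-(3 * δ))..t, σ s with hg
  have hgd (t : ℝ) : HasDerivAt g (σ t) t := hσc.integral_hasStrictDerivAt _ _ |>.hasDerivAt
  have hgs : ContDiff ℝ ∞ g := by
    rw [contDiff_infty_iff_deriv, funext fun t => (hgd t).deriv]
    exact ⟨fun t => (hgd t).differentiableAt, hσs⟩
  have hgm : Monotone g := monotone_of_deriv_nonneg (fun t => (hgd t).differentiableAt)
    fun t => by rw [(hgd t).deriv]; exact hσ0 t
  have hg0 (t : ℝ) (ht : t ≤ -(3 * δ)) : g t = 0 := by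
    rw [hg]
    refine (intervalIntegral.integral_congr (g := fun _ => 0) fun s hs => ?_).trans (by simp)
    rw [uIcc_of_ge ht] at hs
    exact Real.smoothTransition.zero_of_nonpos
      (div_nonpos_of_nonpos_of_nonneg (by linarith [hs.2]) (by positivity))
  have hg3 : g (-(3 * δ)) = 0 := hg0 _ le_rfl
  refine ⟨g, σ, deriv σ, g (-δ) + δ, g (-(2 * δ)), hgs, hgd, hσd, hσ0,
    fun t => hσm.deriv_nonneg, fun t => ?_, hg0, fun t ht => ?_, ?_, fun t ht => hgm ht⟩
  · obtain h | h := le_total t (-(3 * δ))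
    · exact (hg0 t h).ge
    · exact hg3.ge.trans (hgm h)
  · have h1 : ∫ s in (-δ)..t, σ s = t + δ := by
      refine (intervalIntegral.integral_congr (g := fun _ => 1) fun s hs => ?_).trans (by simp)
      rw [uIcc_of_le ht] at hs
      refine Real.smoothTransition.one_of_one_le ?_
      rw [le_div_iff₀ (by positivity)]
      linarith [hs.1]
    have h2 := intervalIntegral.integral_add_adjacent_intervals
      (hσc.intervalIntegrable (-(3 * δ)) (-δ)) (hσc.intervalIntegrable (-δ) t) (μ := volume)
    rw [h1] at h2
    simp only [hg]
    linarith
  · refine intervalIntegral.intervalIntegral_pos_of_pos_on (hσc.intervalIntegrable _ _)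
      (fun s hs => Real.smoothTransition.pos_of_pos ?_) (by linarith)
    have := hs.1
    exact div_pos (by linarith) (by positivity)

theorem exists_differentiable_ne_zero_of_sublevel {n : ℕ} {K Ω W N : Set (CSpace n)}
    {ρ ψ : CSpace n → ℝ} {a : CSpace n} (hK : IsCompact K) (hΩ : IsOpen Ω) (hW : IsOpen W)
    (hρ : ContDiffOn ℝ ∞ ρ W) (hρ0 : ∀ x ∈ W, ∀ w, 0 ≤ leviForm ρ x w) (hKΩ : K ⊆ Ω)
    (haΩ : a ∉ Ω) (hΩc : IsCompact (closure Ω)) (hΩρ : Ω = {z | z ∈ W ∧ ρ z < 0})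
    (hψ : ContDiff ℝ ∞ ψ) (hψ0 : ∀ x w, 0 ≤ leviForm ψ x w) (hN : IsOpen N)
    (hΩN : closure Ω ⊆ N) (hNW : N ⊆ W)
    (hψρ : ∀ x ∈ N, ∀ w, leviForm (fun z => ψ z - ρ z) x w = 0) :
    ∃ f : CSpace n → ℂ, Differentiable ℂ f ∧ f a = 0 ∧ ∀ z ∈ K, f z ≠ 0 := by
  have hΩW : closure Ω ⊆ W := hΩN.trans hNW
  have hΩ0 (z) (hz : z ∈ Ω) : ρ z < 0 := by
    rw [hΩρ] at hz
    exact hz.2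
  have hρat (z) (hz : z ∈ W) : ContDiffAt ℝ ∞ ρ z := hρ.contDiffAt (hW.mem_nhds hz)
  have hρc : ContinuousOn ρ (closure Ω) := hρ.continuousOn.mono hΩW
  obtain ⟨m, hm, hmK⟩ := hK.exists_pos_forall_le (f := fun z => -ρ z)
    (hρc.neg.mono (hKΩ.trans subset_closure)) fun z hz => neg_pos.2 (hΩ0 z (hKΩ hz))
  obtain ⟨δ, hδ, hδm⟩ : ∃ δ, 0 < δ ∧ 3 * δ < m := ⟨m / 4, by linarith, by linarith⟩
  obtain ⟨g, g', g'', C, κ, hgs, hgd, hgd', hg'0, hg''0, hg0, hg1, hg2, hκ, hgκ⟩ :=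
    exists_convex_cutoff hδ
  have hclosed (c : ℝ) : IsClosed {z | z ∈ closure Ω ∧ ρ z ≤ c} :=
    hρc.preimage_isClosed_of_isClosed isClosed_closure isClosed_Iic
  have hopen (c : ℝ) : IsOpen {z | z ∈ Ω ∧ ρ z < c} :=
    (hρc.mono subset_closure).isOpen_inter_preimage hΩ isOpen_Iio
  set L := {z | z ∈ closure Ω ∧ ρ z ≤ -δ} with hL
  set T := {z | z ∈ closure Ω ∧ ρ z ≤ -(2 * δ)} with hT
  have hLc : IsCompact L := hΩc.of_isClosed_subset (hclosed _) fun z hz => hz.1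
  have hLΩ : L ⊆ Ω := fun z hz => by
    rw [hΩρ]
    exact ⟨hΩW hz.1, by linarith [hz.2]⟩
  have hTL : T ⊆ interior L := fun z hz => by
    refine interior_maximal (s := L) (t := {z | z ∈ Ω ∧ ρ z < -δ})
      (fun y hy => ⟨subset_closure hy.1, hy.2.le⟩) (hopen _) ⟨hLΩ ⟨hz.1, ?_⟩, ?_⟩ <;>
    linarith [hz.2]
  have hIT (x) (hx : x ∈ L) (hxT : x ∉ interior T) : -(2 * δ) ≤ ρ x := by
    by_contra! h
    exact hxT (interior_maximal (s := T) (t := {z | z ∈ Ω ∧ ρ z < -(2 * δ)})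
      (fun y hy => ⟨subset_closure hy.1, hy.2.le⟩) (hopen _) ⟨hLΩ hx, h⟩)
  have hh (x) (hx : x ∈ N) : ContDiffAt ℝ ∞ (fun z => ψ z - ρ z) x :=
    hψ.contDiffAt.sub (hρat x (hNW hx))
  obtain ⟨t, P, hcut, hsum⟩ := exists_phaseCover hLc hN (hclosed _) hTL
    (fun z hz => hΩN hz.1) hh hψρ
  classical
  set Ψ : CSpace n → ℝ := fun z => if z ∈ Ω then ψ z - ρ z + g (ρ z) else ψ z + C with hΨ
  have hΨin (z) (hz : z ∈ Ω) : Ψ z = ψ z - ρ z + g (ρ z) := if_pos hz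
  have hΨout (z) (hz : z ∉ L) : Ψ z = ψ z + C := by
    by_cases h : z ∈ Ω
    · have : -δ ≤ ρ z := by
        by_contra! h'
        exact hz ⟨subset_closure h, h'.le⟩
      rw [hΨin z h, hg2 _ this]
      ring
    · exact if_neg h
  have hΨin' (z) (hz : z ∈ Ω) : Ψ =ᶠ[𝓝 z] fun z => ψ z - ρ z + g (ρ z) :=
    mem_of_superset (hΩ.mem_nhds hz) hΨin
  have hΨout' (z) (hz : z ∉ Ω) : Ψ =ᶠ[𝓝 z] fun z => ψ z + C :=
    mem_of_superset (hLc.isClosed.isOpen_compl.mem_nhds fun h => hz (hLΩ h)) hΨout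
  have hgρ (z) (hz : z ∈ Ω) : ContDiffAt ℝ ∞ (fun z => g (ρ z)) z :=
    hgs.contDiffAt.comp z (hρat z (hΩW (subset_closure hz)))
  have hΨs : ContDiff ℝ ∞ Ψ := contDiff_iff_contDiffAt.2 fun z => by
    by_cases hz : z ∈ Ω
    · exact ((hh z (hΩN (subset_closure hz))).add (hgρ z hz)).congr_of_eventuallyEq (hΨin' z hz)
    · exact (hψ.contDiffAt.add contDiffAt_const).congr_of_eventuallyEq (hΨout' z hz)
  have hΨ0 (z w) : 0 ≤ leviForm Ψ z w := by
    by_cases hz : z ∈ Ω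
    · have hzN := hΩN (subset_closure hz)
      rw [leviForm_congr (hΨin' z hz), leviForm_add ((hh z hzN).of_le two_le_infty)
        ((hgρ z hz).of_le two_le_infty), hψρ z hzN, zero_add,
        leviForm_comp ((hρat z (hNW hzN)).of_le two_le_infty) (.of_forall hgd) (hgd' _)]
      have h1 := hρ0 z (hNW hzN) w
      have h2 := hg'0 (ρ z)
      have h3 := hg''0 (ρ z)
      positivity
    · rw [leviForm_congr (hΨout' z hz), leviForm_add (hψ.contDiffAt.of_le two_le_infty)
        contDiffAt_const, leviForm_const, add_zero]
      exact hψ0 z w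
  refine P.exists_differentiable_ne_zero (V := {z | z ∈ Ω ∧ ρ z < -(3 * δ)}) hLc
    (fun h => haΩ (hLΩ h)) hcut hsum hK (fun x hx => ?_) (hopen _) (fun x hx => ⟨hKΩ hx, ?_⟩)
    (fun x hx => ⟨subset_closure hx.1, ?_⟩) hΨs hΨ0 (fun x hx => ?_) (fun x hx => ?_) hκ
    fun x hx hxT => ?_
  · exact (hh x (hΩN (subset_closure (hKΩ hx)))).continuousAt.continuousWithinAt
  · linarith [hmK x hx]
  · linarith [hx.2]
  · rw [hΨin x hx.1, hg1 _ hx.2.le, add_zero]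
  · rw [hΨin x (hLΩ hx)]
    linarith [hg0 (ρ x)]
  · rw [hΨin x (hLΩ hx)]
    linarith [hgκ _ (hIT x hx hxT)]

theorem leviForm_nonneg_of_pos {n : ℕ} {φ : CSpace n → ℝ} {x : CSpace n}
    (h : ∀ w, w ≠ 0 → 0 < leviForm φ x w) (w : CSpace n) : 0 ≤ leviForm φ x w := by
  obtain rfl | hw := eq_or_ne w 0
  · simp [leviForm_eq]
  · exact (h w hw).le

end

/-- a compact `K ⊂ ℂⁿ` is convex with respect to principal hypersurfaces iff
it admits a neighborhood basis of strictly plurisubharmonic sublevel sets `Ω = {ρ < 0}`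
such that `dd^c ρ` extends off a neighborhood of `closure Ω` to a trivial Hodge form
(expressed via a global smooth strictly plurisubharmonic `ψ` with `ψ - ρ` pluriharmonic
near `closure Ω`). -/
theorem stmt1 (n : ℕ) (hn : 1 ≤ n) (K : Set (EuclideanSpace ℂ (Fin n))) (hKc : IsCompact K) :
    PrincipalConvex K ↔
      ∀ U : Set (EuclideanSpace ℂ (Fin n)), IsOpen U → K ⊆ U →
        ∃ (Ω W : Set (EuclideanSpace ℂ (Fin n))) (ρ : EuclideanSpace ℂ (Fin n) → ℝ),
          IsOpen Ω ∧ IsOpen W ∧ closure Ω ⊆ W ∧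
          ContDiffOn ℝ (⊤ : ℕ∞) ρ W ∧
          (∀ x ∈ W, ∀ w : EuclideanSpace ℂ (Fin n), w ≠ 0 → 0 < leviForm ρ x w) ∧
          K ⊆ Ω ∧ Ω ⊆ U ∧ IsCompact (closure Ω) ∧
          Ω = {z | z ∈ W ∧ ρ z < 0} ∧
          ∃ ψ : EuclideanSpace ℂ (Fin n) → ℝ, ContDiff ℝ (⊤ : ℕ∞) ψ ∧
            (∀ x : EuclideanSpace ℂ (Fin n), ∀ w : EuclideanSpace ℂ (Fin n), w ≠ 0 →
              0 < leviForm ψ x w) ∧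
            ∃ N : Set (EuclideanSpace ℂ (Fin n)), IsOpen N ∧ closure Ω ⊆ N ∧ N ⊆ W ∧
              ∀ x ∈ N, ∀ w : EuclideanSpace ℂ (Fin n),
                leviForm (fun z => ψ z - ρ z) x w = 0 := by
  refine ⟨fun hP U hU hKU => forward_direction hKc hP hU hKU, fun H a ha => ?_⟩
  obtain ⟨Ω, W, ρ, hΩ, hW, -, hρ, hρ0, hKΩ, hΩU, hΩc, hΩρ, ψ, hψ, hψ0, N, hN, hΩN, hNW, hψρ⟩ :=
    H {a}ᶜ isOpen_compl_singleton fun z hz h => ha (h ▸ hz)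
  exact exists_differentiable_ne_zero_of_sublevel hKc hΩ hW hρ
    (fun x hx => leviForm_nonneg_of_pos (hρ0 x hx)) hKΩ (fun h => hΩU h rfl) hΩc hΩρ hψ
    (fun x => leviForm_nonneg_of_pos (hψ0 x)) hN hΩN hNW hψρ
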